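/- Let H = 1/6, let (Ω,F,P) be a probability space, and let X¹, X² : ℝ → Ω → ℝ be two independent centered Gaussian processes, each with covariance C_{1/6} and with continuous sample paths. Let f ∈ C_b^∞(ℝ²) and fix t ≥ 0. Set σ_f(ω)² = κ₁² ∫₀ᵗ (∂₁₁₁f(X¹_s,X²_s))² ds + κ₂² ∫₀ᵗ (∂₂₂₂f(X¹_s,X²_s))² ds + κ₃² ∫₀ᵗ (∂₁₂₂f(X¹_s,X²_s))² ds + κ₄² ∫₀ᵗ (∂₁₁₂f(X¹_s,X²_s))² ds. Then for every m ≥ 1, every ψ ∈ C_b^∞(ℝ^{2m}), all times s₁,…,s_m ∈ ℝ and every λ ∈ ℝ: lim_{n→∞} E[ ψ(X¹_{s₁},X²_{s₁},…,X¹_{s_m},X²_{s_m}) · exp(iλ O_n(f,t)) ] = E[ ψ(X¹_{s₁},X²_{s₁},…,X¹_{s_m},X²_{s_m}) · exp(iλ (f(X¹_t,X²_t) − f(0,0))) · exp(−(λ²/2) σ_f²) ]. (This encodes the change-of-variable formula in law f(X_t) − f(0) − ∫₀ᵗ D³f(X_s) d³X_s = ∫₀ᵗ ∇f(X_s) d*X_s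 for the critical Hurst index H = 1/6.) -/

import Mathlib

open MeasureTheory ProbabilityTheory Filter

noncomputable section

/-- Covariance function of the (two-sided) fractional Brownian motion with Hurst index `H`:
`C_H(t,s) = (|t|^{2H} + |s|^{2H} − |t−s|^{2H})/2`. -/
def covH (H t s : ℝ) : ℝ :=
  (|t| ^ (2 * H) + |s| ^ (2 * H) - |t - s| ^ (2 * H)) / 2

/-- `ρ_H(k) = (1/2)(|k+1|^{2H} + |k−1|^{2H} − 2|k|^{2H})`. -/
def rhoH (H : ℝ) (k : ℤ) : ℝ :=
  (|(k : ℝ) + 1| ^ (2 * H) + |(k : ℝ) - 1| ^ (2 * H) - 2 * |(k : ℝ)| ^ (2 * H)) / 2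

/-- `X` is a centered Gaussian process with covariance function `C` under `P`: every finite
linear combination of values of the process is a centered real Gaussian random variable with
the appropriate variance. -/
def IsCenteredGaussianProcess {Ω : Type*} [MeasurableSpace Ω] (P : Measure Ω)
    (X : ℝ → Ω → ℝ) (C : ℝ → ℝ → ℝ) : Prop :=
  (∀ t, Measurable (X t)) ∧
  ∀ (m : ℕ) (ts : Fin m → ℝ) (c : Fin m → ℝ),
    Measure.map (fun ω => ∑ i, c i * X (ts i) ω) P =
      gaussianReal 0 (Real.toNNReal (∑ i, ∑ j, c i * c j * C (ts i) (ts j)))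

/-- The σ-algebras generated by the two processes `X1` and `X2` are independent under `P`. -/
def IndepProcesses {Ω : Type*} [MeasurableSpace Ω] (P : Measure Ω)
    (X1 X2 : ℝ → Ω → ℝ) : Prop :=
  ProbabilityTheory.Indep
    (⨆ t : ℝ, MeasurableSpace.comap (X1 t) inferInstance)
    (⨆ t : ℝ, MeasurableSpace.comap (X2 t) inferInstance) P

/-- `g` is infinitely differentiable and bounded together with all its derivatives. -/
def CbSmooth {E : Type*} [NormedAddCommGroup E] [NormedSpace ℝ E] (g : E → ℝ) : Prop :=
  (∀ n : ℕ, ContDiff ℝ n g) ∧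
  ∀ k : ℕ, ∃ M : ℝ, ∀ x : E, ‖iteratedFDeriv ℝ k g x‖ ≤ M

/-- `f : ℝ² → ℝ` (in curried form) belongs to `C_b^∞(ℝ²)`. -/
def CbSmooth2 (f : ℝ → ℝ → ℝ) : Prop :=
  CbSmooth fun p : ℝ × ℝ => f p.1 p.2

/-- Partial derivative of `f : ℝ → ℝ → ℝ`, taken `k` times in the first variable and `l` times
in the second variable. -/
def pd (k l : ℕ) (f : ℝ → ℝ → ℝ) (x y : ℝ) : ℝ :=
  iteratedDeriv k (fun u => iteratedDeriv l (fun v => f u v) y) x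

/-- The dyadic point `j·2^{−n/2}`. -/
def dyadicPt (n j : ℕ) : ℝ := (j : ℝ) * (2 : ℝ) ^ (-(n : ℝ) / 2)

/-- The number of dyadic steps `⌊2^{n/2} t⌋`. -/
def nSteps (n : ℕ) (t : ℝ) : ℕ := Nat.floor ((2 : ℝ) ^ ((n : ℝ) / 2) * t)

variable {Ω : Type*}

/-- The increment `X_{(j+1)2^{−n/2}} − X_{j2^{−n/2}}` of the process `X`. -/
def Xincr (X : ℝ → Ω → ℝ) (n j : ℕ) (ω : Ω) : ℝ :=
  X (dyadicPt n (j + 1)) ω - X (dyadicPt n j) ω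

/-- The midpoint evaluation `Δ_{j,n} g(X¹,X²)`. -/
def Xmid (X1 X2 : ℝ → Ω → ℝ) (g : ℝ → ℝ → ℝ) (n j : ℕ) (ω : Ω) : ℝ :=
  g ((X1 (dyadicPt n (j + 1)) ω + X1 (dyadicPt n j) ω) / 2)
    ((X2 (dyadicPt n (j + 1)) ω + X2 (dyadicPt n j) ω) / 2)

namespace CriticalHurst

open Function
open scoped ContDiff ENNReal NNReal Topology

/-- Directional derivative of `F` in the fixed direction `c`. -/
def dv {E G : Type*} [NormedAddCommGroup E] [NormedSpace ℝ E] [NormedAddCommGroup G]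
    [NormedSpace ℝ G] (c : E) (F : E → G) : E → G := fun z => fderiv ℝ F z c

section Temperate

variable {E G : Type*} [NormedAddCommGroup E] [NormedSpace ℝ E] [NormedAddCommGroup G]
  [NormedSpace ℝ G]

lemma hasTemperateGrowth_fderiv {F : E → G} (hF : F.HasTemperateGrowth) :
    (fderiv ℝ F).HasTemperateGrowth := by
  refine ⟨hF.1.fderiv_right (by simp), fun n => ?_⟩
  obtain ⟨k, C, h⟩ := hF.2 (n + 1)
  exact ⟨k, C, fun x => by rw [norm_iteratedFDeriv_fderiv]; exact h x⟩

lemma hasTemperateGrowth_dv {F : E → G} (hF : F.HasTemperateGrowth) (c : E) :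
    (dv c F).HasTemperateGrowth :=
  ((ContinuousLinearMap.apply ℝ G c).hasTemperateGrowth).comp (hasTemperateGrowth_fderiv hF)

lemma differentiable_of_temperate {F : E → G} (hF : F.HasTemperateGrowth) :
    Differentiable ℝ F := hF.1.differentiable (by simp)

variable [MeasurableSpace E] [BorelSpace E] [FiniteDimensional ℝ E]

lemma integrable_of_temperate {μ : Measure E} [IsGaussian μ] {F : E → G}
    (hF : F.HasTemperateGrowth) : Integrable F μ := by
  have : CompleteSpace E := FiniteDimensional.complete ℝ E
  obtain ⟨k, C, h⟩ := hF.2 0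
  have hm : MemLp (fun z : E => z) (k : ℝ≥0∞) μ := IsGaussian.memLp_id μ k (by simp)
  have h1 : Integrable (fun z : E => (1 + ‖z‖) ^ k) μ := by
    have h3 : MemLp (fun _ : E => (1 : ℝ)) (k : ℝ≥0∞) μ := memLp_const 1
    have h2 : MemLp (fun z : E => (1 + ‖z‖)) (k : ℝ≥0∞) μ := h3.add hm.norm
    have := h2.integrable_norm_pow'
    refine this.congr (Eventually.of_forall fun z => ?_)
    simp only [Real.norm_eq_abs]
    rw [abs_of_nonneg (by positivity)]
  refine (h1.const_mul C).mono' (hF.1.continuous.aestronglyMeasurable) (Eventually.of_forall fun z => ?_)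
  simpa using h z

end Temperate

/-- One-dimensional Gaussian integration by parts. -/
lemma stein_gaussianReal {G : Type*} [NormedAddCommGroup G] [NormedSpace ℝ G] 
    {v : ℝ≥0} (hv : v ≠ 0) {g g' : ℝ → G} (hg : ∀ x, HasDerivAt g (g' x) x)
    (h0 : Integrable g (gaussianReal 0 v)) (h1 : Integrable (fun x => x • g x) (gaussianReal 0 v))
    (h2 : Integrable g' (gaussianReal 0 v)) :
    ∫ x, x • g x ∂gaussianReal 0 v = (v : ℝ) • ∫ x, g' x ∂gaussianReal 0 v := by
  have hpdf : ∀ x, HasDerivAt (gaussianPDFReal 0 v) (-(x / v) * gaussianPDFReal 0 v x) x := by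
    intro x
    have hv' : (v : ℝ) ≠ 0 := by exact_mod_cast hv
    have h : HasDerivAt (fun x : ℝ => -(x - 0) ^ 2 / (2 * v)) (-(x / v)) x := by
      have := ((((hasDerivAt_id x).sub_const 0).pow 2).neg).div_const (2 * (v : ℝ))
      refine this.congr_deriv ?_
      simp; field_simp
    have := (h.exp).const_mul ((√(2 * Real.pi * v))⁻¹)
    refine this.congr_deriv ?_
    simp only [gaussianPDFReal]
    ring
  have hI : ∀ {u : ℝ → G}, Integrable u (gaussianReal 0 v) →
      Integrable (fun x => gaussianPDFReal 0 v x • u x) := by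
    intro u hu
    rw [gaussianReal_of_var_ne_zero 0 hv] at hu
    rw [integrable_withDensity_iff_integrable_smul₀' (measurable_gaussianPDF 0 v).aemeasurable
      (Eventually.of_forall fun _ => gaussianPDF_lt_top)] at hu
    simpa [toReal_gaussianPDF] using hu
  have key := integral_bilinear_hasDerivAt_right_eq_neg_left_of_integrable
    (L := ContinuousLinearMap.lsmul ℝ ℝ) (u := gaussianPDFReal 0 v) (v := g)
    (u' := fun x => -(x / v) * gaussianPDFReal 0 v x) (v' := g') (fun x _ => hpdf x)
    (fun x _ => hg x) (by simpa using hI h2) ?_ (by simpa using hI h0)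
  · rw [integral_gaussianReal_eq_integral_smul hv, integral_gaussianReal_eq_integral_smul hv]
    simp only [ContinuousLinearMap.lsmul_apply] at key
    rw [key, ← integral_neg, ← integral_smul]
    congr 1; ext x
    rw [smul_smul, ← neg_smul, smul_smul]
    congr 1
    have hv' : (v : ℝ) ≠ 0 := by exact_mod_cast hv
    field_simp
  · have := (hI h1).smul (-(1 / (v : ℝ)))
    refine this.congr (Eventually.of_forall fun x => ?_)
    simp only [Pi.smul_apply, ContinuousLinearMap.lsmul_apply, smul_smul]
    congr 1; ring

section IBP

variable {E : Type*} [NormedAddCommGroup E] [NormedSpace ℝ E] [MeasurableSpace E] [BorelSpace E]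
  [FiniteDimensional ℝ E] {μ : Measure E}

/-- A Gaussian measure all of whose linear functionals are centered. -/
structure CGauss (μ : Measure E) : Prop where
  gauss : IsGaussian μ
  centered : ∀ l : E →L[ℝ] ℝ, ∫ z, l z ∂μ = 0

/-- The covariance vector of the functional `ξ`. -/
def cvec (μ : Measure E) (ξ : E →L[ℝ] ℝ) : E := ∫ z, ξ z • z ∂μ

lemma apply_cvec (hμ : CGauss μ) (ξ : E →L[ℝ] ℝ) {V : Type*} [NormedAddCommGroup V]
    [NormedSpace ℝ V] (L : E →L[ℝ] V) [CompleteSpace V] :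
    L (cvec μ ξ) = ∫ z, ξ z • L z ∂μ := by
  have := hμ.gauss
  have : CompleteSpace E := FiniteDimensional.complete ℝ E
  unfold cvec
  rw [← ContinuousLinearMap.integral_comp_comm]
  · simp
  · exact integrable_of_temperate (by fun_prop)

lemma ibp_gauss {G : Type*} [NormedAddCommGroup G] [NormedSpace ℝ G] (hμ : CGauss μ)
    (ξ : E →L[ℝ] ℝ) {F : E → G} (hF : F.HasTemperateGrowth) :
    ∫ z, ξ z • F z ∂μ = ∫ z, dv (cvec μ ξ) F z ∂μ := by
  have := hμ.gauss
  have : CompleteSpace E := FiniteDimensional.complete ℝ E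
  have hc := apply_cvec hμ ξ (V := ℝ)
  set c := cvec μ ξ with hcdef
  have hmapInt : ∀ {H : Type _} [NormedAddCommGroup H] [NormedSpace ℝ H] {F : E → H},
    F.HasTemperateGrowth → Integrable F μ := fun h => integrable_of_temperate h
  have hmap : μ.map ξ = gaussianReal 0 (Var[ξ; μ]).toNNReal := by
    rw [IsGaussian.map_eq_gaussianReal ξ, hμ.centered ξ]
  have hvar : Var[ξ; μ] = ξ c := by
    rw [variance_eq_sub, hμ.centered ξ, hc]
    · simp [pow_two]
    · exact IsGaussian.memLp_dual μ ξ 2 (by simp)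
  set v := (Var[ξ; μ]).toNNReal with hv
  have hvc : (v : ℝ) = ξ c := by rw [hv, Real.coe_toNNReal _ (variance_nonneg _ _), hvar]
  by_cases hv0 : v = 0
  · have hξ0 : ∀ᵐ z ∂μ, ξ z = 0 := by
      have h1 : ∀ᵐ x ∂(μ.map ξ), x = 0 := by
        rw [hmap, hv0, gaussianReal_zero_var]
        exact (ae_dirac_iff (measurableSet_singleton 0)).2 rfl
      exact ae_of_ae_map (by fun_prop) h1
    have hcz : c = 0 := by
      rw [hcdef, cvec, integral_congr_ae (g := fun _ => (0 : E))]
      · simp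
      · filter_upwards [hξ0] with z hz; simp [hz]
    rw [hcz, integral_congr_ae (g := fun _ => (0 : G))]
    · simp [dv]
    · filter_upwards [hξ0] with z hz; simp [hz]
  have hvne : (v : ℝ) ≠ 0 := by exact_mod_cast hv0
  let W : E →L[ℝ] E := ContinuousLinearMap.id ℝ E - (((v : ℝ)⁻¹ • ξ).smulRight c)
  have hW : ∀ z, W z = z - ((v : ℝ)⁻¹ * ξ z) • c := fun z => by simp [W]
  have hind : IndepFun (ξ : E → ℝ) (W : E → E) μ := by
    have hlaw : HasGaussianLaw (fun z => (ξ z, W z)) μ :=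
      (IsGaussian.hasGaussianLaw_id (μ := μ)).map_fun (ξ.prod W)
    refine hlaw.indepFun_of_covariance_strongDual fun L₁ L₂ => ?_
    have m1 : MemLp (L₁ ∘ ξ) 2 μ := IsGaussian.memLp_dual μ (L₁.comp ξ) 2 (by simp)
    have m2 : MemLp (L₂ ∘ W) 2 μ := IsGaussian.memLp_dual μ (L₂.comp W) 2 (by simp)
    rw [covariance_eq_sub m1 m2]
    have e1 : μ[L₁ ∘ ξ] = 0 := hμ.centered (L₁.comp ξ)
    have e2 : ∫ z, (L₁ ∘ ξ * L₂ ∘ W) z ∂μ = L₁ 1 * (L₂ (W c)) := by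
      have := hc (L₂.comp W)
      simp only [ContinuousLinearMap.comp_apply] at this
      rw [this, ← integral_const_mul]
      congr 1; ext z
      have : L₁ (ξ z) = ξ z * L₁ 1 := by
        rw [← smul_eq_mul, ← map_smul]; simp
      simp only [Pi.mul_apply, Function.comp_apply, this, smul_eq_mul]; ring
    have hWc : W c = 0 := by
      rw [hW, ← hvc, inv_mul_cancel₀ hvne]; simp
    rw [e2, e1, hWc]; simp
  have hprod : μ.map (fun z => (ξ z, W z)) = (gaussianReal 0 v).prod (μ.map W) := by
    rw [(indepFun_iff_map_prod_eq_prod_map_map (by fun_prop) (by fun_prop)).1 hind, hmap]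
  have hmeas : Measurable (fun z => (ξ z, W z)) := by fun_prop
  have : IsProbabilityMeasure (μ.map W) := Measure.isProbabilityMeasure_map (by fun_prop)
  -- transfer to the product
  have transfer : ∀ {k : ℝ × E → G}, Continuous k → (fun z => k (ξ z, W z)).HasTemperateGrowth →
      Integrable k ((gaussianReal 0 v).prod (μ.map W)) ∧
      ∫ z, k (ξ z, W z) ∂μ = ∫ w, ∫ x, k (x, w) ∂(gaussianReal 0 v) ∂(μ.map W) := by
    intro k hk ht
    have hi : Integrable k ((gaussianReal 0 v).prod (μ.map W)) := by
      rw [← hprod]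
      exact (integrable_map_measure hk.aestronglyMeasurable hmeas.aemeasurable).2 (hmapInt ht)
    refine ⟨hi, ?_⟩
    rw [← integral_prod_symm _ hi, ← hprod, integral_map hmeas.aemeasurable hk.aestronglyMeasurable]
  have hrec : ∀ z, ((v : ℝ)⁻¹ * ξ z) • c + W z = z := fun z => by rw [hW]; abel
  have hdF := hasTemperateGrowth_dv hF c
  have t1 := transfer (k := fun p => p.1 • F (((v : ℝ)⁻¹ * p.1) • c + p.2))
    (by have := hF.1.continuous; fun_prop) (by simp only [hrec]; fun_prop)
  have t2 := transfer (k := fun p => dv c F (((v : ℝ)⁻¹ * p.1) • c + p.2))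
    (by have := hdF.1.continuous; fun_prop) (by simp only [hrec]; fun_prop)
  simp only [hrec] at t1 t2
  rw [t1.2, t2.2]
  congr 1; ext w
  have gG : IsGaussian (gaussianReal 0 v) := inferInstance
  have hlin : (fun x : ℝ => ((v : ℝ)⁻¹ * x) • c + w).HasTemperateGrowth := by fun_prop
  have hg1 : (fun x : ℝ => F (((v : ℝ)⁻¹ * x) • c + w)).HasTemperateGrowth := hF.comp hlin
  have hg2 : (fun x : ℝ => dv c F (((v : ℝ)⁻¹ * x) • c + w)).HasTemperateGrowth := hdF.comp hlin
  have hst := stein_gaussianReal hv0 (g := fun x => F (((v : ℝ)⁻¹ * x) • c + w))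
    (g' := fun x => (v : ℝ)⁻¹ • dv c F (((v : ℝ)⁻¹ * x) • c + w)) ?_
    (integrable_of_temperate hg1) (integrable_of_temperate (by fun_prop))
    (integrable_of_temperate (by fun_prop))
  · rw [hst, integral_smul, smul_smul, mul_inv_cancel₀ hvne, one_smul]
  · intro x
    have h1 : HasDerivAt (fun x : ℝ => ((v : ℝ)⁻¹ * x) • c + w) ((v : ℝ)⁻¹ • c) x := by
      have := (((hasDerivAt_id x).const_mul (v : ℝ)⁻¹).smul_const c).add_const w
      simpa using this
    have h2 := ((differentiable_of_temperate hF) (((v : ℝ)⁻¹ * x) • c + w)).hasFDerivAt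
    exact (h2.comp_hasDerivAt x h1).congr_deriv (by simp [dv])

end IBP

/-- Smooth functions that are bounded together with all their derivatives. -/
def Cb {V G : Type*} [NormedAddCommGroup V] [NormedSpace ℝ V] [NormedAddCommGroup G]
    [NormedSpace ℝ G] (g : V → G) : Prop :=
  ContDiff ℝ ∞ g ∧ ∀ k : ℕ, ∃ M : ℝ, ∀ x, ‖iteratedFDeriv ℝ k g x‖ ≤ M

section Cb

variable {V V' G : Type*} [NormedAddCommGroup V] [NormedSpace ℝ V] [NormedAddCommGroup G]
  [NormedSpace ℝ G] [NormedAddCommGroup V'] [NormedSpace ℝ V']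

lemma Cb.temperate {g : V → G} (hg : Cb g) : g.HasTemperateGrowth :=
  ⟨hg.1, fun n => by obtain ⟨M, h⟩ := hg.2 n; exact ⟨0, M, by simpa using h⟩⟩

lemma Cb.uniform {g : V → G} (hg : Cb g) (n : ℕ) :
    ∃ M : ℝ, 0 ≤ M ∧ ∀ k ≤ n, ∀ x, ‖iteratedFDeriv ℝ k g x‖ ≤ M := by
  choose M hM using hg.2
  refine ⟨∑ k ∈ Finset.range (n + 1), |M k|, by positivity, fun k hk x => ?_⟩
  refine (hM k x).trans ((le_abs_self _).trans ?_)
  exact Finset.single_le_sum (f := fun k => |M k|) (fun _ _ => abs_nonneg _) (by simp; omega)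

lemma Cb.bound {g : V → G} (hg : Cb g) : ∃ M : ℝ, 0 ≤ M ∧ ∀ x, ‖g x‖ ≤ M := by
  obtain ⟨M, h0, h⟩ := hg.uniform 0
  exact ⟨M, h0, fun x => by simpa using h 0 le_rfl x⟩

lemma Cb.fderiv_bound {g : V → G} (hg : Cb g) : ∃ M : ℝ, 0 ≤ M ∧ ∀ x, ‖fderiv ℝ g x‖ ≤ M := by
  obtain ⟨M, h0, h⟩ := hg.uniform 1
  exact ⟨M, h0, fun x => by simpa [norm_iteratedFDeriv_one] using h 1 le_rfl x⟩

lemma Cb.lipschitz {g : V → G} (hg : Cb g) : ∃ M : ℝ, 0 ≤ M ∧ ∀ x y, ‖g x - g y‖ ≤ M * ‖x - y‖ := by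
  obtain ⟨M, h0, h⟩ := hg.fderiv_bound
  refine ⟨M, h0, fun x y => ?_⟩
  exact convex_univ.norm_image_sub_le_of_norm_fderiv_le (𝕜 := ℝ)
    (fun x _ => (hg.1.differentiable (by simp)) x) (fun x _ => h x) (Set.mem_univ y) (Set.mem_univ x)

lemma Cb.const (c : G) : Cb (fun _ : V => c) := by
  refine ⟨contDiff_const, fun k => ?_⟩
  rcases k with _ | k
  · exact ⟨‖c‖, fun x => by simp⟩
  · exact ⟨0, fun x => by rw [iteratedFDeriv_const_of_ne (by simp)]; simp⟩

lemma Cb.add {g h : V → G} (hg : Cb g) (hh : Cb h) : Cb (fun x => g x + h x) := by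
  refine ⟨hg.1.add hh.1, fun k => ?_⟩
  obtain ⟨M, h1⟩ := hg.2 k
  obtain ⟨M', h2⟩ := hh.2 k
  refine ⟨M + M', fun x => ?_⟩
  have hc : ∀ {f : V → G}, Cb f → ContDiff ℝ k f := fun hf => hf.1.of_le (by exact_mod_cast le_top)
  have : iteratedFDeriv ℝ k (fun x => g x + h x) x = _ :=
    iteratedFDeriv_add_apply (hc hg).contDiffAt (hc hh).contDiffAt
  rw [this]
  exact (norm_add_le _ _).trans (add_le_add (h1 x) (h2 x))

lemma Cb.clm_comp {G' : Type*} [NormedAddCommGroup G'] [NormedSpace ℝ G'] {g : V → G} (hg : Cb g)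
    (L : G →L[ℝ] G') : Cb (fun x => L (g x)) := by
  refine ⟨L.contDiff.comp hg.1, fun k => ?_⟩
  obtain ⟨M, h1⟩ := hg.2 k
  refine ⟨‖L‖ * M, fun x => ?_⟩
  exact (L.norm_iteratedFDeriv_comp_left (n := k)
    (hg.1.of_le (by exact_mod_cast le_top)).contDiffAt le_rfl).trans (by gcongr; exact h1 x)

lemma Cb.comp_clm {g : V → G} (hg : Cb g) (L : V' →L[ℝ] V) : Cb (fun x => g (L x)) := by
  refine ⟨hg.1.comp L.contDiff, fun k => ?_⟩
  obtain ⟨M, h1⟩ := hg.2 k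
  refine ⟨M * ‖L‖ ^ k, fun x => ?_⟩
  have := L.iteratedFDeriv_comp_right (n := k) (hg.1.of_le (by exact_mod_cast le_top)) x
    (i := k) le_rfl
  have e : (fun x => g (L x)) = g ∘ L := rfl
  rw [e, this]
  refine (ContinuousMultilinearMap.norm_compContinuousLinearMap_le _ _).trans ?_
  simp only [Finset.prod_const, Finset.card_univ, Fintype.card_fin]
  gcongr; exact h1 _

lemma Cb.mul {A : Type*} [NormedRing A] [NormedAlgebra ℝ A] {g h : V → A} (hg : Cb g) (hh : Cb h) :
    Cb (fun x => g x * h x) := by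
  refine ⟨hg.1.mul hh.1, fun k => ?_⟩
  obtain ⟨M, h0, h1⟩ := hg.uniform k
  obtain ⟨M', h0', h2⟩ := hh.uniform k
  refine ⟨∑ i ∈ Finset.range (k + 1), (k.choose i : ℝ) * M * M', fun x => ?_⟩
  refine (norm_iteratedFDeriv_mul_le (N := ∞) hg.1 hh.1 x (by exact_mod_cast le_top)).trans ?_
  gcongr with i hi
  · exact h1 _ (by simp at hi; omega) _
  · exact h2 _ (by omega) _

lemma Cb.neg {g : V → G} (hg : Cb g) : Cb (fun x => - g x) := by
  simpa using hg.clm_comp (-ContinuousLinearMap.id ℝ G)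

lemma Cb.sub {g h : V → G} (hg : Cb g) (hh : Cb h) : Cb (fun x => g x - h x) := by
  simpa [sub_eq_add_neg] using hg.add hh.neg

lemma Cb.const_mul {g : V → ℝ} (hg : Cb g) (c : ℝ) : Cb (fun x => c * g x) := 
  (Cb.const c).mul hg

lemma Cb.dv {g : V → G} (hg : Cb g) (c : V) : Cb (dv c g) := by
  refine ⟨(hasTemperateGrowth_dv hg.temperate c).1, fun k => ?_⟩
  obtain ⟨M, h1⟩ := hg.2 (k + 1)
  refine ⟨‖c‖ * M, fun x => ?_⟩
  refine (norm_iteratedFDeriv_clm_apply_const (N := k) (n := k)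
    (f := fderiv ℝ g) (c := c) ?_ le_rfl).trans ?_
  · exact (hg.1.fderiv_right (m := k) (by exact_mod_cast le_top)).contDiffAt
  · rw [norm_iteratedFDeriv_fderiv]; gcongr; exact h1 x

end Cb

lemma CbSmooth.cb {E : Type*} [NormedAddCommGroup E] [NormedSpace ℝ E] {g : E → ℝ}
    (h : CbSmooth g) : Cb g := ⟨contDiff_infty.2 h.1, h.2⟩

/-- Temperate functions whose derivatives up to order `n` are bounded by `M`. -/
structure BddDer {V : Type*} [NormedAddCommGroup V] [NormedSpace ℝ V] (n : ℕ) (M : ℝ)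
    (g : V → ℝ) : Prop where
  temperate : g.HasTemperateGrowth
  bound : ∀ k ≤ n, ∀ x, ‖iteratedFDeriv ℝ k g x‖ ≤ M

section BddDer
variable {V : Type*} [NormedAddCommGroup V] [NormedSpace ℝ V] {g : V → ℝ} {n m : ℕ} {M : ℝ}

lemma Cb.bddDer (hg : Cb g) (n : ℕ) : ∃ M, 0 ≤ M ∧ BddDer n M g := by
  obtain ⟨M, h0, h⟩ := hg.uniform n
  exact ⟨M, h0, hg.temperate, h⟩

lemma BddDer.mono (h : BddDer n M g) (hm : m ≤ n) : BddDer m M g :=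
  ⟨h.temperate, fun k hk => h.bound k (hk.trans hm)⟩

lemma BddDer.abs_le (h : BddDer n M g) (x : V) : |g x| ≤ M := by
  simpa using h.bound 0 (Nat.zero_le _) x

lemma BddDer.dv (h : BddDer (n + 1) M g) (c : V) : BddDer n (M * ‖c‖) (dv c g) := by
  refine ⟨hasTemperateGrowth_dv h.temperate c, fun k hk x => ?_⟩
  refine (norm_iteratedFDeriv_clm_apply_const (N := k) (n := k)
    (f := fderiv ℝ g) (c := c) ?_ le_rfl).trans ?_
  · exact (h.temperate.1.fderiv_right (m := k) (by exact_mod_cast le_top)).contDiffAt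
  · rw [norm_iteratedFDeriv_fderiv, mul_comm]; gcongr; exact h.bound _ (by omega) x

end BddDer

/-- Hermite polynomials with variance parameter `v`. -/
def herm (v : ℝ) : ℕ → ℝ → ℝ
  | 0, _ => 1
  | 1, x => x
  | n + 2, x => x * herm v (n + 1) x - (n + 1) * v * herm v n x

lemma herm_succ (v : ℝ) (n : ℕ) (x : ℝ) :
    herm v (n + 1) x = x * herm v n x - n * v * herm v (n - 1) x := by
  cases n <;> simp [herm]

lemma hasDerivAt_herm (v : ℝ) (n : ℕ) (x : ℝ) :
    HasDerivAt (herm v n) (n * herm v (n - 1) x) x := by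
  induction n using Nat.strong_induction_on with
  | _ n ih =>
    match n with
    | 0 => simpa [herm] using hasDerivAt_const x (1 : ℝ)
    | 1 => simpa [herm] using hasDerivAt_id' x
    | n + 2 =>
      have h1 := ih (n + 1) (by omega)
      have h0 := ih n (by omega)
      have := ((hasDerivAt_id x).mul h1).sub (h0.const_mul ((n + 1 : ℝ) * v))
      refine this.congr_deriv ?_
      simp only [Nat.add_sub_cancel, id, Nat.add_succ_sub_one]
      rw [herm_succ v n]; push_cast; ring

@[fun_prop]
lemma herm_temperate (v : ℝ) (n : ℕ) : (herm v n).HasTemperateGrowth := by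
  induction n using Nat.strong_induction_on with
  | _ n ih =>
    match n with
    | 0 => exact HasTemperateGrowth.const 1
    | 1 => exact HasTemperateGrowth.id'
    | n + 2 =>
      have h1 := ih (n + 1) (by omega)
      have h0 := ih n (by omega)
      have e : herm v (n + 2) = fun x => x * herm v (n + 1) x - (n + 1) * v * herm v n x := by
        ext x; rw [herm]
      rw [e]; fun_prop

section Gauss

variable {E : Type*} [NormedAddCommGroup E] [NormedSpace ℝ E]

lemma dv_mul {F G : E → ℝ} (hF : F.HasTemperateGrowth) (hG : G.HasTemperateGrowth) (c z : E) :
    dv c (fun z => F z * G z) z = dv c F z * G z + F z * dv c G z := by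
  simp only [dv]
  rw [fderiv_fun_mul (differentiable_of_temperate hF z) (differentiable_of_temperate hG z)]
  simp; ring

lemma dv_smul {H : Type*} [NormedAddCommGroup H] [NormedSpace ℝ H] {F : E → ℝ} {G : E → H}
    (hF : F.HasTemperateGrowth) (hG : G.HasTemperateGrowth) (c z : E) :
    dv c (fun z => F z • G z) z = dv c F z • G z + F z • dv c G z := by
  simp only [dv]
  rw [fderiv_fun_smul (differentiable_of_temperate hF z) (differentiable_of_temperate hG z)]
  simp; abel

lemma dv_comp_clm {V H : Type*} [NormedAddCommGroup V] [NormedSpace ℝ V] [NormedAddCommGroup H]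
    [NormedSpace ℝ H] {g : V → H} (hg : g.HasTemperateGrowth) (L : E →L[ℝ] V) (c z : E) :
    dv c (fun z => g (L z)) z = dv (L c) g (L z) := by
  have h := (differentiable_of_temperate hg (L z)).hasFDerivAt.comp z L.hasFDerivAt
  have h' : HasFDerivAt (fun z => g (L z)) _ z := h
  rw [dv, h'.fderiv]; simp [dv]

variable [MeasurableSpace E] {μ : Measure E}

/-- Hermite polynomial of the Gaussian functional `ξ`. -/
def gh (μ : Measure E) (p : ℕ) (ξ : E →L[ℝ] ℝ) (z : E) : ℝ := herm (ξ (cvec μ ξ)) p (ξ z)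

@[fun_prop]
lemma gh_temperate (p : ℕ) (ξ : E →L[ℝ] ℝ) : (gh μ p ξ).HasTemperateGrowth :=
  (herm_temperate _ p).comp ξ.hasTemperateGrowth

lemma gh_zero (ξ : E →L[ℝ] ℝ) (z : E) : gh μ 0 ξ z = 1 := rfl
lemma gh_one (ξ : E →L[ℝ] ℝ) (z : E) : gh μ 1 ξ z = ξ z := rfl

lemma dv_gh (c : E) (p : ℕ) (ξ : E →L[ℝ] ℝ) (z : E) :
    dv c (gh μ p ξ) z = p * ξ c * gh μ (p - 1) ξ z := by
  have h := (hasDerivAt_herm (ξ (cvec μ ξ)) p (ξ z)).comp_hasFDerivAt z ξ.hasFDerivAt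
  have : HasFDerivAt (gh μ p ξ) _ z := h
  rw [dv, this.fderiv]; simp [gh]; ring

variable [BorelSpace E] [FiniteDimensional ℝ E]

lemma integral_gh_succ {H : Type*} [NormedAddCommGroup H] [NormedSpace ℝ H] (hμ : CGauss μ) (p : ℕ)
    (ξ : E →L[ℝ] ℝ) {F : E → H} (hF : F.HasTemperateGrowth) :
    ∫ z, gh μ (p + 1) ξ z • F z ∂μ = ∫ z, gh μ p ξ z • dv (cvec μ ξ) F z ∂μ := by
  have := hμ.gauss
  have hd := hasTemperateGrowth_dv hF (cvec μ ξ)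
  have key := ibp_gauss hμ ξ (F := fun z => gh μ p ξ z • F z) (by fun_prop)
  simp only [dv_smul (gh_temperate p ξ) hF, dv_gh] at key
  rw [integral_add (integrable_of_temperate (by fun_prop))
    (integrable_of_temperate (by fun_prop))] at key
  have e : ∀ z, gh μ (p + 1) ξ z • F z = ξ z • gh μ p ξ z • F z -
      (p * ξ (cvec μ ξ) * gh μ (p - 1) ξ z) • F z := by
    intro z
    rw [smul_smul, ← sub_smul]; congr 1
    exact herm_succ _ _ _
  simp only [e]
  rw [integral_sub (integrable_of_temperate (by fun_prop))
    (integrable_of_temperate (by fun_prop)), key]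
  abel

lemma cvec_symm (hμ : CGauss μ) (ξ η : E →L[ℝ] ℝ) : ξ (cvec μ η) = η (cvec μ ξ) := by
  rw [apply_cvec hμ, apply_cvec hμ]
  simp [mul_comm]

end Gauss

/-- Bounds for mixed Hermite moments. -/
def hb (a b r : ℝ) : ℕ → ℕ → ℝ
  | 0, q => b ^ q
  | p + 1, q => a * hb a b r p q + q * r * hb a b r p (q - 1)

section Gauss

variable {E : Type*} [NormedAddCommGroup E] [NormedSpace ℝ E] {V : Type*} [NormedAddCommGroup V]
  [NormedSpace ℝ V] [MeasurableSpace E] {μ : Measure E} [BorelSpace E] [FiniteDimensional ℝ E]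

lemma mixed_succ (hμ : CGauss μ) (ξ η : E →L[ℝ] ℝ) (L : E →L[ℝ] V) {g : V → ℝ}
    (hg : g.HasTemperateGrowth) (p q : ℕ) :
    ∫ z, gh μ (p + 1) ξ z * gh μ q η z * g (L z) ∂μ =
      (∫ z, gh μ p ξ z * gh μ q η z * dv (L (cvec μ ξ)) g (L z) ∂μ) +
      q * η (cvec μ ξ) * ∫ z, gh μ p ξ z * gh μ (q - 1) η z * g (L z) ∂μ := by
  have := hμ.gauss
  have hgL : (fun z => g (L z)).HasTemperateGrowth := hg.comp L.hasTemperateGrowth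
  have hdg := hasTemperateGrowth_dv hg (L (cvec μ ξ))
  have hdgL : (fun z => dv (L (cvec μ ξ)) g (L z)).HasTemperateGrowth :=
    hdg.comp L.hasTemperateGrowth
  have key := integral_gh_succ hμ p ξ (F := fun z => gh μ q η z * g (L z)) (by fun_prop)
  simp only [smul_eq_mul, dv_mul (gh_temperate q η) hgL, dv_gh, dv_comp_clm hg] at key
  simp only [mul_assoc] at key ⊢
  rw [key, ← integral_const_mul, ← integral_const_mul, ← integral_add
    (integrable_of_temperate (by fun_prop)) (integrable_of_temperate (by fun_prop))]
  congr 1; ext z; ring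

lemma abs_mixed_le (hμ : CGauss μ) (ξ η : E →L[ℝ] ℝ) (L : E →L[ℝ] V) {r : ℝ}
    (hr : |η (cvec μ ξ)| ≤ r) (p : ℕ) : ∀ (q : ℕ) {M : ℝ} {g : V → ℝ}, BddDer (p + q) M g → 0 ≤ M →
    |∫ z, gh μ p ξ z * gh μ q η z * g (L z) ∂μ| ≤
      M * hb ‖L (cvec μ ξ)‖ ‖L (cvec μ η)‖ r p q := by
  have := hμ.gauss
  have hr0 : 0 ≤ r := (abs_nonneg _).trans hr
  induction p with
  | zero =>
    intro q
    simp only [gh_zero, one_mul, hb, zero_add]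
    induction q with
    | zero =>
      intro M g hg hM
      simp only [gh_zero, one_mul, pow_zero, mul_one]
      have := norm_integral_le_of_norm_le_const (μ := μ) (f := fun z => g (L z)) (C := M)
        (Eventually.of_forall fun z => hg.abs_le _)
      simpa using this
    | succ q ih =>
      intro M g hg hM
      have key := integral_gh_succ hμ q η (F := fun z => g (L z))
        (hg.temperate.comp L.hasTemperateGrowth)
      simp only [smul_eq_mul, dv_comp_clm hg.temperate] at key
      rw [key]
      exact (ih (hg.dv _) (by positivity)).trans (le_of_eq (by ring))
  | succ p ih =>
    intro q M g hg hM
    rw [mixed_succ hμ ξ η L hg.temperate, hb]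
    have h1 := ih q (g := dv (L (cvec μ ξ)) g) (M := M * ‖L (cvec μ ξ)‖)
      (BddDer.dv (hg.mono (by omega)) _) (by positivity)
    have h2 := ih (q - 1) (hg.mono (by omega)) hM
    calc _ ≤ _ := abs_add_le _ _
      _ ≤ M * ‖L (cvec μ ξ)‖ * hb ‖L (cvec μ ξ)‖ ‖L (cvec μ η)‖ r p q +
          q * r * (M * hb ‖L (cvec μ ξ)‖ ‖L (cvec μ η)‖ r p (q - 1)) := by
        rw [abs_mul, abs_mul, Nat.abs_cast]
        gcongr
      _ = _ := by ring

/-- The third-order mixed Hermite moment up to lower order terms. -/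
lemma abs_mixed_three_sub_le (hμ : CGauss μ) (ξ η : E →L[ℝ] ℝ) (L : E →L[ℝ] V) {M r : ℝ}
    {g : V → ℝ} (hr : |η (cvec μ ξ)| ≤ r) (hg : BddDer 6 M g) (hM : 0 ≤ M) :
    |∫ z, gh μ 3 ξ z * gh μ 3 η z * g (L z) ∂μ - 6 * η (cvec μ ξ) ^ 3 * ∫ z, g (L z) ∂μ| ≤
      M * (‖L (cvec μ ξ)‖ * (hb ‖L (cvec μ ξ)‖ ‖L (cvec μ η)‖ r 2 3 +
        3 * r * hb ‖L (cvec μ ξ)‖ ‖L (cvec μ η)‖ r 1 2 +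
        6 * r ^ 2 * hb ‖L (cvec μ ξ)‖ ‖L (cvec μ η)‖ r 0 1)) := by
  have hr0 : 0 ≤ r := (abs_nonneg _).trans hr
  set a := ‖L (cvec μ ξ)‖ with ha
  have e1 := mixed_succ hμ ξ η L hg.temperate 2 3
  have e2 := mixed_succ hμ ξ η L hg.temperate 1 2
  have e3 := mixed_succ hμ ξ η L hg.temperate 0 1
  norm_num [gh_zero] at e1 e2 e3
  have b1 := abs_mixed_le hμ ξ η L hr 2 3 (BddDer.dv hg (L (cvec μ ξ))) (by positivity)
  have b2 := abs_mixed_le hμ ξ η L hr 1 2 (BddDer.dv (hg.mono (m := 4) (by omega)) (L (cvec μ ξ)))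
    (by positivity)
  have b3 := abs_mixed_le hμ ξ η L hr 0 1 (BddDer.dv (hg.mono (m := 2) (by omega)) (L (cvec μ ξ)))
    (by positivity)
  simp only [gh_zero, one_mul] at b3
  set R := η (cvec μ ξ)
  rw [e1, e2, e3]
  set I1 := ∫ z, gh μ 2 ξ z * gh μ 3 η z * dv (L (cvec μ ξ)) g (L z) ∂μ
  set I2 := ∫ z, gh μ 1 ξ z * gh μ 2 η z * dv (L (cvec μ ξ)) g (L z) ∂μ
  set I3 := ∫ z, gh μ 1 η z * dv (L (cvec μ ξ)) g (L z) ∂μ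
  rw [← ha] at b1 b2 b3
  have : I1 + 3 * R * (I2 + 2 * R * (I3 + R * ∫ z, g (L z) ∂μ)) - 6 * R ^ 3 * ∫ z, g (L z) ∂μ =
    I1 + 3 * R * I2 + 6 * R ^ 2 * I3 := by ring
  rw [this]
  calc _ ≤ |I1| + 3 * |R| * |I2| + 6 * |R| ^ 2 * |I3| := by
        refine (abs_add_three _ _ _).trans ?_
        simp [abs_mul]
    _ ≤ M * a * hb a ‖L (cvec μ η)‖ r 2 3 + 3 * r * (M * a * hb a ‖L (cvec μ η)‖ r 1 2) +
        6 * r ^ 2 * (M * a * hb a ‖L (cvec μ η)‖ r 0 1) := by gcongr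
    _ = _ := by ring

end Gauss

lemma hb_diag_le {a b r κ : ℝ} (ha : 0 ≤ a) (hb0 : 0 ≤ b) (hr : 0 ≤ r) (haκ : a ≤ κ) (hbκ : b ≤ κ)
    (hrκ : r ≤ κ) (hκ : κ ≤ 1) {p : ℕ} (hp : p = 1 ∨ p = 3 ∨ p = 5) :
    hb a b r p p ≤ 2000 * (r * κ ^ (p - 1) + κ ^ (2 * p - 2) * (a * b)) := by
  have hκ0 : 0 ≤ κ := ha.trans haκ
  have t : ∀ {m n : ℕ}, n ≤ m → κ ^ m ≤ κ ^ n := fun h => pow_le_pow_of_le_one hκ0 hκ h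
  -- generic term bound
  have key : ∀ i k m : ℕ, m ≤ i + 2 * k → r * (r ^ i * (a ^ k * b ^ k)) ≤ r * κ ^ m := by
    intro i k m h
    gcongr
    calc r ^ i * (a ^ k * b ^ k) ≤ κ ^ i * (κ ^ k * κ ^ k) := by gcongr
      _ = κ ^ (i + 2 * k) := by ring
      _ ≤ _ := t h
  have key0 : ∀ k : ℕ, (a * b) * (a ^ k * b ^ k) ≤ (a * b) * κ ^ (2 * k) := by
    intro k
    gcongr
    calc a ^ k * b ^ k ≤ κ ^ k * κ ^ k := by gcongr
      _ = _ := by ring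
  rcases hp with rfl | rfl | rfl
  · simp only [hb]; norm_num
    nlinarith [mul_nonneg ha hb0]
  · simp only [hb]; norm_num
    have h0 : _ ≤ a * b * κ ^ 4 := key0 2
    have h1 := key 0 2 2 (by norm_num)
    have h2 := key 1 1 2 (by norm_num)
    have h3 := key 2 0 2 (by norm_num)
    have n1 : 0 ≤ r * κ ^ 2 := by positivity
    have n2 : 0 ≤ a * b * κ ^ 4 := by positivity
    linarith
  · simp only [hb]; norm_num
    have h0 : _ ≤ a * b * κ ^ 8 := key0 4
    have h1 := key 0 4 4 (by norm_num)
    have h2 := key 1 3 4 (by norm_num)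
    have h3 := key 2 2 4 (by norm_num)
    have h4 := key 3 1 4 (by norm_num)
    have h5 := key 4 0 4 (by norm_num)
    have n1 : 0 ≤ r * κ ^ 4 := by positivity
    have n2 : 0 ≤ a * b * κ ^ 8 := by positivity
    linarith

lemma hb_three_le {a b r κ : ℝ} (ha : 0 ≤ a) (hb0 : 0 ≤ b) (hr : 0 ≤ r) (haκ : a ≤ κ) (hbκ : b ≤ κ)
    (hrκ : r ≤ κ) (hκ : κ ≤ 1) :
    a * (hb a b r 2 3 + 3 * r * hb a b r 1 2 + 6 * r ^ 2 * hb a b r 0 1) ≤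
      100 * (r * κ ^ 3 + κ ^ 4 * (a * b)) := by
  have hκ0 : 0 ≤ κ := ha.trans haκ
  have t : ∀ {m n : ℕ}, n ≤ m → κ ^ m ≤ κ ^ n := fun h => pow_le_pow_of_le_one hκ0 hκ h
  have key : ∀ i k m : ℕ, m ≤ i + 2 * k → r * (r ^ i * (a ^ k * b ^ k)) ≤ r * κ ^ m := by
    intro i k m h
    gcongr
    calc r ^ i * (a ^ k * b ^ k) ≤ κ ^ i * (κ ^ k * κ ^ k) := by gcongr
      _ = κ ^ (i + 2 * k) := by ring
      _ ≤ _ := t h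
  have h0 : (a * b) * (a ^ 2 * b ^ 2) ≤ (a * b) * κ ^ 4 := by
    gcongr
    calc a ^ 2 * b ^ 2 ≤ κ ^ 2 * κ ^ 2 := by gcongr
      _ = _ := by ring
  have h1 := key 0 2 3 (by norm_num)
  have h2 := key 1 1 3 (by norm_num)
  have n1 : 0 ≤ r * κ ^ 3 := by positivity
  have n2 : 0 ≤ a * b * κ ^ 4 := by positivity
  simp only [hb]; norm_num
  linarith

/-- Smallness and summability of the covariances of the functionals `ξ j` among themselves and
with the vectors `Λ j` at which weights are evaluated. -/
structure WeakCorr {E V ι : Type*} [NormedAddCommGroup E] [NormedSpace ℝ E] [NormedAddCommGroup V]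
    [NormedSpace ℝ V] [MeasurableSpace E] (μ : Measure E) (J : Finset ι) (ξ : ι → E →L[ℝ] ℝ)
    (Λ : ι → E →L[ℝ] V) (κ C : ℝ) : Prop where
  pos : 0 < κ
  le_one : κ ≤ 1
  one_le : 1 ≤ C
  card_le : J.card * κ ^ 3 ≤ C
  corr_le : ∀ i ∈ J, ∀ j ∈ J, |ξ j (cvec μ (ξ i))| ≤ κ
  corr_sum : ∀ i ∈ J, ∑ j ∈ J, |ξ j (cvec μ (ξ i))| ≤ C * κ
  cross_le : ∀ i ∈ J, ∀ j ∈ J, ‖Λ j (cvec μ (ξ i))‖ ≤ κ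
  cross_sum : ∀ j ∈ J, ∑ i ∈ J, ‖Λ j (cvec μ (ξ i))‖ ≤ C
  diag_sum : ∑ i ∈ J, ‖Λ i (cvec μ (ξ i))‖ ≤ C

section Gauss

variable {E V ι : Type*} [NormedAddCommGroup E] [NormedSpace ℝ E] [NormedAddCommGroup V]
  [NormedSpace ℝ V] [MeasurableSpace E] {μ : Measure E}
  {J : Finset ι} {ξ : ι → E →L[ℝ] ℝ} {Λ : ι → E →L[ℝ] V} {κ C : ℝ}

lemma WeakCorr.sum_corr (h : WeakCorr μ J ξ Λ κ C) :
    κ ^ 2 * ∑ i ∈ J, ∑ j ∈ J, |ξ j (cvec μ (ξ i))| ≤ C ^ 2 := by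
  have h1 : ∑ i ∈ J, ∑ j ∈ J, |ξ j (cvec μ (ξ i))| ≤ J.card * (C * κ) := by
    rw [← nsmul_eq_mul]
    exact Finset.sum_le_card_nsmul _ _ _ h.corr_sum
  have := h.pos
  have := h.one_le
  calc _ ≤ κ ^ 2 * (J.card * (C * κ)) := by gcongr
    _ = C * (J.card * κ ^ 3) := by ring
    _ ≤ C * C := by gcongr; exact h.card_le
    _ = _ := by ring

lemma WeakCorr.sum_cross (h : WeakCorr μ J ξ Λ κ C) :
    κ ^ 2 * ∑ i ∈ J, ∑ j ∈ J, ‖(Λ i).prod (Λ j) (cvec μ (ξ i))‖ * ‖(Λ i).prod (Λ j) (cvec μ (ξ j))‖ ≤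
      4 * C ^ 2 := by
  have hκ := h.pos
  have hκ1 := h.le_one
  have hC := h.one_le
  set e : ι → ι → ℝ := fun i j => ‖Λ j (cvec μ (ξ i))‖ with he
  have e0 : ∀ i j, 0 ≤ e i j := fun i j => norm_nonneg _
  have step : ∀ i ∈ J, ∀ j ∈ J,
      ‖(Λ i).prod (Λ j) (cvec μ (ξ i))‖ * ‖(Λ i).prod (Λ j) (cvec μ (ξ j))‖ ≤
        e i i * e j j + e i j * e j j + e i i * e j i + κ * e i j := by
    intro i hi j hj
    have h1 : ‖(Λ i).prod (Λ j) (cvec μ (ξ i))‖ ≤ e i i + e i j := by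
      rw [ContinuousLinearMap.prod_apply, Prod.norm_def]
      exact max_le (by linarith [e0 i j]) (by linarith [e0 i i])
    have h2 : ‖(Λ i).prod (Λ j) (cvec μ (ξ j))‖ ≤ e j i + e j j := by
      rw [ContinuousLinearMap.prod_apply, Prod.norm_def]
      exact max_le (by linarith [e0 j j]) (by linarith [e0 j i])
    have h3 : e j i ≤ κ := h.cross_le j hj i hi
    calc _ ≤ (e i i + e i j) * (e j i + e j j) := by
          gcongr
      _ ≤ _ := by nlinarith [e0 i j]
  have hs : ∀ j ∈ J, ∑ i ∈ J, e i j ≤ C := h.cross_sum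
  have hd : ∑ i ∈ J, e i i ≤ C := h.diag_sum
  have hd0 : 0 ≤ ∑ i ∈ J, e i i := Finset.sum_nonneg fun i _ => e0 i i
  have s1 : ∑ i ∈ J, ∑ j ∈ J, e i i * e j j ≤ C * C := by
    rw [← Finset.sum_mul_sum]; gcongr
  have s2 : ∑ i ∈ J, ∑ j ∈ J, e i j * e j j ≤ C * C := by
    rw [Finset.sum_comm]
    calc _ = ∑ j ∈ J, (∑ i ∈ J, e i j) * e j j := by simp [Finset.sum_mul]
      _ ≤ ∑ j ∈ J, C * e j j := by
        gcongr with j hj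
        exact hs j hj
      _ ≤ _ := by rw [← Finset.mul_sum]; gcongr
  have s3 : ∑ i ∈ J, ∑ j ∈ J, e i i * e j i ≤ C * C := by
    calc _ = ∑ i ∈ J, e i i * (∑ j ∈ J, e j i) := by simp [Finset.mul_sum]
      _ ≤ ∑ i ∈ J, e i i * C := by
        gcongr with i hi
        exact hs i hi
      _ ≤ _ := by rw [← Finset.sum_mul]; gcongr
  have s4 : ∑ i ∈ J, ∑ j ∈ J, κ * e i j ≤ κ * (J.card * C) := by
    rw [Finset.sum_comm]; simp only [← Finset.mul_sum]
    gcongr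
    rw [← nsmul_eq_mul]
    exact Finset.sum_le_card_nsmul _ _ _ hs
  have tot : ∑ i ∈ J, ∑ j ∈ J,
      ‖(Λ i).prod (Λ j) (cvec μ (ξ i))‖ * ‖(Λ i).prod (Λ j) (cvec μ (ξ j))‖ ≤
        3 * (C * C) + κ * (J.card * C) := by
    refine (Finset.sum_le_sum fun i hi => Finset.sum_le_sum fun j hj => step i hi j hj).trans ?_
    simp only [Finset.sum_add_distrib]
    linarith
  calc _ ≤ κ ^ 2 * (3 * (C * C) + κ * (J.card * C)) := by gcongr
    _ = κ ^ 2 * (3 * (C * C)) + C * (J.card * κ ^ 3) := by ring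
    _ ≤ 1 * (3 * (C * C)) + C * C := by
      gcongr
      · exact pow_le_one₀ hκ.le hκ1
      · exact h.card_le
    _ = _ := by ring

lemma prod_cvec_le (h : WeakCorr μ J ξ Λ κ C) {i j k : ι} (hi : i ∈ J) (hj : j ∈ J) (hk : k ∈ J) :
    ‖(Λ i).prod (Λ j) (cvec μ (ξ k))‖ ≤ κ := by
  rw [ContinuousLinearMap.prod_apply, Prod.norm_def]
  exact max_le (h.cross_le _ hk _ hi) (h.cross_le _ hk _ hj)

variable [BorelSpace E] [FiniteDimensional ℝ E]

lemma integral_sq_sum (hμ : CGauss μ) (J : Finset ι) (ξ : ι → E →L[ℝ] ℝ) (Λ : ι → E →L[ℝ] V)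
    {γ : V → ℝ} (hγ : Cb γ) (p : ℕ) :
    ∫ z, (∑ j ∈ J, γ (Λ j z) * gh μ p (ξ j) z) ^ 2 ∂μ = ∑ i ∈ J, ∑ j ∈ J,
      ∫ z, gh μ p (ξ i) z * gh μ p (ξ j) z * (γ (Λ i z) * γ (Λ j z)) ∂μ := by
  have := hμ.gauss
  have hγt : ∀ i, (fun z => γ (Λ i z)).HasTemperateGrowth := fun i => (hγ.comp_clm (Λ i)).temperate
  have e : ∀ z, (∑ j ∈ J, γ (Λ j z) * gh μ p (ξ j) z) ^ 2 = ∑ i ∈ J, ∑ j ∈ J,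
      gh μ p (ξ i) z * gh μ p (ξ j) z * (γ (Λ i z) * γ (Λ j z)) := by
    intro z
    rw [pow_two, Finset.sum_mul_sum]
    refine Finset.sum_congr rfl fun i _ => Finset.sum_congr rfl fun j _ => by ring
  have hi : ∀ i j, Integrable (fun z => gh μ p (ξ i) z * gh μ p (ξ j) z * (γ (Λ i z) * γ (Λ j z))) μ :=
    fun i j => by
      have h1 := hγt i
      have h2 := hγt j
      exact integrable_of_temperate (((gh_temperate p _).mul (gh_temperate p _)).mul (h1.mul h2))
  simp only [e]
  rw [integral_finsetSum _ fun i _ => integrable_finsetSum _ fun j _ => hi i j]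
  exact Finset.sum_congr rfl fun i _ => integral_finsetSum _ fun j _ => hi i j

lemma Cb.tensor {γ : V → ℝ} (hγ : Cb γ) : Cb (fun y : V × V => γ y.1 * γ y.2) :=
  (hγ.comp_clm (ContinuousLinearMap.fst ℝ V V)).mul (hγ.comp_clm (ContinuousLinearMap.snd ℝ V V))

/-- `L²` bound for weighted sums of Hermite polynomials. -/
lemma exists_weighted_bound {γ : V → ℝ} (hγ : Cb γ) {p : ℕ} (hp : p = 1 ∨ p = 3 ∨ p = 5) (C : ℝ) :
    ∃ K : ℝ, 0 ≤ K ∧ ∀ {E ι : Type} [NormedAddCommGroup E] [NormedSpace ℝ E] [MeasurableSpace E]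
      [BorelSpace E] [FiniteDimensional ℝ E] {μ : Measure E} (_ : CGauss μ) {J : Finset ι}
      {ξ : ι → E →L[ℝ] ℝ} {Λ : ι → E →L[ℝ] V} {κ : ℝ} (_ : WeakCorr μ J ξ Λ κ C),
      κ ^ 3 * ∫ z, (∑ j ∈ J, γ (Λ j z) * gh μ p (ξ j) z) ^ 2 ∂μ ≤ K * κ ^ p := by
  obtain ⟨M, hM, hΓ⟩ := hγ.tensor.bddDer (p + p)
  refine ⟨M * 2000 * (5 * C ^ 2), by positivity, ?_⟩
  intro E ι _ _ _ _ _ μ hμ J ξ Λ κ h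
  have hκ := h.pos
  rw [integral_sq_sum hμ J ξ Λ hγ p]
  have step : ∀ i ∈ J, ∀ j ∈ J,
      ∫ z, gh μ p (ξ i) z * gh μ p (ξ j) z * (γ (Λ i z) * γ (Λ j z)) ∂μ ≤
      M * (2000 * (|ξ j (cvec μ (ξ i))| * κ ^ (p - 1) + κ ^ (2 * p - 2) *
        (‖(Λ i).prod (Λ j) (cvec μ (ξ i))‖ * ‖(Λ i).prod (Λ j) (cvec μ (ξ j))‖))) := by
    intro i hi j hj
    have h1 := abs_mixed_le hμ (ξ i) (ξ j) ((Λ i).prod (Λ j)) le_rfl p p hΓ hM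
    refine (le_abs_self _).trans (h1.trans ?_)
    gcongr
    exact hb_diag_le (norm_nonneg _) (norm_nonneg _) (abs_nonneg _) (prod_cvec_le h hi hj hi)
      (prod_cvec_le h hi hj hj) (h.corr_le i hi j hj) h.le_one hp
  have hsum := Finset.sum_le_sum fun i hi => Finset.sum_le_sum fun j hj => step i hi j hj
  simp only [← Finset.mul_sum, Finset.sum_add_distrib, ← Finset.sum_mul] at hsum
  have c1 := h.sum_corr
  have c2 := h.sum_cross
  set A := ∑ i ∈ J, ∑ j ∈ J, |ξ j (cvec μ (ξ i))|
  set B := ∑ i ∈ J, ∑ j ∈ J,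
    ‖(Λ i).prod (Λ j) (cvec μ (ξ i))‖ * ‖(Λ i).prod (Λ j) (cvec μ (ξ j))‖
  obtain ⟨q, rfl⟩ : ∃ q, p = q + 1 := ⟨p - 1, by omega⟩
  have hq : κ ^ (2 * q) ≤ κ ^ q := pow_le_pow_of_le_one hκ.le h.le_one (by omega)
  have e2 : 2 * (q + 1) - 2 = 2 * q := by omega
  rw [Nat.add_sub_cancel, e2] at hsum
  calc _ ≤ κ ^ 3 * (M * (2000 * (A * κ ^ q + κ ^ (2 * q) * B))) := by gcongr
    _ ≤ κ ^ 3 * (M * (2000 * (A * κ ^ q + κ ^ q * B))) := by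
      have : 0 ≤ B := by positivity
      gcongr
    _ = M * 2000 * (κ ^ 2 * A + κ ^ 2 * B) * κ ^ (q + 1) := by ring
    _ ≤ M * 2000 * (C ^ 2 + 4 * C ^ 2) * κ ^ (q + 1) := by gcongr
    _ = _ := by ring

/-- `L²` bound for weighted sums of third Hermite polynomials with small weights. -/
lemma exists_weighted_three_bound {γ : V → ℝ} (hγ : Cb γ) (C : ℝ) :
    ∃ K : ℝ, 0 ≤ K ∧ ∀ {E ι : Type} [NormedAddCommGroup E] [NormedSpace ℝ E] [MeasurableSpace E]
      [BorelSpace E] [FiniteDimensional ℝ E] {μ : Measure E} (_ : CGauss μ) {J : Finset ι}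
      {ξ : ι → E →L[ℝ] ℝ} {Λ : ι → E →L[ℝ] V} {κ : ℝ} (_ : WeakCorr μ J ξ Λ κ C) {C₀ w : ℝ}
      (_ : WeakCorr μ J ξ (fun _ => (0 : E →L[ℝ] ℝ)) κ C₀) (_ : 0 ≤ w) (_ : ∀ j ∈ J, ∫ z, γ (Λ j z) ^ 2 ∂μ ≤ w),
      ∫ z, (∑ j ∈ J, γ (Λ j z) * gh μ 3 (ξ j) z) ^ 2 ∂μ ≤ 6 * C₀ ^ 2 * w + K * κ := by
  obtain ⟨M, hM, hΓ⟩ := hγ.tensor.bddDer 6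
  refine ⟨M * 100 * (5 * C ^ 2), by positivity, ?_⟩
  intro E ι _ _ _ _ _ μ hμ J ξ Λ κ h C₀ w h₀ hw0 hw
  have := hμ.gauss
  have hκ := h.pos
  have hκ1 := h.le_one
  rw [integral_sq_sum hμ J ξ Λ hγ 3]
  have hγt : ∀ i, (fun z => γ (Λ i z)).HasTemperateGrowth := fun i => (hγ.comp_clm (Λ i)).temperate
  have hcs : ∀ i ∈ J, ∀ j ∈ J, |∫ z, γ (Λ i z) * γ (Λ j z) ∂μ| ≤ w := by
    intro i hi j hj
    have h1 := hγt i
    have h2 := hγt j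
    have i1 : Integrable (fun z => γ (Λ i z) ^ 2) μ := integrable_of_temperate (h1.pow 2)
    have i2 : Integrable (fun z => γ (Λ j z) ^ 2) μ := integrable_of_temperate (h2.pow 2)
    calc _ ≤ ∫ z, |γ (Λ i z) * γ (Λ j z)| ∂μ := abs_integral_le_integral_abs
      _ ≤ ∫ z, (1 / 2 * γ (Λ i z) ^ 2 + 1 / 2 * γ (Λ j z) ^ 2) ∂μ := by
        refine integral_mono (integrable_of_temperate (h1.mul h2)).abs
          ((i1.const_mul _).add (i2.const_mul _)) fun z => ?_
        simp only [abs_mul]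
        nlinarith [sq_nonneg (|γ (Λ i z)| - |γ (Λ j z)|), sq_abs (γ (Λ i z)), sq_abs (γ (Λ j z))]
      _ = 1 / 2 * ∫ z, γ (Λ i z) ^ 2 ∂μ + 1 / 2 * ∫ z, γ (Λ j z) ^ 2 ∂μ := by
        rw [integral_add (i1.const_mul _) (i2.const_mul _), integral_const_mul, integral_const_mul]
      _ ≤ w := by linarith [hw i hi, hw j hj]
  have step : ∀ i ∈ J, ∀ j ∈ J,
      ∫ z, gh μ 3 (ξ i) z * gh μ 3 (ξ j) z * (γ (Λ i z) * γ (Λ j z)) ∂μ ≤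
      6 * w * (|ξ j (cvec μ (ξ i))| * κ ^ 2) +
      M * (100 * (|ξ j (cvec μ (ξ i))| * κ ^ 3 + κ ^ 4 *
        (‖(Λ i).prod (Λ j) (cvec μ (ξ i))‖ * ‖(Λ i).prod (Λ j) (cvec μ (ξ j))‖))) := by
    intro i hi j hj
    have h1 := abs_mixed_three_sub_le hμ (ξ i) (ξ j) ((Λ i).prod (Λ j)) le_rfl hΓ hM
    have h2 := hb_three_le (norm_nonneg _) (norm_nonneg _) (abs_nonneg (ξ j (cvec μ (ξ i))))
      (prod_cvec_le h hi hj hi) (prod_cvec_le h hi hj hj) (h.corr_le i hi j hj) h.le_one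
    have h3 : 6 * ξ j (cvec μ (ξ i)) ^ 3 * ∫ z, γ (Λ i z) * γ (Λ j z) ∂μ ≤
        6 * w * (|ξ j (cvec μ (ξ i))| * κ ^ 2) := by
      refine (le_abs_self _).trans ?_
      rw [abs_mul, abs_mul, abs_pow]
      have hr := h.corr_le i hi j hj
      calc _ ≤ |6| * (|ξ j (cvec μ (ξ i))| * κ ^ 2) * w := by
            gcongr
            · calc _ = |ξ j (cvec μ (ξ i))| * |ξ j (cvec μ (ξ i))| ^ 2 := by ring
                _ ≤ _ := by gcongr
            · exact hcs i hi j hj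
        _ = _ := by norm_num; ring
    have h4 := (abs_le.1 (h1.trans (mul_le_mul_of_nonneg_left h2 hM))).2
    simp only [ContinuousLinearMap.prod_apply] at h4 ⊢
    linarith
  have hsum := Finset.sum_le_sum fun i hi => Finset.sum_le_sum fun j hj => step i hi j hj
  simp only [Finset.sum_add_distrib, ← Finset.mul_sum, ← Finset.sum_mul] at hsum
  have c0 := h₀.sum_corr
  have c1 := h.sum_corr
  have c2 := h.sum_cross
  set A := ∑ i ∈ J, ∑ j ∈ J, |ξ j (cvec μ (ξ i))|
  set B := ∑ i ∈ J, ∑ j ∈ J,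
    ‖(Λ i).prod (Λ j) (cvec μ (ξ i))‖ * ‖(Λ i).prod (Λ j) (cvec μ (ξ j))‖
  have hB : 0 ≤ B := by positivity
  calc _ ≤ _ := hsum
    _ = 6 * w * (κ ^ 2 * A) + M * 100 * (κ * (κ ^ 2 * A) + κ ^ 2 * (κ ^ 2 * B)) := by ring
    _ ≤ 6 * w * C₀ ^ 2 + M * 100 * (κ * C ^ 2 + κ * (4 * C ^ 2)) := by
      have : κ ^ 2 ≤ κ := by nlinarith
      gcongr
    _ = _ := by ring

end Gauss

section FourthMoment

variable {E : Type*} [NormedAddCommGroup E] [NormedSpace ℝ E]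

@[fun_prop]
lemma clm_temperate (η : E →L[ℝ] ℝ) : (fun z => η z).HasTemperateGrowth := η.hasTemperateGrowth

lemma dv_add {F G : E → ℝ} (hF : F.HasTemperateGrowth) (hG : G.HasTemperateGrowth) (c z : E) :
    dv c (fun z => F z + G z) z = dv c F z + dv c G z := by
  simp only [dv]
  rw [fderiv_fun_add (differentiable_of_temperate hF z) (differentiable_of_temperate hG z)]
  simp

lemma dv_const_mul {F : E → ℝ} (hF : F.HasTemperateGrowth) (a : ℝ) (c z : E) :
    dv c (fun z => a * F z) z = a * dv c F z := by
  simp only [dv]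
  rw [fderiv_const_mul (differentiable_of_temperate hF z)]
  simp

lemma dv_clm (η : E →L[ℝ] ℝ) (c z : E) : dv c (fun z => η z) z = η c := by
  simp [dv]

variable [MeasurableSpace E] {μ : Measure E}

lemma dv_gh_two (c : E) (ξ : E →L[ℝ] ℝ) (z : E) : dv c (gh μ 2 ξ) z = 2 * ξ c * ξ z := by
  rw [dv_gh]; simp [gh_one]

variable [BorelSpace E] [FiniteDimensional ℝ E]

lemma integral_gh_two_mul (hμ : CGauss μ) (ξ : E →L[ℝ] ℝ) {F F' F'' : E → ℝ}
    (hF : F.HasTemperateGrowth) (h1 : dv (cvec μ ξ) F = F') (h2 : dv (cvec μ ξ) F' = F'') :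
    ∫ z, gh μ 2 ξ z * F z ∂μ = ∫ z, F'' z ∂μ := by
  have h := integral_gh_succ hμ 1 ξ hF
  have h' := integral_gh_succ hμ 0 ξ (hasTemperateGrowth_dv hF (cvec μ ξ))
  simp only [smul_eq_mul, gh_zero, one_mul, zero_add, Nat.reduceAdd] at h h'
  rw [h, h', h1, h2]

lemma integral_gh_two_pair (hμ : CGauss μ) (ξ η : E →L[ℝ] ℝ) :
    ∫ z, gh μ 2 ξ z * gh μ 2 η z ∂μ = 2 * η (cvec μ ξ) ^ 2 := by
  have := hμ.gauss
  have := hμ.gauss.toIsProbabilityMeasure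
  rw [integral_gh_two_mul hμ ξ (by fun_prop) (F' := fun z => 2 * η (cvec μ ξ) * η z)
    (F'' := fun z => 2 * η (cvec μ ξ) * η (cvec μ ξ))]
  · simp; ring
  · ext z; rw [dv_gh_two]
  · ext z; rw [dv_const_mul (by fun_prop), dv_clm]

lemma integral_gh_two_lin (hμ : CGauss μ) (ξ η ζ : E →L[ℝ] ℝ) :
    ∫ z, gh μ 2 ξ z * (η z * ζ z) ∂μ = 2 * η (cvec μ ξ) * ζ (cvec μ ξ) := by
  have := hμ.gauss
  have := hμ.gauss.toIsProbabilityMeasure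
  rw [integral_gh_two_mul hμ ξ (by fun_prop)
    (F' := fun z => η (cvec μ ξ) * ζ z + ζ (cvec μ ξ) * η z)
    (F'' := fun z => 2 * η (cvec μ ξ) * ζ (cvec μ ξ))]
  · simp
  · ext z; rw [dv_mul (by fun_prop) (by fun_prop), dv_clm, dv_clm]; ring
  · ext z; rw [dv_add (by fun_prop) (by fun_prop), dv_const_mul (by fun_prop),
      dv_const_mul (by fun_prop), dv_clm, dv_clm]; ring

/-- Fourth joint moment of second Hermite polynomials. -/
lemma integral_gh_two_four (hμ : CGauss μ) (p q r s : E →L[ℝ] ℝ) :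
    ∫ z, gh μ 2 p z * (gh μ 2 q z * (gh μ 2 r z * gh μ 2 s z)) ∂μ =
      4 * (q (cvec μ p) ^ 2 * s (cvec μ r) ^ 2 + r (cvec μ p) ^ 2 * s (cvec μ q) ^ 2 +
        s (cvec μ p) ^ 2 * r (cvec μ q) ^ 2) +
      16 * (q (cvec μ p) * r (cvec μ p) * s (cvec μ q) * s (cvec μ r) +
        q (cvec μ p) * s (cvec μ p) * r (cvec μ q) * s (cvec μ r) +
        r (cvec μ p) * s (cvec μ p) * r (cvec μ q) * s (cvec μ q)) := by
  have := hμ.gauss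
  set Q := q (cvec μ p) with hQ
  set R := r (cvec μ p) with hR
  set S := s (cvec μ p) with hS
  rw [integral_gh_two_mul hμ p (by fun_prop)
    (F' := fun z => 2 * Q * (q z * (gh μ 2 r z * gh μ 2 s z)) +
      (2 * R * (r z * (gh μ 2 q z * gh μ 2 s z)) + 2 * S * (s z * (gh μ 2 q z * gh μ 2 r z))))
    (F'' := fun z => 2 * Q ^ 2 * (gh μ 2 r z * gh μ 2 s z) +
      2 * R ^ 2 * (gh μ 2 q z * gh μ 2 s z) + 2 * S ^ 2 * (gh μ 2 q z * gh μ 2 r z) +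
      8 * Q * R * (gh μ 2 s z * (q z * r z)) + 8 * Q * S * (gh μ 2 r z * (q z * s z)) +
      8 * R * S * (gh μ 2 q z * (r z * s z)))]
  · repeat rw [integral_add (integrable_of_temperate (by fun_prop))
      (integrable_of_temperate (by fun_prop))]
    simp only [integral_const_mul, integral_gh_two_pair hμ, integral_gh_two_lin hμ]
    rw [cvec_symm hμ q s, cvec_symm hμ r s, cvec_symm hμ q r]
    ring
  · ext z
    rw [dv_mul (by fun_prop) (by fun_prop), dv_mul (by fun_prop) (by fun_prop)]
    simp only [dv_gh_two]
    ring
  · ext z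
    rw [dv_add (by fun_prop) (by fun_prop), dv_add (by fun_prop) (by fun_prop),
      dv_const_mul (by fun_prop), dv_const_mul (by fun_prop), dv_const_mul (by fun_prop)]
    rw [dv_mul (by fun_prop) (by fun_prop), dv_mul (by fun_prop) (by fun_prop),
      dv_mul (by fun_prop) (by fun_prop), dv_mul (by fun_prop) (by fun_prop),
      dv_mul (by fun_prop) (by fun_prop), dv_mul (by fun_prop) (by fun_prop)]
    simp only [dv_gh_two, dv_clm]
    ring

end FourthMoment

section Fluctuation

variable {E V ι : Type*} [NormedAddCommGroup E] [NormedSpace ℝ E] [NormedAddCommGroup V]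
  [NormedSpace ℝ V] [MeasurableSpace E] {μ : Measure E}
  {J : Finset ι} {ξ : ι → E →L[ℝ] ℝ} {Λ : ι → E →L[ℝ] V} {κ C : ℝ}

lemma abs_fluct_le {κ Q R S rq sq sr : ℝ} (hQ : |Q| ≤ κ) (hR : |R| ≤ κ) (hS : |S| ≤ κ)
    (hrq : |rq| ≤ κ) (hsq : |sq| ≤ κ) (hsr : |sr| ≤ κ) :
    |4 * (R ^ 2 * sq ^ 2 + S ^ 2 * rq ^ 2) +
      16 * (Q * R * sq * sr + Q * S * rq * sr + R * S * rq * sq)| ≤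
      κ ^ 3 * (36 * |R| + 20 * |S|) := by
  have hκ : 0 ≤ κ := (abs_nonneg _).trans hQ
  have e1 : |R ^ 2 * sq ^ 2| ≤ |R| * κ ^ 3 := by
    rw [abs_mul, abs_pow, abs_pow]
    calc _ = |R| * (|R| * |sq| ^ 2) := by ring
      _ ≤ |R| * (κ * κ ^ 2) := by gcongr
      _ = _ := by ring
  have e2 : |S ^ 2 * rq ^ 2| ≤ |S| * κ ^ 3 := by
    rw [abs_mul, abs_pow, abs_pow]
    calc _ = |S| * (|S| * |rq| ^ 2) := by ring
      _ ≤ |S| * (κ * κ ^ 2) := by gcongr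
      _ = _ := by ring
  have e3 : |Q * R * sq * sr| ≤ |R| * κ ^ 3 := by
    rw [abs_mul, abs_mul, abs_mul]
    calc _ = |R| * (|Q| * |sq| * |sr|) := by ring
      _ ≤ |R| * (κ * κ * κ) := by gcongr
      _ = _ := by ring
  have e4 : |Q * S * rq * sr| ≤ |S| * κ ^ 3 := by
    rw [abs_mul, abs_mul, abs_mul]
    calc _ = |S| * (|Q| * |rq| * |sr|) := by ring
      _ ≤ |S| * (κ * κ * κ) := by gcongr
      _ = _ := by ring
  have e5 : |R * S * rq * sq| ≤ |R| * κ ^ 3 := by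
    rw [abs_mul, abs_mul, abs_mul]
    calc _ = |R| * (|S| * |rq| * |sq|) := by ring
      _ ≤ |R| * (κ * κ * κ) := by gcongr
      _ = _ := by ring
  rw [abs_le] at *
  constructor <;> nlinarith

variable [BorelSpace E] [FiniteDimensional ℝ E]

lemma integral_fluct_sq_le (hμ : CGauss μ) (h : WeakCorr μ J ξ Λ κ C) {A B : Finset ι} (hA : A ⊆ J)
    (hB : B ⊆ J) :
    ∫ z, (∑ i ∈ A, ∑ j ∈ B, ξ j (cvec μ (ξ i)) * (gh μ 2 (ξ i) z * gh μ 2 (ξ j) z) -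
      2 * ∑ i ∈ A, ∑ j ∈ B, ξ j (cvec μ (ξ i)) ^ 3) ^ 2 ∂μ ≤ 56 * C ^ 4 * κ ^ 3 := by
  have := hμ.gauss
  have := hμ.gauss.toIsProbabilityMeasure
  have hκ := h.pos
  have hC := h.one_le
  set R : ι → ι → ℝ := fun i j => ξ j (cvec μ (ξ i)) with hR
  have hsymm : ∀ i j, R i j = R j i := fun i j => cvec_symm hμ _ _
  set X : ι × ι → E → ℝ := fun x z =>
    R x.1 x.2 * (gh μ 2 (ξ x.1) z * gh μ 2 (ξ x.2) z) + -(2 * R x.1 x.2 ^ 3) with hX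
  have hXt : ∀ x, (X x).HasTemperateGrowth := fun x => by
    simp only [hX]; fun_prop
  have e : ∀ z, (∑ i ∈ A, ∑ j ∈ B, R i j * (gh μ 2 (ξ i) z * gh μ 2 (ξ j) z) -
      2 * ∑ i ∈ A, ∑ j ∈ B, R i j ^ 3) ^ 2 = ∑ x ∈ A ×ˢ B, ∑ y ∈ A ×ˢ B, X x z * X y z := by
    intro z
    rw [← Finset.sum_mul_sum, ← pow_two]
    simp only [hX, Finset.sum_product, Finset.sum_add_distrib, Finset.sum_neg_distrib,
      ← Finset.mul_sum]
    ring
  have hi : ∀ x y, Integrable (fun z => X x z * X y z) μ := fun x y =>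
    integrable_of_temperate ((hXt x).mul (hXt y))
  have hXX : ∀ x y : ι × ι, ∫ z, X x z * X y z ∂μ = R x.1 x.2 * R y.1 y.2 *
      (4 * (R x.1 y.1 ^ 2 * R x.2 y.2 ^ 2 + R x.1 y.2 ^ 2 * R x.2 y.1 ^ 2) +
      16 * (R x.1 x.2 * R x.1 y.1 * R x.2 y.2 * R y.1 y.2 +
        R x.1 x.2 * R x.1 y.2 * R x.2 y.1 * R y.1 y.2 +
        R x.1 y.1 * R x.1 y.2 * R x.2 y.1 * R x.2 y.2)) := by
    rintro ⟨p, q⟩ ⟨r, s⟩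
    simp only [hX]
    have e : ∀ z, (R p q * (gh μ 2 (ξ p) z * gh μ 2 (ξ q) z) + -(2 * R p q ^ 3)) *
        (R r s * (gh μ 2 (ξ r) z * gh μ 2 (ξ s) z) + -(2 * R r s ^ 3)) =
        R p q * R r s * (gh μ 2 (ξ p) z * (gh μ 2 (ξ q) z * (gh μ 2 (ξ r) z * gh μ 2 (ξ s) z))) +
        -(2 * R p q ^ 3 * R r s) * (gh μ 2 (ξ r) z * gh μ 2 (ξ s) z) +
        -(2 * R r s ^ 3 * R p q) * (gh μ 2 (ξ p) z * gh μ 2 (ξ q) z) +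
        4 * R p q ^ 3 * R r s ^ 3 := fun z => by ring
    simp only [e]
    repeat rw [integral_add (integrable_of_temperate (by fun_prop))
      (integrable_of_temperate (by fun_prop))]
    simp only [integral_const_mul, integral_gh_two_pair hμ, integral_gh_two_four hμ]
    simp only [hR, integral_const, smul_eq_mul, probReal_univ]
    ring
  have hle : ∀ x ∈ A ×ˢ B, ∀ y ∈ A ×ˢ B, ∫ z, X x z * X y z ∂μ ≤
      κ ^ 3 * (|R x.1 x.2| * (36 * (|R x.1 y.1| * |R y.1 y.2|) + 20 * (|R x.1 y.2| * |R y.1 y.2|))) := by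
    intro x hx y hy
    rw [Finset.mem_product] at hx hy
    have hc := h.corr_le
    have hp := hA hx.1
    have hq := hB hx.2
    have hr := hA hy.1
    have hs := hB hy.2
    rw [hXX]
    refine (le_abs_self _).trans ?_
    rw [abs_mul, abs_mul]
    calc _ ≤ |R x.1 x.2| * |R y.1 y.2| * (κ ^ 3 * (36 * |R x.1 y.1| + 20 * |R x.1 y.2|)) := by
          gcongr
          exact abs_fluct_le (hc _ hp _ hq) (hc _ hp _ hr) (hc _ hp _ hs) (hc _ hq _ hr)
            (hc _ hq _ hs) (hc _ hr _ hs)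
      _ = _ := by ring
  have hs : ∀ i ∈ J, ∀ D ⊆ J, ∑ j ∈ D, |R i j| ≤ C * κ := fun i hi D hD =>
    (Finset.sum_le_sum_of_subset_of_nonneg hD fun _ _ _ => abs_nonneg _).trans (h.corr_sum i hi)
  have hin : ∀ x ∈ A ×ˢ B, ∑ y ∈ A ×ˢ B, ∫ z, X x z * X y z ∂μ ≤
      κ ^ 3 * (|R x.1 x.2| * (56 * (C * κ) ^ 2)) := by
    intro x hx
    refine (Finset.sum_le_sum fun y hy => hle x hx y hy).trans ?_
    rw [Finset.mem_product] at hx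
    have hp := hA hx.1
    have t1 : ∑ y ∈ A ×ˢ B, |R x.1 y.1| * |R y.1 y.2| ≤ (C * κ) ^ 2 := by
      rw [Finset.sum_product]
      simp only [← Finset.mul_sum]
      calc _ ≤ ∑ r ∈ A, |R x.1 r| * (C * κ) := by
            gcongr with r hr
            exact hs r (hA hr) B hB
        _ ≤ C * κ * (C * κ) := by
            rw [← Finset.sum_mul]; gcongr; exact hs _ hp A hA
        _ = _ := by ring
    have t2 : ∑ y ∈ A ×ˢ B, |R x.1 y.2| * |R y.1 y.2| ≤ (C * κ) ^ 2 := by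
      rw [Finset.sum_product_right]
      simp only [← Finset.mul_sum]
      calc _ ≤ ∑ r ∈ B, |R x.1 r| * (C * κ) := by
            gcongr with r hr
            simp only [hsymm _ r]
            exact hs r (hB hr) A hA
        _ ≤ C * κ * (C * κ) := by
            rw [← Finset.sum_mul]; gcongr; exact hs _ hp B hB
        _ = _ := by ring
    simp only [← Finset.mul_sum, Finset.sum_add_distrib]
    gcongr
    linarith
  simp only [hR] at e ⊢
  simp only [e]
  rw [integral_finsetSum _ fun i _ => integrable_finsetSum _ fun j _ => hi i j]
  simp only [integral_finsetSum _ fun j _ => hi _ j]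
  refine (Finset.sum_le_sum fun x hx => hin x hx).trans ?_
  rw [← Finset.mul_sum, ← Finset.sum_mul, Finset.sum_product]
  have hcard : (A.card : ℝ) ≤ J.card := by exact_mod_cast Finset.card_le_card hA
  have hsum : ∑ i ∈ A, ∑ j ∈ B, |R i j| ≤ J.card * (C * κ) := by
    calc _ ≤ ∑ i ∈ A, C * κ := Finset.sum_le_sum fun i hi => hs i (hA hi) B hB
      _ = A.card * (C * κ) := by simp
      _ ≤ _ := by gcongr
  calc _ ≤ κ ^ 3 * (J.card * (C * κ) * (56 * (C * κ) ^ 2)) := by gcongr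
    _ = 56 * C ^ 3 * κ ^ 3 * (J.card * κ ^ 3) := by ring
    _ ≤ 56 * C ^ 3 * κ ^ 3 * C := by gcongr; exact h.card_le
    _ = _ := by ring

lemma integral_drift_sq_le (hμ : CGauss μ) {A : Finset ι} {κ D : ℝ}
    (hR : ∀ i ∈ A, ∀ j ∈ A, |ξ j (cvec μ (ξ i))| ≤ κ) (ℓ : E →L[ℝ] ℝ)
    (hℓ : ∑ i ∈ A, |ℓ (cvec μ (ξ i))| ≤ D) :
    ∫ z, (∑ i ∈ A, gh μ 2 (ξ i) z * ℓ (cvec μ (ξ i))) ^ 2 ∂μ ≤ 2 * κ ^ 2 * D ^ 2 := by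
  have := hμ.gauss
  have hi : ∀ i j, Integrable (fun z => ℓ (cvec μ (ξ i)) * ℓ (cvec μ (ξ j)) *
    (gh μ 2 (ξ i) z * gh μ 2 (ξ j) z)) μ := fun i j => integrable_of_temperate (by fun_prop)
  have e : ∀ z, (∑ i ∈ A, gh μ 2 (ξ i) z * ℓ (cvec μ (ξ i))) ^ 2 = ∑ i ∈ A, ∑ j ∈ A,
      ℓ (cvec μ (ξ i)) * ℓ (cvec μ (ξ j)) * (gh μ 2 (ξ i) z * gh μ 2 (ξ j) z) := by
    intro z
    rw [pow_two, Finset.sum_mul_sum]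
    refine Finset.sum_congr rfl fun i _ => Finset.sum_congr rfl fun j _ => by ring
  simp only [e]
  rw [integral_finsetSum _ fun i _ => integrable_finsetSum _ fun j _ => hi i j]
  simp only [integral_finsetSum _ fun j _ => hi _ j, integral_const_mul, integral_gh_two_pair hμ]
  calc _ ≤ ∑ i ∈ A, ∑ j ∈ A, |ℓ (cvec μ (ξ i))| * |ℓ (cvec μ (ξ j))| * (2 * κ ^ 2) := by
        refine Finset.sum_le_sum fun i hi => Finset.sum_le_sum fun j hj => (le_abs_self _).trans ?_
        rw [abs_mul, abs_mul, abs_mul, abs_pow, abs_two]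
        gcongr
        exact hR i hi j hj
    _ = (∑ i ∈ A, |ℓ (cvec μ (ξ i))|) ^ 2 * (2 * κ ^ 2) := by
        rw [pow_two (∑ i ∈ A, _), Finset.sum_mul_sum]; simp only [Finset.sum_mul]
    _ ≤ D ^ 2 * (2 * κ ^ 2) := by gcongr
    _ = _ := by ring

end Fluctuation

lemma cb_exp_mul_I : Cb fun x : ℝ => Complex.exp (x * Complex.I) := by
  refine ⟨(Complex.contDiff_exp (𝕜 := ℝ)).comp (Complex.ofRealCLM.contDiff.mul contDiff_const),
    fun n => ⟨1, fun x => ?_⟩⟩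
  have key : ∀ n : ℕ, iteratedDeriv n (fun x : ℝ => Complex.exp (x * Complex.I)) =
      fun x : ℝ => Complex.I ^ n * Complex.exp (x * Complex.I) := by
    intro n
    induction n with
    | zero => ext x; simp
    | succ n ih =>
      rw [iteratedDeriv_succ, ih]
      ext x
      have h : HasDerivAt (fun x : ℝ => Complex.I ^ n * Complex.exp (x * Complex.I))
          (Complex.I ^ n * (Complex.exp (x * Complex.I) * (1 * Complex.I))) x :=
        (((Complex.ofRealCLM.hasDerivAt).mul_const _).cexp.const_mul _)
      rw [h.deriv]; ring
  rw [norm_iteratedFDeriv_eq_norm_iteratedDeriv, key]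
  simp [Complex.norm_exp_ofReal_mul_I]

lemma hasTemperateGrowth_exp_mul_I : (fun x : ℝ => Complex.exp (x * Complex.I)).HasTemperateGrowth :=
  cb_exp_mul_I.temperate

/-- The exponential function can be modified outside a bounded interval so as to have temperate
growth. -/
lemma exists_temperate_exp (M : ℝ) :
    ∃ g : ℝ → ℝ, g.HasTemperateGrowth ∧ ∀ x, |x| ≤ M → g x = Real.exp x := by
  let φ : ContDiffBump (0 : ℝ) := ⟨|M| + 1, |M| + 2, by positivity, by linarith⟩
  refine ⟨fun x => φ x * Real.exp x, ?_, fun x hx => ?_⟩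
  · have hc : HasCompactSupport fun x => φ x * Real.exp x := φ.hasCompactSupport.mul_right
    have hs : ContDiff ℝ ∞ fun x => φ x * Real.exp x := φ.contDiff.mul Real.contDiff_exp
    exact (hc.toSchwartzMap hs).hasTemperateGrowth
  · beta_reduce
    rw [φ.one_of_mem_closedBall, one_mul]
    rw [mem_closedBall_zero_iff, Real.norm_eq_abs]
    exact hx.trans ((le_abs_self M).trans (by simp [φ]))

section Phase

variable {E V ι β : Type*} [NormedAddCommGroup E] [NormedSpace ℝ E] [NormedAddCommGroup V]
  [NormedSpace ℝ V]

lemma dv_amplitude {G : V → ℂ} (hG : G.HasTemperateGrowth) (L : E →L[ℝ] V) {Θ : E → ℝ}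
    (hΘ : Θ.HasTemperateGrowth) (τ : ℝ) (c z : E) :
    dv c (fun z => G (L z) * Complex.exp ((τ * Θ z : ℝ) * Complex.I)) z =
      Complex.exp ((τ * Θ z : ℝ) * Complex.I) *
        (dv (L c) G (L z) + Complex.I * (τ * G (L z) * dv c Θ z)) := by
  have h1 : HasFDerivAt (fun z => G (L z)) _ z :=
    (differentiable_of_temperate hG (L z)).hasFDerivAt.comp z L.hasFDerivAt
  have h2 : HasFDerivAt (fun z => τ * Θ z) _ z :=
    (differentiable_of_temperate hΘ z).hasFDerivAt.const_mul τ
  have h3 : HasFDerivAt (fun z => (((τ * Θ z : ℝ) : ℂ) * Complex.I)) _ z :=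
    (Complex.ofRealCLM.hasFDerivAt.comp z h2).mul_const Complex.I
  have h4 : HasFDerivAt (fun z => G (L z) * Complex.exp ((τ * Θ z : ℝ) * Complex.I)) _ z :=
    h1.mul h3.cexp
  rw [dv, h4.fderiv]
  simp [dv]
  ring

lemma amplitude_temperate {G : V → ℂ} (hG : G.HasTemperateGrowth) (L : E →L[ℝ] V) {Θ : E → ℝ}
    (hΘ : Θ.HasTemperateGrowth) (τ : ℝ) :
    (fun z => G (L z) * Complex.exp ((τ * Θ z : ℝ) * Complex.I)).HasTemperateGrowth :=
  (hG.comp L.hasTemperateGrowth).mul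
    (hasTemperateGrowth_exp_mul_I.comp ((HasTemperateGrowth.const τ).mul hΘ))

variable [MeasurableSpace E] [Fintype β]

/-- Third-order Hermite variation over the block `A`. -/
def hsum (μ : Measure E) (ξ : ι → E →L[ℝ] ℝ) (A : Finset ι) (z : E) : ℝ := ∑ i ∈ A, gh μ 3 (ξ i) z

/-- The drift produced by integrating by parts against the block `A`. -/
def drift (μ : Measure E) (ξ : ι → E →L[ℝ] ℝ) (L : E →L[ℝ] V) (A : Finset ι) (z : E) : V :=
  ∑ i ∈ A, gh μ 2 (ξ i) z • L (cvec μ (ξ i))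

/-- The bracket of the blocks `A` and `B`. -/
def bracket (μ : Measure E) (ξ : ι → E →L[ℝ] ℝ) (A B : Finset ι) (z : E) : ℝ :=
  3 * ∑ i ∈ A, ∑ j ∈ B, ξ j (cvec μ (ξ i)) * (gh μ 2 (ξ i) z * gh μ 2 (ξ j) z)

/-- The phase `∑ b, θ_b(Lz) S_b(z)`. -/
def phase (μ : Measure E) (ξ : ι → E →L[ℝ] ℝ) (L : E →L[ℝ] V) (A : β → Finset ι) (θ : β → V → ℝ)
    (z : E) : ℝ :=
  ∑ b, θ b (L z) * hsum μ ξ (A b) z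

variable {μ : Measure E}

@[fun_prop]
lemma hsum_temperate (ξ : ι → E →L[ℝ] ℝ) (A : Finset ι) : (hsum μ ξ A).HasTemperateGrowth := by
  unfold hsum; fun_prop

@[fun_prop]
lemma bracket_temperate (ξ : ι → E →L[ℝ] ℝ) (A B : Finset ι) :
    (bracket μ ξ A B).HasTemperateGrowth := by
  unfold bracket; fun_prop

lemma phase_temperate (ξ : ι → E →L[ℝ] ℝ) (L : E →L[ℝ] V) (A : β → Finset ι) {θ : β → V → ℝ}
    (hθ : ∀ b, (θ b).HasTemperateGrowth) : (phase μ ξ L A θ).HasTemperateGrowth := by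
  unfold phase
  exact HasTemperateGrowth.sum fun b _ => ((hθ b).comp L.hasTemperateGrowth).mul (hsum_temperate ξ (A b))

lemma dv_hsum (ξ : ι → E →L[ℝ] ℝ) (A : Finset ι) (c z : E) :
    dv c (hsum μ ξ A) z = 3 * ∑ j ∈ A, ξ j c * gh μ 2 (ξ j) z := by
  have h : ∀ j, DifferentiableAt ℝ (gh μ 3 (ξ j)) z := fun j =>
    differentiable_of_temperate (gh_temperate _ _) z
  unfold dv hsum
  rw [fderiv_fun_sum fun j _ => h j]
  simp only [sum_apply, Finset.mul_sum]
  refine Finset.sum_congr rfl fun j _ => ?_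
  have := dv_gh (μ := μ) c 3 (ξ j) z
  rw [dv] at this
  rw [this]; norm_num; ring

lemma dv_phase (ξ : ι → E →L[ℝ] ℝ) (L : E →L[ℝ] V) (A : β → Finset ι) {θ : β → V → ℝ}
    (hθ : ∀ b, (θ b).HasTemperateGrowth) (c z : E) :
    dv c (phase μ ξ L A θ) z = ∑ b, (dv (L c) (θ b) (L z) * hsum μ ξ (A b) z +
      θ b (L z) * (3 * ∑ j ∈ A b, ξ j c * gh μ 2 (ξ j) z)) := by
  have ht : ∀ b, (fun z => θ b (L z)).HasTemperateGrowth := fun b => (hθ b).comp L.hasTemperateGrowth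
  have h : ∀ b, dv c (fun z => θ b (L z) * hsum μ ξ (A b) z) z = dv (L c) (θ b) (L z) * hsum μ ξ (A b) z +
      θ b (L z) * (3 * ∑ j ∈ A b, ξ j c * gh μ 2 (ξ j) z) := fun b => by
    rw [dv_mul (ht b) (hsum_temperate _ _), dv_comp_clm (hθ b), dv_hsum]
  simp only [← h]
  unfold dv phase
  have hd : ∀ b ∈ Finset.univ, DifferentiableAt ℝ (fun z => θ b (L z) * hsum μ ξ (A b) z) z := fun b _ =>
    differentiable_of_temperate ((ht b).mul (hsum_temperate ξ (A b))) z
  rw [fderiv_fun_sum hd]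
  simp

variable [BorelSpace E] [FiniteDimensional ℝ E]

lemma integral_hsum_mul (hμ : CGauss μ) (ξ : ι → E →L[ℝ] ℝ) (L : E →L[ℝ] V) (A : β → Finset ι)
    {θ : β → V → ℝ} (hθ : ∀ b, (θ b).HasTemperateGrowth) (τ : ℝ) (b : β) {G : V → ℂ}
    (hG : G.HasTemperateGrowth) :
    ∫ z, hsum μ ξ (A b) z * (G (L z) * Complex.exp ((τ * phase μ ξ L A θ z : ℝ) * Complex.I)) ∂μ =
    ∫ z, Complex.exp ((τ * phase μ ξ L A θ z : ℝ) * Complex.I) *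
      (fderiv ℝ G (L z) (drift μ ξ L (A b) z) + Complex.I * (τ * G (L z) * (∑ b',
        (fderiv ℝ (θ b') (L z) (drift μ ξ L (A b) z) * hsum μ ξ (A b') z +
          θ b' (L z) * bracket μ ξ (A b) (A b') z) : ℝ))) ∂μ := by
  have := hμ.gauss
  have hΘ := phase_temperate (μ := μ) ξ L A hθ
  set F : E → ℂ := fun z => G (L z) * Complex.exp ((τ * phase μ ξ L A θ z : ℝ) * Complex.I) with hF
  have hFt : F.HasTemperateGrowth := amplitude_temperate hG L hΘ τ
  have hdF : ∀ c, (dv c F).HasTemperateGrowth := fun c => hasTemperateGrowth_dv hFt c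
  have e1 : ∀ z, (hsum μ ξ (A b) z : ℂ) * F z = ∑ i ∈ A b, gh μ (2 + 1) (ξ i) z • F z := by
    intro z
    simp [hsum, Finset.sum_mul]
  change ∫ z, (hsum μ ξ (A b) z : ℂ) * F z ∂μ = _
  simp only [e1]
  have hi1 : ∀ i ∈ A b, Integrable (fun z => gh μ (2 + 1) (ξ i) z • F z) μ := fun i _ =>
    integrable_of_temperate (by fun_prop)
  have hi2 : ∀ i ∈ A b, Integrable (fun z => gh μ 2 (ξ i) z • dv (cvec μ (ξ i)) F z) μ := fun i _ =>
    have := hdF (cvec μ (ξ i))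
    integrable_of_temperate (by fun_prop)
  rw [integral_finsetSum _ hi1, Finset.sum_congr rfl fun i _ => integral_gh_succ hμ 2 (ξ i) hFt,
    ← integral_finsetSum _ hi2]
  congr 1
  ext z
  simp only [hF, dv_amplitude hG L hΘ, dv_phase ξ L A hθ]
  simp only [dv, drift, bracket, map_sum, map_smul, smul_eq_mul, Complex.real_smul]
  have e2 : ∀ b' : β, (∑ i ∈ A b, gh μ 2 (ξ i) z * fderiv ℝ (θ b') (L z) (L (cvec μ (ξ i)))) *
      hsum μ ξ (A b') z + θ b' (L z) * (3 * ∑ i ∈ A b, ∑ j ∈ A b', ξ j (cvec μ (ξ i)) *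
        (gh μ 2 (ξ i) z * gh μ 2 (ξ j) z)) = ∑ i ∈ A b, gh μ 2 (ξ i) z *
      (fderiv ℝ (θ b') (L z) (L (cvec μ (ξ i))) * hsum μ ξ (A b') z +
        θ b' (L z) * (3 * ∑ j ∈ A b', ξ j (cvec μ (ξ i)) * gh μ 2 (ξ j) z)) := by
    intro b'
    simp only [Finset.mul_sum, Finset.sum_mul, ← Finset.sum_add_distrib, mul_add]
    refine Finset.sum_congr rfl fun i _ => ?_
    congr 1
    · ring
    · exact Finset.sum_congr rfl fun j _ => by ring
  simp only [e2]
  rw [Finset.sum_comm]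
  simp only [← Finset.mul_sum]
  push_cast
  rw [Finset.mul_sum (A b), Finset.mul_sum (A b), ← Finset.sum_add_distrib, Finset.mul_sum]
  refine Finset.sum_congr rfl fun i _ => ?_
  ring

end Phase

section Damp

variable {V : Type*} [NormedAddCommGroup V] [NormedSpace ℝ V]

lemma exists_damp_bound {P : V → ℂ} (hP : Cb P) {σ : V → ℝ} (hσ : Cb σ) :
    ∃ K : ℝ, 0 ≤ K ∧ ∀ s : ℝ, |s| ≤ 1 →
      (fun y => P y * (Real.exp (s * σ y) : ℝ)).HasTemperateGrowth ∧
      ∀ y, ‖P y * (Real.exp (s * σ y) : ℝ)‖ ≤ K ∧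
        ‖fderiv ℝ (fun y => P y * (Real.exp (s * σ y) : ℝ)) y‖ ≤ K := by
  obtain ⟨M1, h1, hM1⟩ := hP.bound
  obtain ⟨M2, h2, hM2⟩ := hP.fderiv_bound
  obtain ⟨M3, h3, hM3⟩ := hσ.bound
  obtain ⟨M4, h4, hM4⟩ := hσ.fderiv_bound
  obtain ⟨g, hg, hge⟩ := exists_temperate_exp M3
  refine ⟨Real.exp M3 * (M1 + M2 + M1 * M4), by positivity, fun s hs => ⟨?_, fun y => ?_⟩⟩
  · have e : (fun y => P y * (Real.exp (s * σ y) : ℝ)) = fun y => P y * (g (s * σ y) : ℝ) := by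
      ext y
      rw [hge]
      rw [abs_mul]
      have := hM3 y
      rw [Real.norm_eq_abs] at this
      nlinarith [abs_nonneg s, abs_nonneg (σ y)]
    rw [e]
    exact hP.temperate.mul (Complex.hasTemperateGrowth_ofReal.comp
      (hg.comp ((HasTemperateGrowth.const s).mul hσ.temperate)))
  · have hexp : Real.exp (s * σ y) ≤ Real.exp M3 := by
      refine Real.exp_le_exp.2 ((le_abs_self _).trans ?_)
      rw [abs_mul]
      have := hM3 y
      rw [Real.norm_eq_abs] at this
      nlinarith [abs_nonneg s, abs_nonneg (σ y)]
    have hn : ‖((Real.exp (s * σ y) : ℝ) : ℂ)‖ ≤ Real.exp M3 := by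
      rw [Complex.norm_real, Real.norm_of_nonneg (Real.exp_pos _).le]; exact hexp
    constructor
    · rw [norm_mul]
      calc _ ≤ M1 * Real.exp M3 := by gcongr; exact hM1 y
        _ ≤ _ := by nlinarith [Real.exp_pos M3, mul_nonneg h1 h4]
    · have d1 := (differentiable_of_temperate hP.temperate y).hasFDerivAt
      have d2 := ((differentiable_of_temperate hσ.temperate y).hasFDerivAt.const_mul s).exp
      have d3 : HasFDerivAt (fun y => ((Real.exp (s * σ y) : ℝ) : ℂ)) _ y :=
        Complex.ofRealCLM.hasFDerivAt.comp y d2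
      have d4 : HasFDerivAt (fun y => P y * (Real.exp (s * σ y) : ℝ)) _ y := d1.mul d3
      rw [d4.fderiv]
      refine ContinuousLinearMap.opNorm_le_bound _ (by positivity) fun v => ?_
      simp only [add_apply, smul_apply, ContinuousLinearMap.comp_apply,
        Complex.ofRealCLM_apply, smul_eq_mul]
      have b1 : ‖fderiv ℝ P y v‖ ≤ M2 * ‖v‖ :=
        (ContinuousLinearMap.le_opNorm _ _).trans (by gcongr; exact hM2 y)
      have b2 : |fderiv ℝ σ y v| ≤ M4 * ‖v‖ := by
        rw [← Real.norm_eq_abs]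
        exact (ContinuousLinearMap.le_opNorm _ _).trans (by gcongr; exact hM4 y)
      calc _ ≤ ‖P y‖ * (Real.exp (s * σ y) * (|s| * |fderiv ℝ σ y v|)) +
            ‖((Real.exp (s * σ y) : ℝ) : ℂ)‖ * ‖fderiv ℝ P y v‖ := by
            refine (norm_add_le _ _).trans (le_of_eq ?_)
            rw [norm_mul, norm_mul, Complex.norm_real, Real.norm_eq_abs, abs_mul, abs_mul,
              abs_of_pos (Real.exp_pos _)]
        _ ≤ M1 * (Real.exp M3 * (1 * (M4 * ‖v‖))) + Real.exp M3 * (M2 * ‖v‖) := by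
            gcongr
            exact hM1 y
        _ ≤ _ := by
            have : 0 ≤ Real.exp M3 * M1 * ‖v‖ := by positivity
            nlinarith

lemma exists_functionals (V : Type*) [NormedAddCommGroup V] [NormedSpace ℝ V] [FiniteDimensional ℝ V] :
    ∃ (m : ℕ) (ℓ : Fin m → V →L[ℝ] ℝ), ∀ x, ‖x‖ ^ 2 ≤ ∑ k, ℓ k x ^ 2 := by
  let b := Module.finBasis ℝ V
  refine ⟨_, fun k => (Real.sqrt (Module.finrank ℝ V) * ‖b k‖) • (b.coord k).toContinuousLinearMap,
    fun x => ?_⟩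
  have h1 : ‖x‖ ≤ ∑ k, |b.repr x k| * ‖b k‖ := by
    conv_lhs => rw [← b.sum_repr x]
    refine (norm_sum_le _ _).trans (le_of_eq ?_)
    simp [norm_smul]
  calc ‖x‖ ^ 2 ≤ (∑ k, |b.repr x k| * ‖b k‖) ^ 2 := by gcongr
    _ ≤ (Finset.univ : Finset (Fin (Module.finrank ℝ V))).card * ∑ k, (|b.repr x k| * ‖b k‖) ^ 2 :=
      sq_sum_le_card_mul_sum_sq
    _ = _ := by
      simp only [Finset.card_univ, Fintype.card_fin, Finset.mul_sum]
      refine Finset.sum_congr rfl fun k _ => ?_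
      simp [mul_pow, Real.sq_sqrt]
      ring

end Damp

lemma WeakCorr.mono {E V ι : Type*} [NormedAddCommGroup E] [NormedSpace ℝ E] [NormedAddCommGroup V]
    [NormedSpace ℝ V] [MeasurableSpace E] {μ : Measure E} {J A : Finset ι} {ξ : ι → E →L[ℝ] ℝ}
    {Λ : ι → E →L[ℝ] V} {κ C : ℝ} (h : WeakCorr μ J ξ Λ κ C) (hA : A ⊆ J) : WeakCorr μ A ξ Λ κ C where
  pos := h.pos
  le_one := h.le_one
  one_le := h.one_le
  card_le := by
    refine le_trans ?_ h.card_le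
    have := h.pos
    gcongr
  corr_le i hi j hj := h.corr_le i (hA hi) j (hA hj)
  corr_sum i hi := (Finset.sum_le_sum_of_subset_of_nonneg hA fun _ _ _ => abs_nonneg _).trans
    (h.corr_sum i (hA hi))
  cross_le i hi j hj := h.cross_le i (hA hi) j (hA hj)
  cross_sum j hj := (Finset.sum_le_sum_of_subset_of_nonneg hA fun _ _ _ => norm_nonneg _).trans
    (h.cross_sum j (hA hj))
  diag_sum := (Finset.sum_le_sum_of_subset_of_nonneg hA fun _ _ _ => norm_nonneg _).trans h.diag_sum

/-- Total size of the error terms in the integration by parts against the block `b`. -/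
def ibpError {E V ι β : Type*} [NormedAddCommGroup E] [NormedSpace ℝ E] [NormedAddCommGroup V]
    [NormedSpace ℝ V] [MeasurableSpace E] [Fintype β] (μ : Measure E) (ξ : ι → E →L[ℝ] ℝ)
    (L : E →L[ℝ] V) (A : β → Finset ι) (q : β → β → ℝ) (b : β) (z : E) : ℝ :=
  ‖drift μ ξ L (A b) z‖ + ∑ b', (‖drift μ ξ L (A b) z‖ * |hsum μ ξ (A b') z| +
    |bracket μ ξ (A b) (A b') z - q b b'|)

lemma ibpError_nonneg {E V ι β : Type*} [NormedAddCommGroup E] [NormedSpace ℝ E]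
    [NormedAddCommGroup V] [NormedSpace ℝ V] [MeasurableSpace E] [Fintype β] (μ : Measure E)
    (ξ : ι → E →L[ℝ] ℝ) (L : E →L[ℝ] V) (A : β → Finset ι) (q : β → β → ℝ) (b : β) (z : E) :
    0 ≤ ibpError μ ξ L A q b z := by
  unfold ibpError; positivity

lemma exists_ibpError_bound {V β : Type} [NormedAddCommGroup V] [NormedSpace ℝ V]
    [FiniteDimensional ℝ V] [Fintype β] (C : ℝ) :
    ∃ K : ℝ, 0 ≤ K ∧ ∀ {E ι : Type} [NormedAddCommGroup E] [NormedSpace ℝ E] [MeasurableSpace E]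
      [BorelSpace E] [FiniteDimensional ℝ E] {μ : Measure E} (_ : CGauss μ) {J : Finset ι}
      {ξ : ι → E →L[ℝ] ℝ} {κ : ℝ} (_ : WeakCorr μ J ξ (fun _ => (0 : E →L[ℝ] ℝ)) κ C)
      {A : β → Finset ι} (_ : ∀ b, A b ⊆ J) {L : E →L[ℝ] V}
      (_ : ∀ b, ∑ i ∈ A b, ‖L (cvec μ (ξ i))‖ ≤ C) {q : β → β → ℝ} {η : ℝ}
      (_ : ∀ b b', |6 * ∑ i ∈ A b, ∑ j ∈ A b', ξ j (cvec μ (ξ i)) ^ 3 - q b b'| ≤ η) (b : β),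
      ∫ z, ibpError μ ξ L A q b z ∂μ ≤ K * (κ + η) := by
  obtain ⟨m, ℓ, hℓ⟩ := exists_functionals V
  obtain ⟨K3, hK3, hS⟩ := exists_weighted_bound (Cb.const (V := ℝ) (1 : ℝ)) (p := 3) (by simp) C
  set D : ℝ := ∑ k, 2 * (‖ℓ k‖ * C) ^ 2 with hD
  have hD0 : 0 ≤ D := by positivity
  obtain ⟨n, hn⟩ : ∃ n : ℝ, n = Fintype.card β := ⟨_, rfl⟩
  have hn0 : 0 ≤ n := hn ▸ Nat.cast_nonneg _
  refine ⟨D + 1 + n * (D + K3 + 504 * C ^ 4 + 2), by positivity, ?_⟩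
  intro E ι _ _ _ _ _ μ hμ J ξ κ h A hA L hL q η hη b
  have := hμ.gauss
  have := hμ.gauss.toIsProbabilityMeasure
  have hκ := h.pos
  have hκ1 := h.le_one
  have hC := h.one_le
  have hη0 : 0 ≤ η := (abs_nonneg _).trans (hη b b)
  set N : E → ℝ := fun z => ∑ k, ℓ k (drift μ ξ L (A b) z) ^ 2 with hN
  have hNeq : ∀ k z, ℓ k (drift μ ξ L (A b) z) = ∑ i ∈ A b, gh μ 2 (ξ i) z * (ℓ k ∘L L) (cvec μ (ξ i)) :=
    fun k z => by simp [drift]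
  have hNkt : ∀ k, (fun z => ℓ k (drift μ ξ L (A b) z) ^ 2).HasTemperateGrowth := fun k => by
    simp only [hNeq]; fun_prop
  have hNi : Integrable N μ := integrable_finsetSum _ fun k _ => integrable_of_temperate (hNkt k)
  have hNint : ∫ z, N z ∂μ ≤ D * κ ^ 2 := by
    rw [hN, integral_finsetSum _ fun k _ => integrable_of_temperate (hNkt k), hD, Finset.sum_mul]
    refine Finset.sum_le_sum fun k _ => ?_
    simp only [hNeq]
    refine (integral_drift_sq_le hμ (D := ‖ℓ k‖ * C)
      (fun i hi j hj => h.corr_le i (hA b hi) j (hA b hj)) _ ?_).trans (le_of_eq (by ring))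
    calc _ ≤ ∑ i ∈ A b, ‖ℓ k‖ * ‖L (cvec μ (ξ i))‖ :=
          Finset.sum_le_sum fun i _ => by
            rw [← Real.norm_eq_abs]; exact (ℓ k).le_opNorm _
      _ ≤ _ := by rw [← Finset.mul_sum]; gcongr; exact hL b
  set Z : β → E → ℝ := fun b' z => bracket μ ξ (A b) (A b') z -
    6 * ∑ i ∈ A b, ∑ j ∈ A b', ξ j (cvec μ (ξ i)) ^ 3 with hZ
  have hSi : ∀ b', Integrable (fun z => hsum μ ξ (A b') z ^ 2) μ := fun b' =>
    integrable_of_temperate (by fun_prop)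
  have hZi : ∀ b', Integrable (fun z => Z b' z ^ 2) μ := fun b' =>
    integrable_of_temperate (by simp only [hZ]; fun_prop)
  have hSint : ∀ b', ∫ z, hsum μ ξ (A b') z ^ 2 ∂μ ≤ K3 := fun b' => by
    have := hS hμ (h.mono (hA b'))
    simp only [one_mul] at this
    have hp : 0 < κ ^ 3 := by positivity
    rw [mul_comm K3] at this
    exact le_of_mul_le_mul_left this hp
  have hZint : ∀ b', ∫ z, Z b' z ^ 2 ∂μ ≤ 504 * C ^ 4 * κ ^ 3 := fun b' => by
    have := integral_fluct_sq_le hμ h (hA b) (hA b')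
    have e : ∀ z, Z b' z ^ 2 = 9 * (∑ i ∈ A b, ∑ j ∈ A b', ξ j (cvec μ (ξ i)) *
      (gh μ 2 (ξ i) z * gh μ 2 (ξ j) z) - 2 * ∑ i ∈ A b, ∑ j ∈ A b', ξ j (cvec μ (ξ i)) ^ 3) ^ 2 :=
      fun z => by simp only [hZ, bracket]; ring
    simp only [e, integral_const_mul]
    linarith
  have hpt : ∀ z, ibpError μ ξ L A q b z ≤ (1 / κ * N z + κ) + ∑ b', (1 / κ * N z +
      κ * hsum μ ξ (A b') z ^ 2 + (1 / κ * Z b' z ^ 2 + (κ + η))) := by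
    intro z
    have hx := hℓ (drift μ ξ L (A b) z)
    have hyoung : ∀ x y : ℝ, x * y ≤ 1 / κ * x ^ 2 + κ * y ^ 2 := fun x y => by
      have : 1 / κ * x ^ 2 + κ * y ^ 2 - x * y = 1 / κ * ((x - κ * y / 2) ^ 2 + 3 / 4 * (κ * y) ^ 2) := by
        field_simp; ring
      have : 0 ≤ 1 / κ * ((x - κ * y / 2) ^ 2 + 3 / 4 * (κ * y) ^ 2) := by positivity
      linarith
    unfold ibpError
    gcongr with b' _
    · have := hyoung ‖drift μ ξ L (A b) z‖ 1
      have h2 : 1 / κ * ‖drift μ ξ L (A b) z‖ ^ 2 ≤ 1 / κ * N z := by gcongr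
      linarith
    · have := hyoung ‖drift μ ξ L (A b) z‖ |hsum μ ξ (A b') z|
      have h2 : 1 / κ * ‖drift μ ξ L (A b) z‖ ^ 2 ≤ 1 / κ * N z := by gcongr
      rw [sq_abs] at this
      linarith
    · have h1 := hyoung |Z b' z| 1
      rw [sq_abs] at h1
      have h2 := abs_sub_le (bracket μ ξ (A b) (A b') z)
        (6 * ∑ i ∈ A b, ∑ j ∈ A b', ξ j (cvec μ (ξ i)) ^ 3) (q b b')
      have h3 := hη b b'
      have h4 : |bracket μ ξ (A b) (A b') z -
        6 * ∑ i ∈ A b, ∑ j ∈ A b', ξ j (cvec μ (ξ i)) ^ 3| = |Z b' z| := rfl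
      linarith
  have i1 : Integrable (fun z => 1 / κ * N z + κ) μ := (hNi.const_mul _).add (integrable_const _)
  have i2 : ∀ b', Integrable (fun z => 1 / κ * N z + κ * hsum μ ξ (A b') z ^ 2) μ := fun b' =>
    (hNi.const_mul _).add ((hSi b').const_mul _)
  have i3 : ∀ b', Integrable (fun z => 1 / κ * Z b' z ^ 2 + (κ + η)) μ := fun b' =>
    ((hZi b').const_mul _).add (integrable_const _)
  have i4 : ∀ b' ∈ (Finset.univ : Finset β), Integrable (fun z => 1 / κ * N z +
      κ * hsum μ ξ (A b') z ^ 2 + (1 / κ * Z b' z ^ 2 + (κ + η))) μ := fun b' _ => (i2 b').add (i3 b')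
  have hN1 : 1 / κ * ∫ z, N z ∂μ ≤ D * κ := by
    calc _ ≤ 1 / κ * (D * κ ^ 2) := by gcongr
      _ = _ := by field_simp
  have c1 : ∫ z, (1 / κ * N z + κ) ∂μ ≤ (D + 1) * κ := by
    rw [integral_add (hNi.const_mul _) (integrable_const _), integral_const_mul]
    simp only [integral_const, probReal_univ, one_smul]
    linarith
  have c2 : ∀ b', ∫ z, (1 / κ * N z + κ * hsum μ ξ (A b') z ^ 2 + (1 / κ * Z b' z ^ 2 + (κ + η))) ∂μ ≤
      (D + K3 + 504 * C ^ 4 + 2) * (κ + η) := by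
    intro b'
    rw [integral_add (i2 b') (i3 b'), integral_add (hNi.const_mul _) ((hSi b').const_mul _),
      integral_add ((hZi b').const_mul _) (integrable_const _), integral_const_mul, integral_const_mul,
      integral_const_mul]
    simp only [integral_const, probReal_univ, one_smul]
    have a1 : κ * ∫ z, hsum μ ξ (A b') z ^ 2 ∂μ ≤ κ * K3 := by gcongr; exact hSint b'
    have a2 : 1 / κ * ∫ z, Z b' z ^ 2 ∂μ ≤ 504 * C ^ 4 * κ := by
      calc _ ≤ 1 / κ * (504 * C ^ 4 * κ ^ 3) := by gcongr; exact hZint b'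
        _ = 504 * C ^ 4 * κ * κ := by field_simp
        _ ≤ 504 * C ^ 4 * κ * 1 := by gcongr
        _ = _ := by ring
    have : 0 ≤ (D + K3 + 504 * C ^ 4 + 1) * η + κ := by positivity
    nlinarith
  calc _ ≤ ∫ z, ((1 / κ * N z + κ) + ∑ b', (1 / κ * N z +
      κ * hsum μ ξ (A b') z ^ 2 + (1 / κ * Z b' z ^ 2 + (κ + η)))) ∂μ := by
        refine integral_mono_of_nonneg (Eventually.of_forall (ibpError_nonneg μ ξ L A q b))
          (i1.add (integrable_finsetSum _ i4)) (Eventually.of_forall hpt)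
    _ = ∫ z, (1 / κ * N z + κ) ∂μ + ∑ b', ∫ z, (1 / κ * N z +
      κ * hsum μ ξ (A b') z ^ 2 + (1 / κ * Z b' z ^ 2 + (κ + η))) ∂μ := by
        rw [integral_add i1 (integrable_finsetSum _ i4), integral_finsetSum _ i4]
    _ ≤ (D + 1) * κ + ∑ b' : β, (D + K3 + 504 * C ^ 4 + 2) * (κ + η) := by
        gcongr with b' _
        exact c2 b'
    _ ≤ _ := by
        simp only [Finset.sum_const, Finset.card_univ, nsmul_eq_mul, ← hn]
        have : 0 ≤ (D + 1) * η := by positivity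
        nlinarith

lemma Cb.sum {V G β : Type*} [NormedAddCommGroup V] [NormedSpace ℝ V] [NormedAddCommGroup G]
    [NormedSpace ℝ G] {s : Finset β} {g : β → V → G} (hg : ∀ b ∈ s, Cb (g b)) :
    Cb (fun x => ∑ b ∈ s, g b x) := by
  classical
  induction s using Finset.induction_on with
  | empty => simpa using Cb.const (0 : G)
  | insert b s hb ih =>
    simp only [Finset.sum_insert hb]
    exact (hg b (by simp)).add (ih fun b' hb' => hg b' (by simp [hb']))

lemma Cb.ofReal {V : Type*} [NormedAddCommGroup V] [NormedSpace ℝ V] {g : V → ℝ} (hg : Cb g) :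
    Cb (fun x => (g x : ℂ)) := hg.clm_comp Complex.ofRealCLM

lemma norm_error_term_le {V β : Type*} [NormedAddCommGroup V] [NormedSpace ℝ V] [Fintype β]
    {g : ℂ} {Dg : V →L[ℝ] ℂ} {θ S B q : β → ℝ} {Dθ : β → V →L[ℝ] ℝ} {τ K M : ℝ} {e : ℂ} {x : V}
    (he : ‖e‖ = 1) (hg : ‖g‖ ≤ K) (hDg : ‖Dg‖ ≤ K) (hθ : ∀ b, |θ b| ≤ M) (hDθ : ∀ b, ‖Dθ b‖ ≤ M)
    (hτ : |τ| ≤ 1) (hM : 1 ≤ M) :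
    ‖Complex.I * (e * (Dg x + Complex.I * (τ * g * (∑ b, (Dθ b x * S b + θ b * B b) : ℝ)))) +
      τ * (e * g * (∑ b, θ b * q b : ℝ))‖ ≤
      K * M * (‖x‖ + ∑ b, (‖x‖ * |S b| + |B b - q b|)) := by
  have hK : 0 ≤ K := (norm_nonneg _).trans hg
  have e1 : Complex.I * (e * (Dg x + Complex.I * (τ * g * (∑ b, (Dθ b x * S b + θ b * B b) : ℝ)))) +
      τ * (e * g * (∑ b, θ b * q b : ℝ)) =
      e * (Complex.I * Dg x - τ * g * (∑ b, (Dθ b x * S b + θ b * (B b - q b)) : ℝ)) := by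
    have : ∑ b, (Dθ b x * S b + θ b * (B b - q b)) = ∑ b, (Dθ b x * S b + θ b * B b) -
        ∑ b, θ b * q b := by
      rw [← Finset.sum_sub_distrib]; exact Finset.sum_congr rfl fun b _ => by ring
    rw [this]
    have hI := Complex.I_mul_I
    push_cast
    linear_combination (e * τ * g * (∑ b, ((Dθ b x : ℂ) * S b + θ b * B b))) * hI
  rw [e1, norm_mul, he, one_mul]
  have h1 : ‖Dg x‖ ≤ K * ‖x‖ := (Dg.le_opNorm x).trans (by gcongr)
  have h2 : ∀ b, |Dθ b x| ≤ M * ‖x‖ := fun b => by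
    rw [← Real.norm_eq_abs]; exact ((Dθ b).le_opNorm x).trans (by gcongr; exact hDθ b)
  have h3 : |∑ b, (Dθ b x * S b + θ b * (B b - q b))| ≤ ∑ b, M * (‖x‖ * |S b| + |B b - q b|) := by
    refine (Finset.abs_sum_le_sum_abs _ _).trans (Finset.sum_le_sum fun b _ => ?_)
    refine (abs_add_le _ _).trans ?_
    rw [abs_mul, abs_mul]
    have : |Dθ b x| * |S b| ≤ M * ‖x‖ * |S b| := by gcongr; exact h2 b
    have : |θ b| * |B b - q b| ≤ M * |B b - q b| := by gcongr; exact hθ b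
    linarith
  rw [← Finset.mul_sum] at h3
  refine (norm_sub_le _ _).trans ?_
  rw [norm_mul, norm_mul, norm_mul, Complex.norm_I, Complex.norm_real, Complex.norm_real,
    Real.norm_eq_abs, Real.norm_eq_abs, one_mul]
  calc _ ≤ K * ‖x‖ + 1 * K * (M * ∑ b, (‖x‖ * |S b| + |B b - q b|)) := by gcongr
    _ ≤ _ := by
      have : K * ‖x‖ ≤ K * M * ‖x‖ := by
        have : 0 ≤ K * ‖x‖ := by positivity
        nlinarith
      linarith

/-- Quantitative conditional central limit theorem for the weighted sums `∑ b, θ_b(Lz) S_b(z)`. -/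
theorem exists_clt_bound {V β : Type} [NormedAddCommGroup V] [NormedSpace ℝ V]
    [FiniteDimensional ℝ V] [Fintype β] {Ψ : V → ℂ} (hΨ : Cb Ψ) {θ : β → V → ℝ} (hθ : ∀ b, Cb (θ b))
    (q : β → β → ℝ) (C : ℝ) :
    ∃ K : ℝ, 0 ≤ K ∧ ∀ {E ι : Type} [NormedAddCommGroup E] [NormedSpace ℝ E] [MeasurableSpace E]
      [BorelSpace E] [FiniteDimensional ℝ E] {μ : Measure E} (_ : CGauss μ) {J : Finset ι}
      {ξ : ι → E →L[ℝ] ℝ} {κ : ℝ} (_ : WeakCorr μ J ξ (fun _ => (0 : E →L[ℝ] ℝ)) κ C)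
      {A : β → Finset ι} (_ : ∀ b, A b ⊆ J) {L : E →L[ℝ] V}
      (_ : ∀ b, ∑ i ∈ A b, ‖L (cvec μ (ξ i))‖ ≤ C) {η : ℝ}
      (_ : ∀ b b', |6 * ∑ i ∈ A b, ∑ j ∈ A b', ξ j (cvec μ (ξ i)) ^ 3 - q b b'| ≤ η),
      ‖∫ z, Ψ (L z) * Complex.exp ((phase μ ξ L A θ z : ℝ) * Complex.I) ∂μ -
        ∫ z, Ψ (L z) * (Real.exp (-1 / 2 * ∑ b, ∑ b', θ b (L z) * θ b' (L z) * q b b') : ℝ) ∂μ‖ ≤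
        K * (κ + η) := by
  set σ : V → ℝ := fun y => ∑ b, ∑ b', θ b y * θ b' y * q b b' with hσdef
  have hσ : Cb σ := Cb.sum fun b _ => Cb.sum fun b' _ => ((hθ b).mul (hθ b')).mul (Cb.const _)
  have hP : ∀ b, Cb fun y => Ψ y * (θ b y : ℂ) := fun b => hΨ.mul (hθ b).ofReal
  choose KG hKG0 hKG using fun b => exists_damp_bound (hP b) hσ
  obtain ⟨K0, hK00, hK0⟩ := exists_damp_bound hΨ hσ
  obtain ⟨Mσ, hMσ0, hMσ⟩ := hσ.bound
  choose M1 hM10 hM1 using fun b => (hθ b).bound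
  choose M2 hM20 hM2 using fun b => (hθ b).fderiv_bound
  set M : ℝ := 1 + ∑ b, (M1 b + M2 b) with hM
  set KK : ℝ := ∑ b, KG b with hKK
  have hM1' : ∀ b, M1 b + M2 b ≤ M := fun b => by
    have := Finset.single_le_sum (f := fun b => M1 b + M2 b)
      (fun b _ => add_nonneg (hM10 b) (hM20 b)) (Finset.mem_univ b)
    linarith
  have hMone : 1 ≤ M := by
    have : 0 ≤ ∑ b, (M1 b + M2 b) := Finset.sum_nonneg fun b _ => add_nonneg (hM10 b) (hM20 b)
    linarith
  have hKK' : ∀ b, KG b ≤ KK := fun b =>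
    Finset.single_le_sum (f := KG) (fun b _ => hKG0 b) (Finset.mem_univ b)
  have hKK0 : 0 ≤ KK := Finset.sum_nonneg fun b _ => hKG0 b
  obtain ⟨KE, hKE0, hKE⟩ := exists_ibpError_bound (V := V) (β := β) C
  refine ⟨∑ _b : β, KK * M * KE, by positivity, ?_⟩
  intro E ι _ _ _ _ _ μ hμ J ξ κ h A hA L hL η hη
  have := hμ.gauss
  have := hμ.gauss.toIsProbabilityMeasure
  have hθt : ∀ b, (θ b).HasTemperateGrowth := fun b => (hθ b).temperate
  set Θ : E → ℝ := phase μ ξ L A θ with hΘdef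
  have hΘ : Θ.HasTemperateGrowth := phase_temperate ξ L A hθt
  set s : ℝ → ℝ := fun τ => -(1 - τ ^ 2) / 2 with hs
  set ex : ℝ → E → ℂ := fun τ z => Complex.exp ((τ * Θ z : ℝ) * Complex.I) with hex
  have hexn : ∀ τ z, ‖ex τ z‖ = 1 := fun τ z => Complex.norm_exp_ofReal_mul_I _
  set F : ℝ → E → ℂ := fun τ z => Ψ (L z) * (Real.exp (s τ * σ (L z)) : ℝ) * ex τ z with hF
  set F' : ℝ → E → ℂ := fun τ z => F τ z * ((τ * σ (L z) : ℝ) + (Θ z : ℝ) * Complex.I) with hF'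
  have hs1 : ∀ τ : ℝ, |τ| ≤ 3 / 2 → |s τ| ≤ 1 := fun τ hτ => by
    have := abs_le.1 hτ
    simp only [hs, abs_le]
    constructor <;> nlinarith
  have hFt : ∀ τ : ℝ, |τ| ≤ 3 / 2 → (F τ).HasTemperateGrowth := fun τ hτ =>
    amplitude_temperate (hK0 _ (hs1 τ hτ)).1 L hΘ τ
  have hΘc : (fun z => (Θ z : ℂ)).HasTemperateGrowth := Complex.hasTemperateGrowth_ofReal.comp hΘ
  have hσc : (fun z => (σ (L z) : ℂ)).HasTemperateGrowth :=
    Complex.hasTemperateGrowth_ofReal.comp (hσ.temperate.comp L.hasTemperateGrowth)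
  have hF't : ∀ τ : ℝ, |τ| ≤ 3 / 2 → (F' τ).HasTemperateGrowth := fun τ hτ => by
    have h1 := hFt τ hτ
    simp only [hF', Complex.ofReal_mul]
    fun_prop
  have hderiv : ∀ τ ∈ Set.Icc (0 : ℝ) 1, HasDerivAt (fun τ => ∫ z, F τ z ∂μ) (∫ z, F' τ z ∂μ) τ := by
    intro τ hτ
    have hball : ∀ x ∈ Metric.ball τ (1 / 2), |x| ≤ 3 / 2 := fun x hx => by
      rw [Metric.mem_ball, Real.dist_eq] at hx
      have := abs_lt.1 hx
      rw [abs_le]; constructor <;> linarith [hτ.1, hτ.2]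
    have hτ' : |τ| ≤ 3 / 2 := hball τ (Metric.mem_ball_self (by norm_num))
    refine (hasDerivAt_integral_of_dominated_loc_of_deriv_le
      (bound := fun z => K0 * (3 / 2 * Mσ + ‖Θ z‖))
      (Metric.ball_mem_nhds τ (by norm_num : (0 : ℝ) < 1 / 2)) ?_
      (integrable_of_temperate (hFt τ hτ')) (integrable_of_temperate (hF't τ hτ')).1 ?_ ?_ ?_).2
    · filter_upwards [Metric.ball_mem_nhds τ (by norm_num : (0 : ℝ) < 1 / 2)] with x hx
      exact (integrable_of_temperate (hFt x (hball x hx))).1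
    · refine Eventually.of_forall fun z x hx => ?_
      simp only [hF', hF]
      rw [norm_mul, norm_mul, hexn, mul_one]
      have h1 := ((hK0 _ (hs1 x (hball x hx))).2 (L z)).1
      have h2 : ‖((x * σ (L z) : ℝ) : ℂ) + (Θ z : ℝ) * Complex.I‖ ≤ 3 / 2 * Mσ + ‖Θ z‖ := by
        refine (norm_add_le _ _).trans ?_
        rw [norm_mul, Complex.norm_I, mul_one, Complex.norm_real, Complex.norm_real, norm_mul]
        gcongr
        · exact hball x hx
        · exact hMσ _
      gcongr
    · exact ((integrable_const _).add (integrable_of_temperate hΘ).norm).const_mul _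
    · refine Eventually.of_forall fun z x hx => ?_
      have d1 : HasDerivAt s x x := by
        have : HasDerivAt (fun τ : ℝ => -(1 - τ ^ 2) / 2) _ x :=
          ((hasDerivAt_pow 2 x).const_sub 1).neg.div_const 2
        convert this using 1
        simp
      have d2 : HasDerivAt (fun x => ((Real.exp (s x * σ (L z)) : ℝ) : ℂ)) _ x :=
        ((d1.mul_const (σ (L z))).exp).ofReal_comp
      have d3 : HasDerivAt (fun x => (((x * Θ z : ℝ) : ℂ) * Complex.I)) _ x :=
        (((hasDerivAt_id x).mul_const (Θ z)).ofReal_comp).mul_const Complex.I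
      have d4 : HasDerivAt (fun x => F x z) _ x := ((d2.const_mul (Ψ (L z))).mul d3.cexp)
      refine d4.congr_deriv ?_
      simp only [hF', hF, hex]
      push_cast
      ring
  set G : ℝ → β → V → ℂ := fun τ b y => Ψ y * (θ b y : ℂ) * (Real.exp (s τ * σ y) : ℝ) with hG
  have hGt : ∀ τ : ℝ, |τ| ≤ 3 / 2 → ∀ b, (G τ b).HasTemperateGrowth := fun τ hτ b =>
    (hKG b _ (hs1 τ hτ)).1
  have hbd : ∀ τ ∈ Set.Ico (0 : ℝ) 1, ‖∫ z, F' τ z ∂μ‖ ≤ (∑ _b : β, KK * M * KE) * (κ + η) := by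
    intro τ hτ
    have hτ1 : |τ| ≤ 1 := by rw [abs_le]; constructor <;> linarith [hτ.1, hτ.2]
    have hτ2 : |τ| ≤ 3 / 2 := by linarith
    have hAt : ∀ b, (fun z => G τ b (L z) * ex τ z).HasTemperateGrowth := fun b =>
      amplitude_temperate (hGt τ hτ2 b) L hΘ τ
    set T1 : β → E → ℂ := fun b z => hsum μ ξ (A b) z * (G τ b (L z) * ex τ z) with hT1
    set T2 : β → E → ℂ := fun b z => τ * (ex τ z * G τ b (L z) * (∑ b', θ b' (L z) * q b b' : ℝ)) with hT2
    set T3 : β → E → ℂ := fun b z => ex τ z *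
      (fderiv ℝ (G τ b) (L z) (drift μ ξ L (A b) z) + Complex.I * (τ * G τ b (L z) * (∑ b',
        (fderiv ℝ (θ b') (L z) (drift μ ξ L (A b) z) * hsum μ ξ (A b') z +
          θ b' (L z) * bracket μ ξ (A b) (A b') z) : ℝ))) with hT3
    have hT1i : ∀ b, Integrable (T1 b) μ := fun b => integrable_of_temperate
      ((Complex.hasTemperateGrowth_ofReal.comp (hsum_temperate ξ (A b))).mul (hAt b))
    have hqc : ∀ b, (fun z => ((∑ b', θ b' (L z) * q b b' : ℝ) : ℂ)).HasTemperateGrowth := fun b =>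
      Complex.hasTemperateGrowth_ofReal.comp (HasTemperateGrowth.sum fun b' _ =>
        ((hθt b').comp L.hasTemperateGrowth).mul (HasTemperateGrowth.const _))
    have hT2i : ∀ b, Integrable (T2 b) μ := fun b => integrable_of_temperate (by
      have h1 := hAt b
      have h2 := hqc b
      have : T2 b = fun z => τ * ((G τ b (L z) * ex τ z) * (∑ b', θ b' (L z) * q b b' : ℝ)) := by
        ext z; simp only [hT2]; ring
      rw [this]
      fun_prop)
    have hT13 : ∀ b, ∫ z, T1 b z ∂μ = ∫ z, T3 b z ∂μ := fun b =>
      integral_hsum_mul hμ ξ L A hθt τ b (hGt τ hτ2 b)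
    have e1 : ∀ z, F' τ z = ∑ b, (Complex.I * T1 b z + T2 b z) := by
      intro z
      have : σ (L z) = ∑ b, θ b (L z) * ∑ b', θ b' (L z) * q b b' := by
        simp only [hσdef, Finset.mul_sum, mul_assoc]
      simp only [hF', hF, hT1, hT2, hG, this, hΘdef, phase, mul_add, Finset.mul_sum, Finset.sum_mul,
        Finset.sum_add_distrib, Complex.ofReal_sum, Complex.ofReal_mul]
      rw [add_comm]
      congr 1
      · exact Finset.sum_congr rfl fun b _ => by ring
      · exact Finset.sum_congr rfl fun b _ => Finset.sum_congr rfl fun b' _ => by ring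
    have hsumI : ∀ b ∈ (Finset.univ : Finset β), Integrable (fun z => Complex.I * T1 b z + T2 b z) μ :=
      fun b _ => ((hT1i b).const_mul _).add (hT2i b)
    rw [integral_congr_ae (Eventually.of_forall e1), integral_finsetSum _ hsumI, Finset.sum_mul]
    refine (norm_sum_le _ _).trans (Finset.sum_le_sum fun b _ => ?_)
    have hdr : (drift μ ξ L (A b)).HasTemperateGrowth := by unfold drift; fun_prop
    have happ : ∀ {H : Type} [NormedAddCommGroup H] [NormedSpace ℝ H] {g : V → H},
        g.HasTemperateGrowth → (fun z => fderiv ℝ g (L z) (drift μ ξ L (A b) z)).HasTemperateGrowth :=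
      fun hg => (ContinuousLinearMap.id ℝ _).bilinear_hasTemperateGrowth
        ((hasTemperateGrowth_fderiv hg).comp L.hasTemperateGrowth) hdr
    have hbr : (fun z => ((∑ b', (fderiv ℝ (θ b') (L z) (drift μ ξ L (A b) z) * hsum μ ξ (A b') z +
          θ b' (L z) * bracket μ ξ (A b) (A b') z) : ℝ) : ℂ)).HasTemperateGrowth :=
      Complex.hasTemperateGrowth_ofReal.comp (HasTemperateGrowth.sum fun b' _ =>
        ((happ (hθt b')).mul (hsum_temperate ξ (A b'))).add
          (((hθt b').comp L.hasTemperateGrowth).mul (bracket_temperate ξ (A b) (A b'))))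
    have hT3i : Integrable (T3 b) μ := integrable_of_temperate (by
      have h1 := hAt b
      have h2 := happ (hGt τ hτ2 b)
      have hext : (ex τ).HasTemperateGrowth :=
        hasTemperateGrowth_exp_mul_I.comp ((HasTemperateGrowth.const τ).mul hΘ)
      have : T3 b = fun z => ex τ z * fderiv ℝ (G τ b) (L z) (drift μ ξ L (A b) z) +
          (G τ b (L z) * ex τ z) * (Complex.I * τ * ((∑ b', (fderiv ℝ (θ b') (L z)
            (drift μ ξ L (A b) z) * hsum μ ξ (A b') z +
              θ b' (L z) * bracket μ ξ (A b) (A b') z) : ℝ) : ℂ)) := by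
        ext z; simp only [hT3]; ring
      rw [this]
      fun_prop)
    rw [integral_add ((hT1i b).const_mul _) (hT2i b), integral_const_mul, hT13, ← integral_const_mul,
      ← integral_add (hT3i.const_mul _) (hT2i b)]
    have hib : Integrable (fun z => KK * M * ibpError μ ξ L A q b z) μ := by
      refine Integrable.const_mul ((integrable_of_temperate hdr).norm.add
        (integrable_finsetSum _ fun b' _ => ?_)) _
      refine Integrable.add ?_ ?_
      · have : Integrable (fun z => hsum μ ξ (A b') z • drift μ ξ L (A b) z) μ :=
          integrable_of_temperate (by fun_prop)
        refine this.norm.congr (Eventually.of_forall fun z => ?_)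
        simp [norm_smul, mul_comm]
      · have : Integrable (fun z => bracket μ ξ (A b) (A b') z - q b b') μ :=
          integrable_of_temperate (by fun_prop)
        exact this.norm
    calc _ ≤ ∫ z, KK * M * ibpError μ ξ L A q b z ∂μ := by
          refine norm_integral_le_of_norm_le hib (Eventually.of_forall fun z => ?_)
          have hbz := (hKG b _ (hs1 τ hτ2)).2 (L z)
          exact norm_error_term_le (e := ex τ z) (g := G τ b (L z)) (hexn τ z)
            (hbz.1.trans (hKK' b)) (hbz.2.trans (hKK' b))
            (fun b' => (hM1 b' (L z)).trans (by linarith [hM1' b', hM20 b']))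
            (fun b' => (hM2 b' (L z)).trans (by linarith [hM1' b', hM10 b'])) hτ1 hMone
      _ ≤ KK * M * (KE * (κ + η)) := by
          rw [integral_const_mul]
          gcongr
          exact hKE hμ h hA hL hη b
      _ = _ := by ring
  have key := norm_image_sub_le_of_norm_deriv_le_segment_01'
    (fun τ hτ => (hderiv τ hτ).hasDerivWithinAt) hbd
  have e1 : ∀ z, F 1 z = Ψ (L z) * Complex.exp ((phase μ ξ L A θ z : ℝ) * Complex.I) := fun z => by
    simp [F, s, ex, Θ]
  have e0 : ∀ z, F 0 z = Ψ (L z) *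
      (Real.exp (-1 / 2 * ∑ b, ∑ b', θ b (L z) * θ b' (L z) * q b b') : ℝ) := fun z => by
    simp [F, s, ex, σ]
  simpa only [e1, e0] using key

/-- The odd real cube root. -/
def cbrt (x : ℝ) : ℝ := SignType.sign x * |x| ^ (1 / 3 : ℝ)

lemma abs_cbrt (x : ℝ) : |cbrt x| = |x| ^ (1 / 3 : ℝ) := by
  rcases lt_trichotomy x 0 with h | h | h
  · simp [cbrt, h, abs_of_nonneg (Real.rpow_nonneg (abs_nonneg x) _)]
  · subst h; simp [cbrt]
  · simp [cbrt, h, abs_of_nonneg (Real.rpow_nonneg (abs_nonneg x) _)]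

lemma rpow_third_pow {x : ℝ} (hx : 0 ≤ x) : (x ^ (1 / 3 : ℝ)) ^ 3 = x := by
  rw [← Real.rpow_natCast, ← Real.rpow_mul hx]; norm_num

lemma cbrt_pow (x : ℝ) : cbrt x ^ 3 = x := by
  rw [cbrt, mul_pow, rpow_third_pow (abs_nonneg x)]
  rcases lt_trichotomy x 0 with h | h | h <;> simp [h, abs_of_neg, abs_of_pos]
  ring

lemma cbrt_mono : Monotone cbrt := by
  intro x y h
  rw [← cbrt_pow x, ← cbrt_pow y] at h
  exact (Odd.strictMono_pow (by decide : Odd 3)).le_iff_le.1 h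

lemma cbrt_of_nonneg {x : ℝ} (hx : 0 ≤ x) : cbrt x = x ^ (1 / 3 : ℝ) := by
  rcases hx.eq_or_lt with rfl | h
  · simp [cbrt]
  · simp [cbrt, h, abs_of_pos]

lemma cbrt_neg (x : ℝ) : cbrt (-x) = - cbrt x := by
  simp [cbrt, Left.sign_neg]

lemma cbrt_sub_le {x y : ℝ} (h : x ≤ y) : cbrt y - cbrt x ≤ 2 * (y - x) ^ (1 / 3 : ℝ) := by
  have h1 := cbrt_mono h
  have hx := cbrt_pow x
  have hy := cbrt_pow y
  set a := cbrt x
  set b := cbrt y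
  have h2 : (b - a) ^ 3 ≤ (2 * (y - x) ^ (1 / 3 : ℝ)) ^ 3 := by
    rw [mul_pow, rpow_third_pow (by linarith), ← hx, ← hy]
    have : 0 ≤ (b - a) * (a + b) ^ 2 := mul_nonneg (by linarith) (sq_nonneg _)
    have : 0 ≤ b ^ 3 - a ^ 3 := by rw [hx, hy]; linarith
    nlinarith
  exact le_of_pow_le_pow_left₀ (by norm_num) (by have := sub_nonneg.2 h; positivity) h2

/-- The covariance for the Hurst index `1/6`. -/
def cov6 (t s : ℝ) : ℝ := covH (1 / 6) t s

lemma cov6_eq (t s : ℝ) : cov6 t s = (|cbrt t| + |cbrt s| - |cbrt (t - s)|) / 2 := by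
  simp only [cov6, covH, abs_cbrt]; norm_num

lemma abs_cov6_sub_le {a b : ℝ} (h : a ≤ b) (s : ℝ) :
    |cov6 b s - cov6 a s| ≤ (cbrt b - cbrt a) / 2 + (cbrt (b - s) - cbrt (a - s)) / 2 := by
  have h1 := abs_abs_sub_abs_le_abs_sub (cbrt b) (cbrt a)
  have h2 := abs_abs_sub_abs_le_abs_sub (cbrt (b - s)) (cbrt (a - s))
  rw [abs_of_nonneg (sub_nonneg.2 (cbrt_mono h))] at h1
  rw [abs_of_nonneg (sub_nonneg.2 (cbrt_mono (by linarith : a - s ≤ b - s)))] at h2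
  rw [cov6_eq, cov6_eq]
  rw [abs_le] at *
  constructor <;> linarith [h1.1, h1.2, h2.1, h2.2]

lemma abs_cov6_sub_le' {a b : ℝ} (h : a ≤ b) (s : ℝ) :
    |cov6 b s - cov6 a s| ≤ 2 * (b - a) ^ (1 / 3 : ℝ) := by
  have h0 := abs_cov6_sub_le h s
  have h1 := cbrt_sub_le h
  have h2 := cbrt_sub_le (by linarith : a - s ≤ b - s)
  rw [sub_sub_sub_cancel_right] at h2
  linarith

lemma sum_abs_cov6_le {N : ℕ} {τ : ℕ → ℝ} (hτ : Monotone τ) (s : ℝ) :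
    ∑ i ∈ Finset.range N, |cov6 (τ (i + 1)) s - cov6 (τ i) s| ≤ 2 * (τ N - τ 0) ^ (1 / 3 : ℝ) := by
  calc _ ≤ ∑ i ∈ Finset.range N, ((cbrt (τ (i + 1)) / 2 + cbrt (τ (i + 1) - s) / 2) -
        (cbrt (τ i) / 2 + cbrt (τ i - s) / 2)) := by
        refine Finset.sum_le_sum fun i _ => ?_
        have := abs_cov6_sub_le (hτ (Nat.le_succ i)) s
        simp only [Nat.succ_eq_add_one] at this
        linarith
    _ = (cbrt (τ N) / 2 + cbrt (τ N - s) / 2) - (cbrt (τ 0) / 2 + cbrt (τ 0 - s) / 2) :=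
        Finset.sum_range_sub (fun i => cbrt (τ i) / 2 + cbrt (τ i - s) / 2) N
    _ ≤ _ := by
        have h := hτ (Nat.zero_le N)
        have h1 := cbrt_sub_le h
        have h2 := cbrt_sub_le (by linarith : τ 0 - s ≤ τ N - s)
        rw [sub_sub_sub_cancel_right] at h2
        linarith

/-- The correlation sequence of the increments for the Hurst index `1/6`. -/
def rho6 (k : ℤ) : ℝ := rhoH (1 / 6) k

lemma rho6_eq (k : ℤ) : rho6 k = (|cbrt (k + 1)| + |cbrt (k - 1)| - 2 * |cbrt k|) / 2 := by
  simp only [rho6, rhoH, abs_cbrt]; norm_num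

lemma rho6_neg (k : ℤ) : rho6 (-k) = rho6 k := by
  simp only [rho6_eq]
  push_cast
  have h1 : (-(k : ℝ) + 1) = -(k - 1) := by ring
  have h2 : (-(k : ℝ) - 1) = -(k + 1) := by ring
  rw [h1, h2, cbrt_neg, cbrt_neg, cbrt_neg, abs_neg, abs_neg, abs_neg]
  ring

lemma two_mul_cbrt_ge (k : ℕ) : cbrt (k + 2) + cbrt k ≤ 2 * cbrt (k + 1) := by
  have hconc : ConcaveOn ℝ (Set.Ici 0) fun x : ℝ => x ^ (1 / 3 : ℝ) :=
    Real.concaveOn_rpow (by norm_num) (by norm_num)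
  have h0 : (k : ℝ) ∈ Set.Ici (0 : ℝ) := by simp
  have h2 : (k : ℝ) + 2 ∈ Set.Ici (0 : ℝ) := by simp; positivity
  have hc := hconc.2 h0 h2 (by norm_num : (0 : ℝ) ≤ 1 / 2) (by norm_num : (0 : ℝ) ≤ 1 / 2)
    (by norm_num)
  simp only [smul_eq_mul] at hc
  rw [cbrt_of_nonneg (by positivity), cbrt_of_nonneg (by positivity), cbrt_of_nonneg (by positivity)]
  have e : 1 / 2 * (k : ℝ) + 1 / 2 * (k + 2) = k + 1 := by ring
  rw [e] at hc
  linarith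

lemma abs_rho6_succ (k : ℕ) : |rho6 ((k : ℤ) + 1)| =
    ((cbrt (k + 1) - cbrt k) - (cbrt (k + 2) - cbrt (k + 1))) / 2 := by
  have h := two_mul_cbrt_ge k
  have hp : ∀ x : ℝ, 0 ≤ x → |cbrt x| = cbrt x := fun x hx => by
    rw [cbrt_of_nonneg hx, abs_of_nonneg (by positivity)]
  rw [rho6_eq]
  push_cast
  have e1 : (k : ℝ) + 1 + 1 = k + 2 := by ring
  have e2 : (k : ℝ) + 1 - 1 = k := by ring
  rw [e1, e2, hp _ (by positivity), hp _ (by positivity), hp _ (by positivity), abs_of_nonpos (by linarith)]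
  ring

lemma summable_abs_rho6 : Summable fun k : ℤ => |rho6 k| := by
  have h : Summable fun k : ℕ => |rho6 k| := by
    rw [← summable_nat_add_iff 1]
    refine summable_of_sum_range_le (c := 1 / 2) (fun _ => abs_nonneg _) fun n => ?_
    have e : ∀ k : ℕ, |rho6 ((k + 1 : ℕ) : ℤ)| =
        -((cbrt ((k + 1 : ℕ) + 1) - cbrt (k + 1 : ℕ)) / 2) - -((cbrt (k + 1) - cbrt k) / 2) := fun k => by
      push_cast
      rw [abs_rho6_succ]
      have e1 : (k : ℝ) + 1 + 1 = k + 2 := by ring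
      rw [e1]; ring
    simp only [e]
    rw [Finset.sum_range_sub (fun k : ℕ => -((cbrt (k + 1) - cbrt k) / 2))]
    have h1 := cbrt_mono (by linarith : (n : ℝ) ≤ n + 1)
    have h2 : cbrt 0 = 0 := by simp [cbrt]
    have h3 : cbrt 1 = 1 := by simp [cbrt]
    simp only [Nat.cast_zero, zero_add, h2, h3]
    linarith
  rw [summable_int_iff_summable_nat_and_neg]
  exact ⟨h, by simpa only [rho6_neg] using h⟩

/-- The total correlation of the increments. -/
def rhoSum : ℝ := ∑' k : ℤ, |rho6 k|

lemma abs_rho6_le (k : ℤ) : |rho6 k| ≤ rhoSum :=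
  summable_abs_rho6.le_tsum k fun _ _ => abs_nonneg _

lemma sum_abs_rho6_le (i N : ℕ) : ∑ j ∈ Finset.range N, |rho6 ((i : ℤ) - j)| ≤ rhoSum := by
  have hinj : Set.InjOn (fun j : ℕ => (i : ℤ) - j) (Finset.range N) := fun a _ b _ h => by
    simpa using h
  rw [← Finset.sum_image (f := fun k : ℤ => |rho6 k|) hinj]
  exact summable_abs_rho6.sum_le_tsum _ fun _ _ => abs_nonneg _

lemma rhoSum_nonneg : 0 ≤ rhoSum := tsum_nonneg fun _ => abs_nonneg _

lemma cbrt_mul_of_nonneg {δ : ℝ} (hδ : 0 ≤ δ) (x : ℝ) : cbrt (x * δ) = cbrt x * δ ^ (1 / 3 : ℝ) := by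
  have h1 : cbrt (x * δ) ^ 3 = (cbrt x * δ ^ (1 / 3 : ℝ)) ^ 3 := by
    rw [cbrt_pow, mul_pow, cbrt_pow, rpow_third_pow hδ]
  exact (Odd.strictMono_pow (by decide : Odd 3)).injective h1

/-- Correlation of the increments on a regular grid. -/
lemma cov6_grid {δ : ℝ} (hδ : 0 ≤ δ) (i j : ℕ) :
    (cov6 ((i + 1 : ℕ) * δ) ((j + 1 : ℕ) * δ) - cov6 (i * δ) ((j + 1 : ℕ) * δ)) -
      (cov6 ((i + 1 : ℕ) * δ) (j * δ) - cov6 (i * δ) (j * δ)) =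
      δ ^ (1 / 3 : ℝ) * rho6 ((i : ℤ) - j) := by
  simp only [cov6_eq, rho6_eq]
  push_cast
  have e1 : ((i : ℝ) + 1) * δ - (j + 1) * δ = (i - j) * δ := by ring
  have e2 : (i : ℝ) * δ - (j + 1) * δ = (i - j - 1) * δ := by ring
  have e3 : ((i : ℝ) + 1) * δ - j * δ = (i - j + 1) * δ := by ring
  have e4 : (i : ℝ) * δ - j * δ = (i - j) * δ := by ring
  rw [e1, e2, e3, e4]
  simp only [cbrt_mul_of_nonneg hδ, abs_mul, abs_of_nonneg (Real.rpow_nonneg hδ _)]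
  ring

lemma sum_block_eq (r : ℤ → ℝ) (a b a' b' : ℕ) :
    ∑ i ∈ Finset.Ico a b, ∑ j ∈ Finset.Ico a' b', r ((i : ℤ) - j) =
      ∑' k : ℤ, ((min (b : ℤ) (b' + k) - max (a : ℤ) (a' + k)).toNat : ℝ) * r k := by
  have h1 : ∀ i : ℤ, ∑ j ∈ Finset.Ico (a' : ℤ) b', r (i - j) =
      ∑' k : ℤ, (if k ∈ Finset.Ioc (i - b') (i - a') then r k else 0) := by
    intro i
    have hs : ∑' k : ℤ, (if k ∈ Finset.Ioc (i - b') (i - a') then r k else 0) =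
        ∑ k ∈ Finset.Ioc (i - b') (i - a'), r k := by
      rw [tsum_eq_sum (s := Finset.Ioc (i - (b' : ℤ)) (i - a')) fun k hk => by rw [if_neg hk]]
      exact Finset.sum_congr rfl fun k hk => by rw [if_pos hk]
    rw [hs]
    refine Finset.sum_bij' (fun j _ => i - j) (fun k _ => i - k) ?_ ?_ ?_ ?_ ?_ <;>
      intros <;> simp_all <;> omega
  have hsum : ∀ i : ℤ, Summable fun k : ℤ => (if k ∈ Finset.Ioc (i - b') (i - a') then r k else 0) :=
    fun i => summable_of_hasFiniteSupport ((Finset.finite_toSet (Finset.Ioc (i - (b' : ℤ)) (i - a'))).subset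
      fun k hk => by by_contra h; exact hk (if_neg h))
  have e1 : ∑ i ∈ Finset.Ico a b, ∑ j ∈ Finset.Ico a' b', r ((i : ℤ) - j) =
      ∑ i ∈ Finset.Ico (a : ℤ) b, ∑ j ∈ Finset.Ico (a' : ℤ) b', r (i - j) := by
    have hI : ∀ (c d : ℕ) (g : ℤ → ℝ), ∑ i ∈ Finset.Ico (c : ℤ) d, g i = ∑ i ∈ Finset.Ico c d, g i := by
      intro c d g
      refine Finset.sum_nbij' Int.toNat (fun i => (i : ℤ)) ?_ ?_ ?_ ?_ ?_ <;> intro i hi <;>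
        simp only [Finset.mem_Ico] at hi ⊢ <;> first | omega | skip
      congr 1
      omega
    simp only [hI]
  rw [e1, Finset.sum_congr rfl fun i _ => h1 i, ← Summable.tsum_finsetSum fun i _ => hsum i]
  congr 1
  ext k
  rw [← Finset.sum_filter, Finset.sum_const, nsmul_eq_mul]
  congr 2
  rw [← Int.card_Ico]
  congr 1
  ext i
  simp
  omega

lemma tendsto_block {r : ℤ → ℝ} (hr : Summable fun k => |r k|) {δ : ℕ → ℝ} (hδ : ∀ n, 0 < δ n)
    (hδ0 : Tendsto δ atTop (𝓝 0)) {a b a' b' : ℕ → ℕ} {α β α' β' : ℝ}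
    (ha : Tendsto (fun n => a n * δ n) atTop (𝓝 α)) (hb : Tendsto (fun n => b n * δ n) atTop (𝓝 β))
    (ha' : Tendsto (fun n => a' n * δ n) atTop (𝓝 α'))
    (hb' : Tendsto (fun n => b' n * δ n) atTop (𝓝 β')) :
    Tendsto (fun n => δ n * ∑ i ∈ Finset.Ico (a n) (b n), ∑ j ∈ Finset.Ico (a' n) (b' n), r ((i : ℤ) - j))
      atTop (𝓝 (max (min β β' - max α α') 0 * ∑' k, r k)) := by
  simp only [sum_block_eq r]
  simp only [← tsum_mul_left]
  have key : ∀ n k, δ n * (((min (b n : ℤ) (b' n + k) - max (a n : ℤ) (a' n + k)).toNat : ℝ) * r k) =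
      max (min (b n * δ n) (b' n * δ n + k * δ n) - max (a n * δ n) (a' n * δ n + k * δ n)) 0 * r k := by
    intro n k
    have h0 := (hδ n).le
    have : ((min (b n : ℤ) (b' n + k) - max (a n : ℤ) (a' n + k)).toNat : ℝ) =
        max (min (b n : ℝ) (b' n + k) - max (a n : ℝ) (a' n + k)) 0 := by
      rw [← Int.cast_natCast, Int.ofNat_toNat]
      push_cast
      rfl
    rw [this, ← mul_assoc, mul_max_of_nonneg _ _ h0, mul_sub, mul_min_of_nonneg _ _ h0,
      mul_max_of_nonneg _ _ h0, mul_zero]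
    ring_nf
  simp only [key]
  obtain ⟨B, hB⟩ := hb.bddAbove_range
  have hB' : ∀ n, b n * δ n ≤ B := fun n => hB ⟨n, rfl⟩
  have hB0 : 0 ≤ B := (by have := (hδ 0).le; positivity : (0 : ℝ) ≤ b 0 * δ 0).trans (hB' 0)
  refine tendsto_tsum_of_dominated_convergence (bound := fun k => B * |r k|) (hr.mul_left B) ?_ ?_
  · intro k
    have hk : Tendsto (fun n => (k : ℝ) * δ n) atTop (𝓝 0) := by simpa using hδ0.const_mul (k : ℝ)
    have := (((hb.min (hb'.add hk)).sub (ha.max (ha'.add hk))).max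
      (tendsto_const_nhds (x := (0 : ℝ)))).mul_const (r k)
    simpa using this
  · refine Eventually.of_forall fun n k => ?_
    rw [norm_mul, Real.norm_eq_abs, Real.norm_eq_abs, abs_of_nonneg (le_max_right _ _)]
    gcongr
    refine max_le ?_ hB0
    have h1 : 0 ≤ a n * δ n := by have := (hδ n).le; positivity
    have h2 := min_le_left (b n * δ n) (b' n * δ n + k * δ n)
    have h3 := le_max_left (a n * δ n) (a' n * δ n + k * δ n)
    linarith [hB' n]

/-- The mesh of the `n`-th dyadic grid. -/
def mesh (n : ℕ) : ℝ := (2 : ℝ) ^ (-(n : ℝ) / 2)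

lemma mesh_pos (n : ℕ) : 0 < mesh n := Real.rpow_pos_of_pos (by norm_num) _

lemma dyadicPt_eq (n j : ℕ) : dyadicPt n j = j * mesh n := rfl

lemma tendsto_two_rpow : Tendsto (fun n : ℕ => (2 : ℝ) ^ ((n : ℝ) / 2)) atTop atTop := by
  have h : Tendsto (fun n : ℕ => (n : ℝ) / 2) atTop atTop :=
    tendsto_natCast_atTop_atTop.atTop_div_const (by norm_num)
  exact (tendsto_rpow_atTop_of_base_gt_one 2 (by norm_num)).comp h

lemma mesh_eq (n : ℕ) : mesh n = ((2 : ℝ) ^ ((n : ℝ) / 2))⁻¹ := by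
  rw [mesh, neg_div, Real.rpow_neg (by norm_num)]

lemma tendsto_mesh : Tendsto mesh atTop (𝓝 0) := by
  simp only [funext mesh_eq]
  exact tendsto_two_rpow.inv_tendsto_atTop

lemma nSteps_mul_mesh_le (n : ℕ) {T : ℝ} (hT : 0 ≤ T) : nSteps n T * mesh n ≤ T := by
  have h : (0 : ℝ) < 2 ^ ((n : ℝ) / 2) := Real.rpow_pos_of_pos (by norm_num) _
  rw [mesh_eq, ← div_eq_mul_inv, div_le_iff₀ h, mul_comm T]
  exact Nat.floor_le (by positivity)

lemma tendsto_nSteps {T : ℝ} (hT : 0 ≤ T) :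
    Tendsto (fun n => nSteps n T * mesh n) atTop (𝓝 T) := by
  have := (tendsto_nat_floor_mul_div_atTop hT).comp tendsto_two_rpow
  refine this.congr fun n => ?_
  simp only [Function.comp, mesh_eq, nSteps, div_eq_mul_inv]
  rw [mul_comm T]

lemma nSteps_mono (n : ℕ) : Monotone (nSteps n) := fun a b h => by
  unfold nSteps; gcongr

lemma nSteps_zero (n : ℕ) : nSteps n 0 = 0 := by simp [nSteps]

lemma sub_nSteps_mul_mesh_le (n : ℕ) (T : ℝ) : T - nSteps n T * mesh n ≤ mesh n := by
  have h : (0 : ℝ) < 2 ^ ((n : ℝ) / 2) := Real.rpow_pos_of_pos (by norm_num) _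
  have h1 := (Nat.lt_floor_add_one ((2 : ℝ) ^ ((n : ℝ) / 2) * T)).le
  have h2 : T ≤ (nSteps n T + 1) * mesh n := by
    rw [mesh_eq, ← div_eq_mul_inv, le_div_iff₀ h, mul_comm T]
    exact h1
  linarith

lemma abs_taylor_chain_le {M : ℝ} (n : ℕ) : ∀ {F : ℕ → ℝ → ℝ}
    (_ : ∀ k x, HasDerivAt (F k) (F (k + 1) x) x) (_ : ∀ x, |F n x| ≤ M) (x : ℝ),
    |F 0 x - ∑ k ∈ Finset.range n, F k 0 * x ^ k / k.factorial| ≤ M * |x| ^ n := by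
  induction n with
  | zero => intro F _ h x; simpa using h x
  | succ n ih =>
    intro F hF hM x
    set G : ℝ → ℝ := fun x => F 0 x - ∑ k ∈ Finset.range (n + 1), F k 0 * x ^ k / k.factorial with hG
    have hd : ∀ x, HasDerivAt G
        (F 1 x - ∑ k ∈ Finset.range n, F (k + 1) 0 * x ^ k / k.factorial) x := by
      intro x
      refine (hF 0 x).sub ?_
      have h1 : ∀ k ∈ Finset.range (n + 1), HasDerivAt (fun x : ℝ => F k 0 * x ^ k / k.factorial)
          (F k 0 * (k * x ^ (k - 1)) / k.factorial) x := fun k _ =>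
        ((hasDerivAt_pow k x).const_mul _).div_const _
      refine (HasDerivAt.fun_sum h1).congr_deriv ?_
      rw [Finset.sum_range_succ']
      simp only [Nat.cast_zero, zero_mul, mul_zero, zero_div, add_zero, Nat.add_sub_cancel]
      refine Finset.sum_congr rfl fun k _ => ?_
      rw [Nat.factorial_succ]
      push_cast
      have : (k.factorial : ℝ) ≠ 0 := by positivity
      field_simp
    have hG0 : G 0 = 0 := by
      simp only [hG, Finset.sum_range_succ', Nat.factorial_zero, pow_zero]
      simp
    have hM0 : 0 ≤ M := (abs_nonneg _).trans (hM 0)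
    have hb : ∀ y ∈ Set.uIcc 0 x,
        ‖F 1 y - ∑ k ∈ Finset.range n, F (k + 1) 0 * y ^ k / k.factorial‖ ≤ M * |x| ^ n := by
      intro y hy
      refine (ih (F := fun k => F (k + 1)) (fun k x => hF (k + 1) x) hM y).trans ?_
      have : |y| ≤ |x| := by simpa using Set.abs_sub_left_of_mem_uIcc hy
      gcongr
    have := (convex_uIcc (0 : ℝ) x).norm_image_sub_le_of_norm_hasDerivWithin_le
      (fun y _ => (hd y).hasDerivWithinAt) hb Set.left_mem_uIcc Set.right_mem_uIcc
    rw [hG0, sub_zero, sub_zero, Real.norm_eq_abs, Real.norm_eq_abs] at this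
    rw [pow_succ, ← mul_assoc]
    exact this

section Directional

variable {V : Type*} [NormedAddCommGroup V] [NormedSpace ℝ V] {g : V → ℝ}

lemma cb_iterate_dv (hg : Cb g) (c : V) (k : ℕ) : Cb ((dv c)^[k] g) := by
  induction k with
  | zero => exact hg
  | succ k ih => rw [iterate_succ_apply']; exact ih.dv c

lemma bddDer_iterate_dv {M : ℝ} (c : V) (k : ℕ) : ∀ {n : ℕ}, BddDer (n + k) M g →
    BddDer n (M * ‖c‖ ^ k) ((dv c)^[k] g) := by
  induction k with
  | zero => intro n h; simpa using h
  | succ k ih =>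
    intro n h
    rw [iterate_succ_apply', pow_succ, ← mul_assoc]
    refine (ih (n := n + 1) ?_).dv c
    rwa [add_assoc, add_comm 1 k]

lemma hasDerivAt_line (hg : Cb g) (m h : V) (x : ℝ) :
    HasDerivAt (fun x : ℝ => g (m + x • h)) (dv h g (m + x • h)) x := by
  have h1 : HasDerivAt (fun x : ℝ => m + x • h) h x := by
    simpa using ((hasDerivAt_id x).smul_const h).const_add m
  exact ((differentiable_of_temperate hg.temperate (m + x • h)).hasFDerivAt).comp_hasDerivAt x h1

lemma exists_midpoint_taylor (hg : Cb g) (n : ℕ) : ∃ K, 0 ≤ K ∧ ∀ m h : V,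
    |g (m + (1 / 2 : ℝ) • h) - g (m - (1 / 2 : ℝ) • h) -
      ∑ k ∈ Finset.range n, (dv h)^[k] g m * ((1 / 2) ^ k - (-1 / 2) ^ k) / k.factorial| ≤ K * ‖h‖ ^ n := by
  obtain ⟨M, h0, hM⟩ := hg.bddDer n
  refine ⟨2 * M, by positivity, fun m h => ?_⟩
  have key := abs_taylor_chain_le (M := M * ‖h‖ ^ n) n (F := fun k x => (dv h)^[k] g (m + x • h))
    (fun k x => by
      have := hasDerivAt_line (cb_iterate_dv hg h k) m h x
      rwa [← iterate_succ_apply' (dv h)] at this)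
    (fun x => (bddDer_iterate_dv h n (n := 0) (by simpa using hM)).abs_le _)
  have e1 := key (1 / 2)
  have e2 := key (-1 / 2)
  simp only [iterate_zero, id, zero_smul, add_zero] at e1 e2
  have e3 : m + (-1 / 2 : ℝ) • h = m - (1 / 2 : ℝ) • h := by rw [neg_div, neg_smul, sub_eq_add_neg]
  rw [e3] at e2
  have hle : ∀ y : ℝ, |y| = 1 / 2 → M * ‖h‖ ^ n * |y| ^ n ≤ M * ‖h‖ ^ n := by
    intro y hy
    rw [hy]
    exact mul_le_of_le_one_right (by positivity) (pow_le_one₀ (by norm_num) (by norm_num))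
  have e1' := e1.trans (hle _ (by norm_num [abs_of_pos]))
  have e2' := e2.trans (hle _ (by norm_num [abs_of_neg]))
  rw [abs_le] at *
  have hs : ∑ k ∈ Finset.range n, (dv h)^[k] g m * ((1 / 2) ^ k - (-1 / 2) ^ k) / k.factorial =
      ∑ k ∈ Finset.range n, (dv h)^[k] g m * (1 / 2) ^ k / k.factorial -
      ∑ k ∈ Finset.range n, (dv h)^[k] g m * (-1 / 2) ^ k / k.factorial := by
    rw [← Finset.sum_sub_distrib]
    exact Finset.sum_congr rfl fun k _ => by ring
  rw [hs]
  constructor <;> linarith [e1'.1, e1'.2, e2'.1, e2'.2]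

lemma dv_comm (hg : Cb g) (c d : V) : dv c (dv d g) = dv d (dv c g) := by
  ext z
  have h : ContDiffAt ℝ 2 g z := (hg.1.of_le (by norm_cast)).contDiffAt
  have hs := h.isSymmSndFDerivAt (by simp)
  have hd : DifferentiableAt ℝ (fderiv ℝ g) z :=
    (hg.1.fderiv_right (m := ∞) (by simp)).differentiable (by simp) z
  have hdv : ∀ a b : V, dv a (dv b g) z = fderiv ℝ (fderiv ℝ g) z a b := by
    intro a b
    have : HasFDerivAt (fun z => fderiv ℝ g z b)
      ((ContinuousLinearMap.apply ℝ ℝ b).comp (fderiv ℝ (fderiv ℝ g) z)) z :=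
      (ContinuousLinearMap.apply ℝ ℝ b).hasFDerivAt.comp z hd.hasFDerivAt
    change fderiv ℝ (fun z => fderiv ℝ g z b) z a = _
    rw [this.fderiv]
    rfl
  rw [hdv, hdv, hs.eq]

/-- The space of smooth functions that are bounded together with all their derivatives. -/
def CbSub (V : Type*) [NormedAddCommGroup V] [NormedSpace ℝ V] : Submodule ℝ (V → ℝ) where
  carrier := {g | Cb g}
  add_mem' := Cb.add
  zero_mem' := Cb.const 0
  smul_mem' c _ h := h.const_mul c

/-- Directional derivatives as endomorphisms of `CbSub V`. -/
def dvEnd (c : V) : Module.End ℝ (CbSub V) where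
  toFun g := ⟨dv c g.1, Cb.dv g.2 c⟩
  map_add' g h := by
    ext z
    have hg := differentiable_of_temperate (Cb.temperate g.2) z
    have hh := differentiable_of_temperate (Cb.temperate h.2) z
    change fderiv ℝ (fun z => g.1 z + h.1 z) z c = fderiv ℝ g.1 z c + fderiv ℝ h.1 z c
    rw [fderiv_fun_add hg hh]
    rfl
  map_smul' a g := by
    ext z
    have hg := differentiable_of_temperate (Cb.temperate g.2) z
    change fderiv ℝ (fun z => a * g.1 z) z c = a * fderiv ℝ g.1 z c
    rw [fderiv_const_mul hg]
    rfl

lemma dvEnd_pow_apply (c : V) (k : ℕ) (g : CbSub V) : ((dvEnd c ^ k) g).1 = (dv c)^[k] g.1 := by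
  induction k with
  | zero => rfl
  | succ k ih => rw [pow_succ', Module.End.mul_apply, iterate_succ_apply', ← ih]; rfl

lemma dvEnd_commute (c d : V) : Commute (dvEnd c) (dvEnd d) :=
  LinearMap.ext fun g => Subtype.ext (dv_comm g.2 c d)

lemma dvEnd_add_smul (a b : ℝ) (c d : V) : dvEnd (a • c + b • d) = a • dvEnd c + b • dvEnd d :=
  LinearMap.ext fun g => Subtype.ext (funext fun z => by
    change fderiv ℝ g.1 z (a • c + b • d) = a * fderiv ℝ g.1 z c + b * fderiv ℝ g.1 z d
    simp)

end Directional

/-- Mixed partial derivatives of functions of two real variables. -/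
def pdv (a b : ℕ) (g : ℝ × ℝ → ℝ) : ℝ × ℝ → ℝ := (dv (1, 0))^[a] ((dv (0, 1))^[b] g)

lemma cb_pdv {g : ℝ × ℝ → ℝ} (hg : Cb g) (a b : ℕ) : Cb (pdv a b g) :=
  cb_iterate_dv (cb_iterate_dv hg _ b) _ a

lemma iterate_dv_eq {g : ℝ × ℝ → ℝ} (hg : Cb g) (h : ℝ × ℝ) (k : ℕ) (z : ℝ × ℝ) :
    (dv h)^[k] g z =
      ∑ i ∈ Finset.range (k + 1), h.1 ^ i * h.2 ^ (k - i) * pdv i (k - i) g z * k.choose i := by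
  have e : h = h.1 • ((1 : ℝ), (0 : ℝ)) + h.2 • ((0 : ℝ), (1 : ℝ)) := by ext <;> simp
  have h1 := dvEnd_pow_apply h k ⟨g, hg⟩
  rw [e, dvEnd_add_smul, Commute.add_pow (((dvEnd_commute _ _).smul_left _).smul_right _), ← e] at h1
  rw [← h1]
  simp only [smul_pow, LinearMap.sum_apply, AddSubmonoidClass.coe_finsetSum, Finset.sum_apply]
  refine Finset.sum_congr rfl fun i _ => ?_
  have h2 : ((dvEnd ((1 : ℝ), (0 : ℝ)) ^ i) ((dvEnd ((0 : ℝ), (1 : ℝ)) ^ (k - i)) ⟨g, hg⟩)).1 =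
      pdv i (k - i) g := by
    rw [dvEnd_pow_apply, dvEnd_pow_apply]; rfl
  rw [← h2]
  simp only [Module.End.mul_apply, LinearMap.smul_apply, Module.End.natCast_apply, map_nsmul, map_smul,
    smul_smul]
  simp [mul_comm, mul_left_comm, mul_assoc]

section

/-- The directions used to polarize cubic and quintic forms in two variables. -/
def dir : Fin 6 → ℝ × ℝ := ![(1, 0), (0, 1), (1, 1), (1, -1), (1, 2), (1, -2)]

/-- The Euclidean product on `ℝ × ℝ`. -/
def dot (u h : ℝ × ℝ) : ℝ := u.1 * h.1 + u.2 * h.2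

/-- Weights of the cubic form `D³g` along the directions `dir`. -/
def wtThree (g : ℝ × ℝ → ℝ) : Fin 6 → ℝ × ℝ → ℝ :=
  ![fun z => pdv 3 0 g z - pdv 1 2 g z, fun z => pdv 0 3 g z - pdv 2 1 g z,
    fun z => (1 / 2) * (pdv 1 2 g z + pdv 2 1 g z), fun z => (1 / 2) * (pdv 1 2 g z - pdv 2 1 g z),
    fun _ => 0, fun _ => 0]

/-- Weights of the quintic form `D⁵g` along the directions `dir`. -/
def wtFive (g : ℝ × ℝ → ℝ) : Fin 6 → ℝ × ℝ → ℝ :=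
  ![fun z => pdv 5 0 g z - (5 / 4) * pdv 3 2 g z + (1 / 4) * pdv 1 4 g z,
    fun z => pdv 0 5 g z + 4 * pdv 4 1 g z - 5 * pdv 2 3 g z,
    fun z => (2 / 3) * pdv 3 2 g z - (1 / 6) * pdv 1 4 g z + (2 / 3) * pdv 4 1 g z - (1 / 6) * pdv 2 3 g z,
    fun z => (2 / 3) * pdv 3 2 g z - (1 / 6) * pdv 1 4 g z - (2 / 3) * pdv 4 1 g z + (1 / 6) * pdv 2 3 g z,
    fun z => (1 / 24) * pdv 1 4 g z - (1 / 24) * pdv 3 2 g z + (1 / 12) * pdv 2 3 g z - (1 / 12) * pdv 4 1 g z,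
    fun z => (1 / 24) * pdv 1 4 g z - (1 / 24) * pdv 3 2 g z - (1 / 12) * pdv 2 3 g z + (1 / 12) * pdv 4 1 g z]

/-- The Laplacian of a function of two variables. -/
def lap (g : ℝ × ℝ → ℝ) (z : ℝ × ℝ) : ℝ := pdv 2 0 g z + pdv 0 2 g z

variable {g : ℝ × ℝ → ℝ}

lemma cb_wtThree (hg : Cb g) (i : Fin 6) : Cb (wtThree g i) := by
  have h := cb_pdv hg
  fin_cases i
  · exact (h 3 0).sub (h 1 2)
  · exact (h 0 3).sub (h 2 1)
  · exact ((h 1 2).add (h 2 1)).const_mul _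
  · exact ((h 1 2).sub (h 2 1)).const_mul _
  · exact Cb.const 0
  · exact Cb.const 0

lemma cb_wtFive (hg : Cb g) (i : Fin 6) : Cb (wtFive g i) := by
  have h := cb_pdv hg
  fin_cases i
  · exact ((h 5 0).sub ((h 3 2).const_mul _)).add ((h 1 4).const_mul _)
  · exact ((h 0 5).add ((h 4 1).const_mul _)).sub ((h 2 3).const_mul _)
  · exact ((((h 3 2).const_mul _).sub ((h 1 4).const_mul _)).add ((h 4 1).const_mul _)).sub
      ((h 2 3).const_mul _)
  · exact ((((h 3 2).const_mul _).sub ((h 1 4).const_mul _)).sub ((h 4 1).const_mul _)).add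
      ((h 2 3).const_mul _)
  · exact ((((h 1 4).const_mul _).sub ((h 3 2).const_mul _)).add ((h 2 3).const_mul _)).sub
      ((h 4 1).const_mul _)
  · exact ((((h 1 4).const_mul _).sub ((h 3 2).const_mul _)).sub ((h 2 3).const_mul _)).add
      ((h 4 1).const_mul _)

lemma cb_lap (hg : Cb g) : Cb (lap g) := (cb_pdv hg 2 0).add (cb_pdv hg 0 2)

lemma iterate_three_eq (hg : Cb g) (h z : ℝ × ℝ) :
    (dv h)^[3] g z = ∑ u, wtThree g u z * dot (dir u) h ^ 3 := by
  rw [iterate_dv_eq hg]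
  simp [Finset.sum_range_succ, Fin.sum_univ_six, wtThree, dir, dot, Nat.choose]
  ring

lemma iterate_five_eq (hg : Cb g) (h z : ℝ × ℝ) :
    (dv h)^[5] g z = ∑ u, wtFive g u z * dot (dir u) h ^ 5 := by
  rw [iterate_dv_eq hg]
  simp [Finset.sum_range_succ, Fin.sum_univ_six, wtFive, dir, dot, Nat.choose]
  ring

lemma dv_pdv_add (hg : Cb g) (a b a' b' : ℕ) (c z : ℝ × ℝ) :
    dv c (fun z => pdv a b g z + pdv a' b' g z) z = dv c (pdv a b g) z + dv c (pdv a' b' g) z := by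
  unfold dv
  rw [fderiv_fun_add (differentiable_of_temperate (cb_pdv hg a b).temperate z)
    (differentiable_of_temperate (cb_pdv hg a' b').temperate z)]
  rfl

lemma dv_pair (g : ℝ × ℝ → ℝ) (h z : ℝ × ℝ) : dv h g z = h.1 * dv (1, 0) g z + h.2 * dv (0, 1) g z := by
  have e : h = h.1 • ((1 : ℝ), (0 : ℝ)) + h.2 • ((0 : ℝ), (1 : ℝ)) := by ext <;> simp
  have := (fderiv ℝ g z).map_add (h.1 • ((1 : ℝ), (0 : ℝ))) (h.2 • ((0 : ℝ), (1 : ℝ)))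
  rw [← e, map_smul, map_smul] at this
  exact this

lemma dv_pdv_right (hg : Cb g) (a b : ℕ) : dv (0, 1) (pdv a b g) = pdv a (b + 1) g := by
  induction a with
  | zero => exact (iterate_succ_apply' (dv (0, 1)) b g).symm
  | succ a ih =>
    have e : ∀ c, pdv (a + 1) c g = dv (1, 0) (pdv a c g) := fun c => iterate_succ_apply' _ _ _
    rw [e, e, dv_comm (cb_pdv hg a b), ih]

lemma dv_pdv_left (a b : ℕ) : dv (1, 0) (pdv a b g) = pdv (a + 1) b g :=
  (iterate_succ_apply' _ _ _).symm

lemma dv_lap (hg : Cb g) (h z : ℝ × ℝ) :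
    dv h (lap g) z = ∑ u, wtThree g u z * dot (dir u) (dir u) * dot (dir u) h := by
  have e : dv h (lap g) z = dv h (pdv 2 0 g) z + dv h (pdv 0 2 g) z := dv_pdv_add hg 2 0 0 2 h z
  rw [e, dv_pair (pdv 2 0 g), dv_pair (pdv 0 2 g), dv_pdv_left, dv_pdv_left, dv_pdv_right hg, dv_pdv_right hg]
  simp [Fin.sum_univ_six, wtThree, dir, dot]
  ring

lemma sum_wtThree_sq (g : ℝ × ℝ → ℝ) (z : ℝ × ℝ) :
    ∑ u, ∑ u', wtThree g u z * wtThree g u' z * dot (dir u) (dir u') ^ 3 =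
      pdv 3 0 g z ^ 2 + pdv 0 3 g z ^ 2 + 3 * pdv 1 2 g z ^ 2 + 3 * pdv 2 1 g z ^ 2 := by
  simp [Fin.sum_univ_six, wtThree, dir, dot]
  ring

lemma exists_taylor_five (hg : Cb g) : ∃ K, 0 ≤ K ∧ ∀ m h : ℝ × ℝ,
    |g (m + (1 / 2 : ℝ) • h) - g (m - (1 / 2 : ℝ) • h) - dv h g m
      - (1 / 24) * ∑ u, wtThree g u m * dot (dir u) h ^ 3| ≤ K * ‖h‖ ^ 5 := by
  obtain ⟨K, h0, hK⟩ := exists_midpoint_taylor hg 5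
  refine ⟨K, h0, fun m h => ?_⟩
  convert hK m h using 2
  rw [← iterate_three_eq hg]
  simp [Finset.sum_range_succ, Nat.factorial]
  ring

lemma exists_taylor_seven (hg : Cb g) : ∃ K, 0 ≤ K ∧ ∀ m h : ℝ × ℝ,
    |g (m + (1 / 2 : ℝ) • h) - g (m - (1 / 2 : ℝ) • h) - dv h g m
      - (1 / 24) * ∑ u, wtThree g u m * dot (dir u) h ^ 3
      - (1 / 1920) * ∑ u, wtFive g u m * dot (dir u) h ^ 5| ≤ K * ‖h‖ ^ 7 := by
  obtain ⟨K, h0, hK⟩ := exists_midpoint_taylor hg 7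
  refine ⟨K, h0, fun m h => ?_⟩
  convert hK m h using 2
  rw [← iterate_three_eq hg, ← iterate_five_eq hg]
  simp [Finset.sum_range_succ, Nat.factorial]
  ring

lemma contDiff_pdv_line (hg : Cb g) (k l : ℕ) (x y : ℝ) :
    iteratedDeriv l (fun v => g (x, v)) y = pdv 0 l g (x, y) ∧
    iteratedDeriv k (fun u => pdv 0 l g (u, y)) x = pdv k l g (x, y) := by
  constructor
  · revert y
    induction l with
    | zero => intro y; simp [pdv]
    | succ l ih =>
      intro y
      rw [iteratedDeriv_succ, show iteratedDeriv l (fun v => g (x, v)) = fun y => pdv 0 l g (x, y) from funext ih]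
      have h1 : HasDerivAt (fun y : ℝ => (x, y)) ((0 : ℝ), (1 : ℝ)) y :=
        (hasDerivAt_const y x).prodMk (hasDerivAt_id y)
      have h2 := ((differentiable_of_temperate (cb_pdv hg 0 l).temperate (x, y)).hasFDerivAt).comp_hasDerivAt y h1
      rw [← dv_pdv_right hg]
      exact h2.deriv
  · revert x
    induction k with
    | zero => intro x; simp
    | succ k ih =>
      intro x
      rw [iteratedDeriv_succ, show iteratedDeriv k (fun u => pdv 0 l g (u, y)) = fun x => pdv k l g (x, y) from funext ih]
      have h1 : HasDerivAt (fun x : ℝ => (x, y)) ((1 : ℝ), (0 : ℝ)) x :=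
        (hasDerivAt_id x).prodMk (hasDerivAt_const x y)
      have h2 := ((differentiable_of_temperate (cb_pdv hg k l).temperate (x, y)).hasFDerivAt).comp_hasDerivAt x h1
      rw [← dv_pdv_left]
      exact h2.deriv

lemma pd_eq_pdv {f : ℝ → ℝ → ℝ} (hf : CbSmooth2 f) (k l : ℕ) (x y : ℝ) :
    pd k l f x y = pdv k l (fun p => f p.1 p.2) (x, y) := by
  have hg : Cb (fun p : ℝ × ℝ => f p.1 p.2) := CbSmooth.cb hf
  rw [← (contDiff_pdv_line hg k l x y).2]
  unfold pd
  congr 1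
  funext u
  exact (contDiff_pdv_line hg k l u y).1

end

section

/-- The function `F` is integrable with `L¹` norm at most `a`. -/
structure LeOne {A : Type*} [MeasurableSpace A] (μ : Measure A) (F : A → ℝ) (a : ℝ) : Prop where
  int : Integrable F μ
  le : ∫ z, |F z| ∂μ ≤ a

namespace LeOne
variable {A : Type*} [MeasurableSpace A] {μ : Measure A} {F G : A → ℝ} {a b : ℝ}

lemma mono (h : LeOne μ F a) (hab : a ≤ b) : LeOne μ F b := ⟨h.int, h.le.trans hab⟩

lemma add (h : LeOne μ F a) (h' : LeOne μ G b) : LeOne μ (fun z => F z + G z) (a + b) := by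
  refine ⟨h.int.add h'.int, ?_⟩
  calc ∫ z, |F z + G z| ∂μ ≤ ∫ z, (|F z| + |G z|) ∂μ :=
        integral_mono (h.int.add h'.int).abs (h.int.abs.add h'.int.abs) fun z => abs_add_le _ _
    _ = ∫ z, |F z| ∂μ + ∫ z, |G z| ∂μ := integral_add h.int.abs h'.int.abs
    _ ≤ a + b := add_le_add h.le h'.le

lemma const_mul (h : LeOne μ F a) (c : ℝ) : LeOne μ (fun z => c * F z) (|c| * a) := by
  refine ⟨h.int.const_mul c, ?_⟩
  simp only [abs_mul, integral_const_mul]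
  gcongr
  exact h.le

lemma sum {ι : Type*} (s : Finset ι) {F : ι → A → ℝ} {a : ι → ℝ} (h : ∀ i ∈ s, LeOne μ (F i) (a i)) :
    LeOne μ (fun z => ∑ i ∈ s, F i z) (∑ i ∈ s, a i) := by
  classical
  induction s using Finset.induction_on with
  | empty => exact ⟨by simp, by simp⟩
  | insert i s hi ih =>
    simp only [Finset.sum_insert hi]
    exact (h i (by simp)).add (ih fun j hj => h j (by simp [hj]))

lemma of_abs_le (h : LeOne μ G a) (hF : AEStronglyMeasurable F μ) (hFG : ∀ z, |F z| ≤ G z) :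
    LeOne μ F a := by
  have hi : Integrable F μ := h.int.mono' hF (Eventually.of_forall hFG)
  exact ⟨hi, (integral_mono hi.abs h.int.abs fun z => (hFG z).trans (le_abs_self _)).trans h.le⟩

lemma of_sq [IsProbabilityMeasure μ] (hF : AEStronglyMeasurable F μ) (hi : Integrable (fun z => F z ^ 2) μ)
    (ha : 0 ≤ a) (h : ∫ z, F z ^ 2 ∂μ ≤ a ^ 2) : LeOne μ F a := by
  have hm : MemLp F 2 μ := (memLp_two_iff_integrable_sq hF).2 hi
  have hI : Integrable F μ := hm.integrable (by norm_num)
  refine ⟨hI, ?_⟩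
  have hv : 0 ≤ Var[|F|; μ] := variance_nonneg _ μ
  rw [variance_eq_sub hm.abs] at hv
  simp only [Pi.pow_apply, Pi.abs_apply, sq_abs] at hv
  exact (pow_le_pow_iff_left₀ (integral_nonneg fun _ => abs_nonneg _) ha two_ne_zero).1 (by linarith)

end LeOne

/-- The linear form `dot u`. -/
def dotL (u : ℝ × ℝ) : ℝ × ℝ →L[ℝ] ℝ :=
  u.1 • ContinuousLinearMap.fst ℝ ℝ ℝ + u.2 • ContinuousLinearMap.snd ℝ ℝ ℝ

lemma dotL_apply (u h : ℝ × ℝ) : dotL u h = dot u h := by simp [dotL, dot]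

section Path
variable {E : Type*} [NormedAddCommGroup E] [NormedSpace ℝ E]

/-- Increments of a discrete path. -/
def incr (b : ℕ → E →L[ℝ] ℝ × ℝ) (j : ℕ) : E →L[ℝ] ℝ × ℝ := b (j + 1) - b j

/-- Midpoints of a discrete path. -/
def mid (b : ℕ → E →L[ℝ] ℝ × ℝ) (j : ℕ) : E →L[ℝ] ℝ × ℝ := (1 / 2 : ℝ) • (b j + b (j + 1))

/-- Increments of a discrete path in the directions `dir`. -/
def xi (b : ℕ → E →L[ℝ] ℝ × ℝ) (i : Fin 6 × ℕ) : E →L[ℝ] ℝ := (dotL (dir i.1)).comp (incr b i.2)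

lemma xi_apply (b : ℕ → E →L[ℝ] ℝ × ℝ) (i : Fin 6 × ℕ) (z : E) :
    xi b i z = dot (dir i.1) (incr b i.2 z) := dotL_apply _ _

lemma mid_add (b : ℕ → E →L[ℝ] ℝ × ℝ) (j : ℕ) (z : E) :
    mid b j z + (1 / 2 : ℝ) • incr b j z = b (j + 1) z := by
  ext <;> simp [mid, incr] <;> ring

lemma mid_sub (b : ℕ → E →L[ℝ] ℝ × ℝ) (j : ℕ) (z : E) :
    mid b j z - (1 / 2 : ℝ) • incr b j z = b j z := by
  ext <;> simp [mid, incr] <;> ring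

lemma norm_incr_pow_le (b : ℕ → E →L[ℝ] ℝ × ℝ) (j p : ℕ) (z : E) :
    ‖incr b j z‖ ^ p ≤ |xi b (0, j) z| ^ p + |xi b (1, j) z| ^ p := by
  have h0 : xi b (0, j) z = (incr b j z).1 := by simp [xi_apply, dir, dot]
  have h1 : xi b (1, j) z = (incr b j z).2 := by simp [xi_apply, dir, dot]
  rw [h0, h1, Prod.norm_def, Real.norm_eq_abs, Real.norm_eq_abs]
  rcases le_total |(incr b j z).1| |(incr b j z).2| with h | h
  · rw [max_eq_right h]; exact le_add_of_nonneg_left (by positivity)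
  · rw [max_eq_left h]; exact le_add_of_nonneg_right (by positivity)

variable [MeasurableSpace E]

/-- A discrete Gaussian path in the plane with `N` weakly correlated steps of variance `v ≤ s ^ 2`. -/
structure Grid (μ : Measure E) (b : ℕ → E →L[ℝ] ℝ × ℝ) (N : ℕ) (v s C : ℝ) : Prop where
  gauss : CGauss μ
  weak : WeakCorr μ (Finset.univ ×ˢ Finset.range N) (xi b) (fun i => mid b i.2) (s ^ 2) C
  s_pos : 0 < s
  var : ∀ u, ∀ j < N, xi b (u, j) (cvec μ (xi b (u, j))) = dot (dir u) (dir u) * v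
  v_nonneg : 0 ≤ v
  v_le : v ≤ s ^ 2

namespace Grid
variable {μ : Measure E} {b : ℕ → E →L[ℝ] ℝ × ℝ} {N : ℕ} {v s C : ℝ}

lemma s_le_one (h : Grid μ b N v s C) : s ≤ 1 :=
  (sq_le_one_iff₀ h.s_pos.le).1 h.weak.le_one

lemma card_le (h : Grid μ b N v s C) : N * s ^ 6 ≤ C := by
  have := h.weak.card_le
  simp only [Finset.card_product, Finset.card_univ, Fintype.card_fin, Finset.card_range] at this
  push_cast at this
  have h0 : 0 ≤ (N : ℝ) * s ^ 6 := by have := h.s_pos; positivity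
  nlinarith

lemma xi_le (h : Grid μ b N v s C) (i : Fin 6 × ℕ) (hi : i.2 < N) :
    xi b i (cvec μ (xi b i)) ≤ s ^ 2 :=
  (le_abs_self _).trans (h.weak.corr_le i (by simpa using hi) i (by simpa using hi))

end Grid

/-- Weighted sums of Hermite polynomials of the increments. -/
def wsum (μ : Measure E) (b : ℕ → E →L[ℝ] ℝ × ℝ) (N : ℕ) (γ : ℝ × ℝ → ℝ) (u : Fin 6) (p : ℕ) (z : E) : ℝ :=
  ∑ j ∈ Finset.range N, γ (mid b j z) * gh μ p (xi b (u, j)) z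

lemma wsum_temperate {μ : Measure E} (b : ℕ → E →L[ℝ] ℝ × ℝ) (N : ℕ) {γ : ℝ × ℝ → ℝ} (hγ : Cb γ)
    (u : Fin 6) (p : ℕ) : (wsum μ b N γ u p).HasTemperateGrowth :=
  HasTemperateGrowth.sum fun j _ => (hγ.comp_clm (mid b j)).temperate.mul (gh_temperate p _)

end Path

/-- Absolute moments of the standard normal distribution. -/
def absMoment (p : ℕ) : ℝ := ∫ x, |x| ^ p ∂gaussianReal 0 1

lemma absMoment_nonneg (p : ℕ) : 0 ≤ absMoment p := integral_nonneg fun _ => by positivity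

lemma integral_abs_pow_gaussianReal (p : ℕ) {s : ℝ} (hs : 0 ≤ s) :
    ∫ x, |x| ^ p ∂gaussianReal 0 (Real.toNNReal (s ^ 2)) = s ^ p * absMoment p := by
  have h := gaussianReal_map_const_mul (μ := 0) (v := 1) s
  have e : NNReal.mk (s ^ 2) (sq_nonneg s) * 1 = Real.toNNReal (s ^ 2) := by
    rw [mul_one]; exact (Real.toNNReal_of_nonneg (sq_nonneg s)).symm
  rw [e, mul_zero] at h
  rw [← h, integral_map (by fun_prop) (by fun_prop), absMoment, ← integral_const_mul]
  simp only [abs_mul, mul_pow, abs_of_nonneg hs]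

end

section
variable {E : Type*} [NormedAddCommGroup E] [NormedSpace ℝ E] [MeasurableSpace E] [BorelSpace E]
  [FiniteDimensional ℝ E] {μ : Measure E}

lemma CGauss.map_eq (hμ : CGauss μ) (ξ : E →L[ℝ] ℝ) :
    μ.map ξ = gaussianReal 0 (ξ (cvec μ ξ)).toNNReal := by
  have := hμ.gauss
  have : CompleteSpace E := FiniteDimensional.complete ℝ E
  have hvar : Var[ξ; μ] = ξ (cvec μ ξ) := by
    rw [variance_eq_sub, hμ.centered ξ, apply_cvec hμ]
    · simp [pow_two]
    · exact IsGaussian.memLp_dual μ ξ 2 (by simp)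
  rw [IsGaussian.map_eq_gaussianReal ξ, hμ.centered ξ, hvar]

lemma CGauss.cvec_self_nonneg (hμ : CGauss μ) (ξ : E →L[ℝ] ℝ) : 0 ≤ ξ (cvec μ ξ) := by
  rw [apply_cvec hμ]
  exact integral_nonneg fun z => mul_self_nonneg _

lemma CGauss.leOne_abs_pow (hμ : CGauss μ) (ξ : E →L[ℝ] ℝ) (p : ℕ) {s : ℝ} (hs : 0 ≤ s)
    (h : ξ (cvec μ ξ) ≤ s ^ 2) : LeOne μ (fun z => |ξ z| ^ p) (s ^ p * absMoment p) := by
  have := hμ.gauss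
  have : CompleteSpace E := FiniteDimensional.complete ℝ E
  have h0 := hμ.cvec_self_nonneg ξ
  have hi : Integrable (fun x : ℝ => |x| ^ p) (μ.map ξ) := by
    rw [hμ.map_eq]
    have hm : MemLp (fun z : ℝ => z) (p : ℝ≥0∞) (gaussianReal 0 (ξ (cvec μ ξ)).toNNReal) :=
      memLp_id_gaussianReal' p (by simp)
    exact hm.integrable_norm_pow'
  refine ⟨(integrable_map_measure (g := fun x : ℝ => |x| ^ p) (by fun_prop) (by fun_prop)).1 hi, ?_⟩
  simp only [abs_pow, abs_abs]
  rw [← integral_map (φ := ξ) (f := fun x : ℝ => |x| ^ p) (by fun_prop) (by fun_prop), hμ.map_eq,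
    ← Real.sq_sqrt h0, integral_abs_pow_gaussianReal p (Real.sqrt_nonneg _)]
  have := absMoment_nonneg p
  gcongr
  exact Real.sqrt_le_iff.2 ⟨hs, h⟩

lemma herm_three (v x : ℝ) : x ^ 3 = herm v 3 x + 3 * v * x := by
  simp only [herm]; push_cast; ring

lemma herm_five (v x : ℝ) : x ^ 5 = herm v 5 x + 10 * v * herm v 3 x + 15 * v ^ 2 * x := by
  simp only [herm]; push_cast; ring

namespace Grid
variable {b : ℕ → E →L[ℝ] ℝ × ℝ} {N : ℕ} {v s C : ℝ}

lemma leOne_sum_norm_pow (h : Grid μ b N v s C) (p : ℕ) :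
    LeOne μ (fun z => ∑ j ∈ Finset.range N, ‖incr b j z‖ ^ p) (2 * C * absMoment p * s ^ p / s ^ 6) := by
  have h1 : ∀ j ∈ Finset.range N, LeOne μ (fun z => ‖incr b j z‖ ^ p)
      (s ^ p * absMoment p + s ^ p * absMoment p) := by
    intro j hj
    have hj' := Finset.mem_range.1 hj
    refine ((h.gauss.leOne_abs_pow (xi b (0, j)) p h.s_pos.le (h.xi_le _ hj')).add
      (h.gauss.leOne_abs_pow (xi b (1, j)) p h.s_pos.le (h.xi_le _ hj'))).of_abs_le (by fun_prop) ?_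
    intro z
    rw [abs_of_nonneg (by positivity)]
    exact norm_incr_pow_le b j _ z
  refine (LeOne.sum _ h1).mono ?_
  rw [Finset.sum_const, Finset.card_range, nsmul_eq_mul]
  have := h.card_le
  have := absMoment_nonneg p
  have := h.s_pos
  rw [le_div_iff₀ (by positivity)]
  calc (N : ℝ) * (s ^ p * absMoment p + s ^ p * absMoment p) * s ^ 6
      = 2 * (N * s ^ 6) * absMoment p * s ^ p := by ring
    _ ≤ _ := by gcongr

end Grid
end

lemma exists_wsum_bound {γ : ℝ × ℝ → ℝ} (hγ : Cb γ) {p : ℕ} (hp : p = 1 ∨ p = 3 ∨ p = 5) (C : ℝ) :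
    ∃ K : ℝ, 0 ≤ K ∧ ∀ {E : Type} [NormedAddCommGroup E] [NormedSpace ℝ E] [MeasurableSpace E]
      [BorelSpace E] [FiniteDimensional ℝ E] {μ : Measure E} {b : ℕ → E →L[ℝ] ℝ × ℝ} {N : ℕ} {v s : ℝ}
      (_ : Grid μ b N v s C) (u : Fin 6), LeOne μ (wsum μ b N γ u p) (K * s ^ p / s ^ 3) := by
  obtain ⟨K, h0, hK⟩ := exists_weighted_bound hγ hp C
  refine ⟨√K, Real.sqrt_nonneg _, fun {E} _ _ _ _ _ μ b N v s h u => ?_⟩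
  have hs := h.s_pos
  have := h.gauss.gauss.toIsProbabilityMeasure
  have hw := h.weak.mono (A := {u} ×ˢ Finset.range N)
    (Finset.product_subset_product_left (Finset.subset_univ _))
  have h1 := hK h.gauss hw
  simp only [Finset.sum_product, Finset.sum_singleton] at h1
  have ht := wsum_temperate (μ := μ) b N hγ u p
  have := h.gauss.gauss
  have e1 : (fun z => wsum μ b N γ u p z ^ 2) = fun z => wsum μ b N γ u p z * wsum μ b N γ u p z := by
    ext z; ring
  refine LeOne.of_sq ht.1.continuous.aestronglyMeasurable ?_ (by positivity) ?_
  · rw [e1]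
    exact integrable_of_temperate (ht.mul ht)
  · have e : (√K * s ^ p / s ^ 3) ^ 2 = K * (s ^ 2) ^ p / (s ^ 2) ^ 3 := by
      rw [div_pow, mul_pow, Real.sq_sqrt h0, ← pow_mul, ← pow_mul, ← pow_mul, ← pow_mul, mul_comm p 2]
    rw [e, le_div_iff₀ (by positivity), mul_comm]
    exact h1

section
variable {E : Type*} [NormedAddCommGroup E] [NormedSpace ℝ E] {g : ℝ × ℝ → ℝ}

/-- Midpoint Riemann sums of the gradient of `g` along a discrete path. -/
def midSum (b : ℕ → E →L[ℝ] ℝ × ℝ) (N : ℕ) (g : ℝ × ℝ → ℝ) (z : E) : ℝ :=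
  ∑ j ∈ Finset.range N, dv (incr b j z) g (mid b j z)

lemma continuous_midSum (b : ℕ → E →L[ℝ] ℝ × ℝ) (N : ℕ) (hg : Cb g) : Continuous (midSum b N g) := by
  refine continuous_finsetSum _ fun j _ => ?_
  have h : Continuous (fderiv ℝ g) := (hasTemperateGrowth_fderiv hg.temperate).1.continuous
  exact (h.comp (mid b j).continuous).clm_apply (incr b j).continuous

variable [MeasurableSpace E] {μ : Measure E} {b : ℕ → E →L[ℝ] ℝ × ℝ} {N : ℕ} {v s C : ℝ}

lemma Grid.sum_pow_three (h : Grid μ b N v s C) (γ : ℝ × ℝ → ℝ) (u : Fin 6) (z : E) :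
    ∑ j ∈ Finset.range N, γ (mid b j z) * dot (dir u) (incr b j z) ^ 3 =
      wsum μ b N γ u 3 z + 3 * (dot (dir u) (dir u) * v) * wsum μ b N γ u 1 z := by
  simp only [wsum, Finset.mul_sum, ← Finset.sum_add_distrib]
  refine Finset.sum_congr rfl fun j hj => ?_
  rw [gh_one, gh, h.var u j (Finset.mem_range.1 hj), ← xi_apply b (u, j),
    herm_three (dot (dir u) (dir u) * v)]
  ring

lemma Grid.sum_pow_five (h : Grid μ b N v s C) (γ : ℝ × ℝ → ℝ) (u : Fin 6) (z : E) :
    ∑ j ∈ Finset.range N, γ (mid b j z) * dot (dir u) (incr b j z) ^ 5 =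
      wsum μ b N γ u 5 z + 10 * (dot (dir u) (dir u) * v) * wsum μ b N γ u 3 z +
        15 * (dot (dir u) (dir u) * v) ^ 2 * wsum μ b N γ u 1 z := by
  simp only [wsum, Finset.mul_sum, ← Finset.sum_add_distrib]
  refine Finset.sum_congr rfl fun j hj => ?_
  rw [gh_one, gh, gh, h.var u j (Finset.mem_range.1 hj), ← xi_apply b (u, j),
    herm_five (dot (dir u) (dir u) * v)]
  ring

lemma midSum_lap (hg : Cb g) (b : ℕ → E →L[ℝ] ℝ × ℝ) (N : ℕ) (z : E) :
    midSum b N (lap g) z = ∑ u, dot (dir u) (dir u) * wsum μ b N (wtThree g u) u 1 z := by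
  simp only [midSum, dv_lap hg, wsum, Finset.mul_sum]
  rw [Finset.sum_comm]
  refine Finset.sum_congr rfl fun u _ => Finset.sum_congr rfl fun j _ => ?_
  rw [gh_one, xi_apply]
  ring

variable [BorelSpace E] [FiniteDimensional ℝ E]

lemma Grid.leOne_sum_of_le (h : Grid μ b N v s C) {F : ℝ × ℝ → ℝ × ℝ → ℝ} {K : ℝ} (p : ℕ)
    (hK : 0 ≤ K) (hF : ∀ m h, |F m h| ≤ K * ‖h‖ ^ p)
    (hc : Continuous fun z => ∑ j ∈ Finset.range N, F (mid b j z) (incr b j z)) :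
    LeOne μ (fun z => ∑ j ∈ Finset.range N, F (mid b j z) (incr b j z))
      (K * (2 * C * absMoment p * s ^ p / s ^ 6)) := by
  have h1 := (h.leOne_sum_norm_pow p).const_mul K
  rw [abs_of_nonneg hK] at h1
  refine h1.of_abs_le hc.aestronglyMeasurable fun z => ?_
  rw [Finset.mul_sum]
  exact (Finset.abs_sum_le_sum_abs _ _).trans (Finset.sum_le_sum fun j _ => hF _ _)

end

lemma dot_dir_le (u : Fin 6) : |dot (dir u) (dir u)| ≤ 5 := by
  fin_cases u <;> norm_num [dot, dir, abs_of_pos]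

lemma exists_midSum_bound {g : ℝ × ℝ → ℝ} (hg : Cb g) (C : ℝ) :
    ∃ K : ℝ, 0 ≤ K ∧ ∀ {E : Type} [NormedAddCommGroup E] [NormedSpace ℝ E] [MeasurableSpace E]
      [BorelSpace E] [FiniteDimensional ℝ E] {μ : Measure E} {b : ℕ → E →L[ℝ] ℝ × ℝ} {N : ℕ} {v s : ℝ}
      (_ : Grid μ b N v s C), LeOne μ (midSum b N g) (K / s) := by
  obtain ⟨M, hM0, hM⟩ := hg.bound
  obtain ⟨K5, hK50, hK5⟩ := exists_taylor_five hg
  choose K1 hK10 hK1 using fun u => exists_wsum_bound (cb_wtThree hg u) (p := 1) (by simp) C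
  choose K3 hK30 hK3 using fun u => exists_wsum_bound (cb_wtThree hg u) (p := 3) (by simp) C
  have hm := absMoment_nonneg 5
  refine ⟨2 * M + K5 * (2 * |C| * absMoment 5) + 1 / 24 * ∑ u, (K3 u + 15 * K1 u), ?_,
    fun {E} _ _ _ _ _ μ b N v s h => ?_⟩
  · have : 0 ≤ ∑ u, (K3 u + 15 * K1 u) := Finset.sum_nonneg fun u _ => by linarith [hK30 u, hK10 u]
    positivity
  have := h.gauss.gauss.toIsProbabilityMeasure
  have hs := h.s_pos
  have hs1 := h.s_le_one
  have hC : 0 ≤ C := zero_le_one.trans h.weak.one_le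
  have hgc : Continuous g := hg.1.continuous
  have hwc : ∀ u, Continuous (wtThree g u) := fun u => (cb_wtThree hg u).1.continuous
  set R : ℝ × ℝ → ℝ × ℝ → ℝ := fun m h => g (m + (1 / 2 : ℝ) • h) - g (m - (1 / 2 : ℝ) • h) - dv h g m
      - (1 / 24) * ∑ u, wtThree g u m * dot (dir u) h ^ 3 with hR
  have hid : ∀ z, ∑ j ∈ Finset.range N, R (mid b j z) (incr b j z) = (g (b N z) - g (b 0 z)) -
      midSum b N g z - 1 / 24 * ∑ u, (wsum μ b N (wtThree g u) u 3 z +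
        3 * (dot (dir u) (dir u) * v) * wsum μ b N (wtThree g u) u 1 z) := by
    intro z
    simp only [hR, Finset.sum_sub_distrib, mid_add, mid_sub, midSum]
    rw [← Finset.sum_sub_distrib, Finset.sum_range_sub (fun j => g (b j z)), ← Finset.mul_sum, Finset.sum_comm]
    simp only [h.sum_pow_three]
  have hcont : Continuous fun z => ∑ j ∈ Finset.range N, R (mid b j z) (incr b j z) := by
    simp only [hid]
    have h1 := continuous_midSum b N hg
    have h2 := fun u p => (wsum_temperate (μ := μ) b N (cb_wtThree hg u) u p).1.continuous
    fun_prop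
  have l1 := h.leOne_sum_of_le (F := R) 5 hK50 hK5 hcont
  have l2 : LeOne μ (fun z => g (b N z) - g (b 0 z)) (2 * M) := by
    have hi : LeOne μ (fun _ => 2 * M) (2 * M) := ⟨integrable_const _, by
      rw [integral_const, probReal_univ, one_smul, abs_of_nonneg (by positivity)]⟩
    refine hi.of_abs_le (by fun_prop) fun z => ?_
    have h1 := hM (b N z)
    have h2 := hM (b 0 z)
    rw [Real.norm_eq_abs, abs_le] at h1 h2
    rw [abs_le]; constructor <;> linarith
  have l3 : ∀ u, LeOne μ (fun z => wsum μ b N (wtThree g u) u 3 z +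
        3 * (dot (dir u) (dir u) * v) * wsum μ b N (wtThree g u) u 1 z) (K3 u + 15 * K1 u) := by
    intro u
    refine ((hK3 u h u).add ((hK1 u h u).const_mul (3 * (dot (dir u) (dir u) * v)))).mono ?_
    have e1 : K3 u * s ^ 3 / s ^ 3 = K3 u := by field_simp
    have e2 : K1 u * s ^ 1 / s ^ 3 = K1 u / s ^ 2 := by field_simp
    rw [e1, e2, abs_mul, abs_mul, abs_of_nonneg h.v_nonneg, abs_of_pos (by norm_num : (0 : ℝ) < 3)]
    have := dot_dir_le u
    have h1 : 3 * (|dot (dir u) (dir u)| * v) * (K1 u / s ^ 2) ≤ 3 * (5 * s ^ 2) * (K1 u / s ^ 2) := by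
      have := h.v_le
      have := hK10 u
      have := h.v_nonneg
      gcongr
    have h2 : 3 * (5 * s ^ 2) * (K1 u / s ^ 2) = 15 * K1 u := by field_simp; ring
    linarith
  have l4 := (LeOne.sum Finset.univ fun u _ => l3 u).const_mul (-(1 / 24))
  have l5 := (l2.add (l1.const_mul (-1))).add l4
  have e : (fun z => ((g (b N z) - g (b 0 z)) + -1 * ∑ j ∈ Finset.range N, R (mid b j z) (incr b j z)) +
      -(1 / 24) * ∑ u, (wsum μ b N (wtThree g u) u 3 z +
        3 * (dot (dir u) (dir u) * v) * wsum μ b N (wtThree g u) u 1 z)) = midSum b N g := by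
    ext z; rw [hid]; ring
  rw [e] at l5
  refine l5.mono ?_
  have hsum : 0 ≤ ∑ u, (K3 u + 15 * K1 u) := Finset.sum_nonneg fun u _ => by linarith [hK30 u, hK10 u]
  rw [abs_of_nonneg hC, le_div_iff₀ hs, add_mul, add_mul]
  have e1 : |(-1 : ℝ)| * (K5 * (2 * C * absMoment 5 * s ^ 5 / s ^ 6)) * s = K5 * (2 * C * absMoment 5) := by
    rw [abs_neg, abs_one]; field_simp
  rw [e1, abs_neg, abs_of_pos (by norm_num : (0 : ℝ) < 1 / 24)]
  have e2 : 2 * M * s ≤ 2 * M := mul_le_of_le_one_right (by positivity) hs1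
  have e3 : 1 / 24 * ∑ u, (K3 u + 15 * K1 u) * s ≤ 1 / 24 * ∑ u, (K3 u + 15 * K1 u) := by
    rw [← Finset.sum_mul]
    gcongr
    exact mul_le_of_le_one_right hsum hs1
  rw [← Finset.sum_mul] at e3
  linarith

/-- The cubic variation term in the expansion of midpoint Riemann sums. -/
def cubicSum {E : Type*} [NormedAddCommGroup E] [NormedSpace ℝ E] [MeasurableSpace E] (μ : Measure E)
    (b : ℕ → E →L[ℝ] ℝ × ℝ) (N : ℕ) (g : ℝ × ℝ → ℝ) (z : E) : ℝ :=
  ∑ u, wsum μ b N (wtThree g u) u 3 z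

lemma exists_expansion_bound {g : ℝ × ℝ → ℝ} (hg : Cb g) (C : ℝ) :
    ∃ K : ℝ, 0 ≤ K ∧ ∀ {E : Type} [NormedAddCommGroup E] [NormedSpace ℝ E] [MeasurableSpace E]
      [BorelSpace E] [FiniteDimensional ℝ E] {μ : Measure E} {b : ℕ → E →L[ℝ] ℝ × ℝ} {N : ℕ} {v s : ℝ}
      (_ : Grid μ b N v s C),
      LeOne μ (fun z => midSum b N g z - (g (b N z) - g (b 0 z) - 1 / 24 * cubicSum μ b N g z)) (K * s) := by
  obtain ⟨KL, hKL0, hKL⟩ := exists_midSum_bound (cb_lap hg) C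
  obtain ⟨K7, hK70, hK7⟩ := exists_taylor_seven hg
  choose K1 hK10 hK1 using fun u => exists_wsum_bound (cb_wtFive hg u) (p := 1) (by simp) C
  choose K3 hK30 hK3 using fun u => exists_wsum_bound (cb_wtFive hg u) (p := 3) (by simp) C
  choose K5 hK50 hK5 using fun u => exists_wsum_bound (cb_wtFive hg u) (p := 5) (by simp) C
  have hm := absMoment_nonneg 7
  have hsum : 0 ≤ ∑ u, (K5 u + 50 * K3 u + 375 * K1 u) :=
    Finset.sum_nonneg fun u _ => by linarith [hK30 u, hK10 u, hK50 u]
  refine ⟨K7 * (2 * |C| * absMoment 7) + KL + ∑ u, (K5 u + 50 * K3 u + 375 * K1 u), by positivity,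
    fun {E} _ _ _ _ _ μ b N v s h => ?_⟩
  have hs := h.s_pos
  have hs1 := h.s_le_one
  have hC : 0 ≤ C := zero_le_one.trans h.weak.one_le
  have hgc : Continuous g := hg.1.continuous
  set R : ℝ × ℝ → ℝ × ℝ → ℝ := fun m h => g (m + (1 / 2 : ℝ) • h) - g (m - (1 / 2 : ℝ) • h) - dv h g m
      - (1 / 24) * ∑ u, wtThree g u m * dot (dir u) h ^ 3
      - (1 / 1920) * ∑ u, wtFive g u m * dot (dir u) h ^ 5 with hR
  set Q : Fin 6 → E → ℝ := fun u z => wsum μ b N (wtFive g u) u 5 z +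
    10 * (dot (dir u) (dir u) * v) * wsum μ b N (wtFive g u) u 3 z +
      15 * (dot (dir u) (dir u) * v) ^ 2 * wsum μ b N (wtFive g u) u 1 z with hQ
  have hid : ∀ z, ∑ j ∈ Finset.range N, R (mid b j z) (incr b j z) = (g (b N z) - g (b 0 z)) -
      midSum b N g z - 1 / 24 * (cubicSum μ b N g z + 3 * v * midSum b N (lap g) z) - 1 / 1920 * ∑ u, Q u z := by
    intro z
    simp only [hR, Finset.sum_sub_distrib, mid_add, mid_sub]
    rw [← Finset.sum_sub_distrib, Finset.sum_range_sub (fun j => g (b j z)), ← Finset.mul_sum,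
      ← Finset.mul_sum, Finset.sum_comm]
    nth_rewrite 2 [Finset.sum_comm]
    simp only [h.sum_pow_three, h.sum_pow_five]
    rw [midSum_lap (μ := μ) hg, Finset.sum_add_distrib, Finset.mul_sum (a := 3 * v)]
    simp only [cubicSum, midSum, hQ]
    congr 4
    exact Finset.sum_congr rfl fun u _ => by ring
  have hcont : Continuous fun z => ∑ j ∈ Finset.range N, R (mid b j z) (incr b j z) := by
    simp only [hid, hQ, cubicSum]
    have h1 := continuous_midSum b N hg
    have h1' := continuous_midSum b N (cb_lap hg)
    have h2 := fun u p => (wsum_temperate (μ := μ) b N (cb_wtThree hg u) u p).1.continuous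
    have h3 := fun u p => (wsum_temperate (μ := μ) b N (cb_wtFive hg u) u p).1.continuous
    fun_prop
  have l1 := h.leOne_sum_of_le (F := R) 7 hK70 hK7 hcont
  have l2 := (hKL h).const_mul (1 / 8 * v)
  have l3 : ∀ u, LeOne μ (Q u) ((K5 u + 50 * K3 u + 375 * K1 u) * s) := by
    intro u
    refine (((hK5 u h u).add ((hK3 u h u).const_mul (10 * (dot (dir u) (dir u) * v)))).add
      ((hK1 u h u).const_mul (15 * (dot (dir u) (dir u) * v) ^ 2))).mono ?_
    have e1 : K3 u * s ^ 3 / s ^ 3 = K3 u := by field_simp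
    have e2 : K1 u * s ^ 1 / s ^ 3 = K1 u / s ^ 2 := by field_simp
    have e3 : K5 u * s ^ 5 / s ^ 3 = K5 u * s ^ 2 := by field_simp
    have := dot_dir_le u
    have hd : |dot (dir u) (dir u) * v| ≤ 5 * s ^ 2 := by
      rw [abs_mul, abs_of_nonneg h.v_nonneg]
      have := h.v_le
      have := h.v_nonneg
      gcongr
    rw [e1, e2, e3, abs_mul 10, abs_mul 15, abs_pow, abs_of_pos (by norm_num : (0 : ℝ) < 10),
      abs_of_pos (by norm_num : (0 : ℝ) < 15)]
    have k1 := hK10 u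
    have k3 := hK30 u
    have k5 := hK50 u
    have hss : s ^ 2 ≤ s := by nlinarith
    have h1 : 10 * |dot (dir u) (dir u) * v| * K3 u ≤ 10 * (5 * s ^ 2) * K3 u := by gcongr
    have h2 : 15 * |dot (dir u) (dir u) * v| ^ 2 * (K1 u / s ^ 2) ≤
        15 * (5 * s ^ 2) ^ 2 * (K1 u / s ^ 2) := by gcongr
    have h3 : 15 * (5 * s ^ 2) ^ 2 * (K1 u / s ^ 2) = 375 * K1 u * s ^ 2 := by field_simp; ring
    have h4 : (K5 u + 50 * K3 u + 375 * K1 u) * s ^ 2 ≤ (K5 u + 50 * K3 u + 375 * K1 u) * s := by gcongr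
    linarith
  have l4 := (LeOne.sum Finset.univ fun u _ => l3 u).const_mul (-(1 / 1920))
  have l5 := ((l1.const_mul (-1)).add (l2.const_mul (-1))).add l4
  have e : (fun z => (-1 * ∑ j ∈ Finset.range N, R (mid b j z) (incr b j z) +
      -1 * (1 / 8 * v * midSum b N (lap g) z)) + -(1 / 1920) * ∑ u, Q u z) = fun z =>
      midSum b N g z - (g (b N z) - g (b 0 z) - 1 / 24 * cubicSum μ b N g z) := by
    ext z; rw [hid]; ring
  rw [e] at l5
  refine l5.mono ?_
  have e1 : |(-1 : ℝ)| * (K7 * (2 * C * absMoment 7 * s ^ 7 / s ^ 6)) = K7 * (2 * C * absMoment 7) * s := by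
    rw [abs_neg, abs_one]; field_simp
  have e2 : |(-1 : ℝ)| * (|1 / 8 * v| * (KL / s)) ≤ KL * s := by
    rw [abs_neg, abs_one, one_mul, abs_of_nonneg (by have := h.v_nonneg; positivity)]
    calc 1 / 8 * v * (KL / s) ≤ 1 / 8 * s ^ 2 * (KL / s) := by gcongr; exact h.v_le
      _ = 1 / 8 * (KL * s) := by field_simp
      _ ≤ KL * s := by have : 0 ≤ KL * s := by positivity
                       linarith
  have e4 : |(-(1 / 1920) : ℝ)| = 1 / 1920 := by norm_num [abs_of_pos]
  rw [e1, ← Finset.sum_mul, e4, abs_of_nonneg hC, add_mul, add_mul]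
  have e3 : 0 ≤ (∑ u, (K5 u + 50 * K3 u + 375 * K1 u)) * s := by positivity
  linarith

end CriticalHurst

namespace CriticalHurst

open Function
open scoped ENNReal NNReal Topology

section Planar
variable {E : Type*} [NormedAddCommGroup E] [NormedSpace ℝ E] [MeasurableSpace E]

/-- Under `μ`, the evaluations `ev s` for `s ∈ T` form a planar Gaussian process with independent
coordinates of covariance `cov6`. -/
structure Planar (μ : Measure E) (ev : ℝ → E →L[ℝ] ℝ × ℝ) (T : Set ℝ) : Prop where
  gauss : CGauss μ
  cov : ∀ s ∈ T, ∀ r ∈ T, ∀ w : ℝ × ℝ, ev s (cvec μ ((dotL w).comp (ev r))) = cov6 s r • w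

/-- The path of evaluations along a regular grid. -/
def gridPath (ev : ℝ → E →L[ℝ] ℝ × ℝ) (δ : ℝ) (j : ℕ) : E →L[ℝ] ℝ × ℝ := ev (j * δ)

section Midpoint
variable {E : Type*} [NormedAddCommGroup E] [NormedSpace ℝ E] {ev : ℝ → E →L[ℝ] ℝ × ℝ}

lemma norm_mid_le (δ : ℝ) (j : ℕ) (x : E) : ‖mid (gridPath ev δ) j x‖ ≤
    (‖ev (j * δ) x‖ + ‖ev ((j + 1 : ℕ) * δ) x‖) / 2 := by
  rw [mid, smul_apply, add_apply, norm_smul, Real.norm_eq_abs, abs_of_pos one_half_pos]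
  have := norm_add_le (gridPath ev δ j x) (gridPath ev δ (j + 1) x)
  simp only [gridPath] at this ⊢
  linarith

end Midpoint

variable [BorelSpace E] [FiniteDimensional ℝ E] {μ : Measure E} {ev : ℝ → E →L[ℝ] ℝ × ℝ} {T : Set ℝ}

lemma cvec_sub (hμ : CGauss μ) (ξ η : E →L[ℝ] ℝ) : cvec μ (ξ - η) = cvec μ ξ - cvec μ η := by
  refine (SeparatingDual.eq_iff_forall_dual_eq (R := ℝ)).2 fun l => ?_
  rw [map_sub, cvec_symm hμ, cvec_symm hμ l ξ, cvec_symm hμ l η]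
  rfl

lemma norm_dir_le (u : Fin 6) : ‖dir u‖ ≤ 2 := by
  fin_cases u <;> simp [dir, Prod.norm_def]

lemma abs_dot_dir_le (u u' : Fin 6) : |dot (dir u) (dir u')| ≤ 5 := by
  fin_cases u <;> fin_cases u' <;> norm_num [dir, dot]

namespace Planar

lemma ev_cvec (h : Planar μ ev T) {s : ℝ} (hs : s ∈ T) {δ : ℝ} (i : Fin 6 × ℕ) (hi : i.2 * δ ∈ T)
    (hi' : (i.2 + 1 : ℕ) * δ ∈ T) :
    ev s (cvec μ (xi (gridPath ev δ) i)) = (cov6 s ((i.2 + 1 : ℕ) * δ) - cov6 s (i.2 * δ)) • dir i.1 := by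
  have e : xi (gridPath ev δ) i = (dotL (dir i.1)).comp (ev ((i.2 + 1 : ℕ) * δ)) -
      (dotL (dir i.1)).comp (ev (i.2 * δ)) := by
    rw [xi, incr, ContinuousLinearMap.comp_sub]
    rfl
  rw [e, cvec_sub h.gauss, map_sub, h.cov s hs _ hi', h.cov s hs _ hi, sub_smul]

lemma xi_cvec (h : Planar μ ev T) {δ : ℝ} (hδ : 0 ≤ δ) {N : ℕ} (hT : ∀ j ≤ N, (j : ℝ) * δ ∈ T)
    (i j : Fin 6 × ℕ) (hi : i.2 < N) (hj : j.2 < N) :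
    xi (gridPath ev δ) j (cvec μ (xi (gridPath ev δ) i)) =
      dot (dir j.1) (dir i.1) * (δ ^ (1 / 3 : ℝ) * rho6 ((j.2 : ℤ) - i.2)) := by
  rw [xi_apply, incr, sub_apply, gridPath, gridPath, h.ev_cvec (hT _ hj) i (hT _ hi.le) (hT _ hi),
    h.ev_cvec (hT _ hj.le) i (hT _ hi.le) (hT _ hi), ← cov6_grid hδ]
  simp only [dot, Prod.fst_sub, Prod.snd_sub, Prod.smul_fst, Prod.smul_snd, smul_eq_mul]
  ring

lemma cov6_comm (s t : ℝ) : cov6 s t = cov6 t s := by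
  rw [cov6_eq, cov6_eq, ← neg_sub s t, cbrt_neg, abs_neg]; ring

lemma norm_ev_cvec_le (h : Planar μ ev T) {s : ℝ} (hs : s ∈ T) {δ : ℝ} (i : Fin 6 × ℕ)
    (hi : i.2 * δ ∈ T) (hi' : (i.2 + 1 : ℕ) * δ ∈ T) :
    ‖ev s (cvec μ (xi (gridPath ev δ) i))‖ ≤ 2 * |cov6 ((i.2 + 1 : ℕ) * δ) s - cov6 (i.2 * δ) s| := by
  rw [h.ev_cvec hs i hi hi', norm_smul, Real.norm_eq_abs, cov6_comm s, cov6_comm s, mul_comm 2]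
  exact mul_le_mul_of_nonneg_left (norm_dir_le _) (abs_nonneg _)

lemma norm_ev_cvec_le' (h : Planar μ ev T) {s : ℝ} (hs : s ∈ T) {δ : ℝ} (hδ : 0 ≤ δ) (i : Fin 6 × ℕ)
    (hi : i.2 * δ ∈ T) (hi' : (i.2 + 1 : ℕ) * δ ∈ T) :
    ‖ev s (cvec μ (xi (gridPath ev δ) i))‖ ≤ 4 * δ ^ (1 / 3 : ℝ) := by
  have h1 := h.norm_ev_cvec_le hs i hi hi'
  have h2 := abs_cov6_sub_le' (a := i.2 * δ) (b := (i.2 + 1 : ℕ) * δ) (by push_cast; nlinarith) s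
  have e : ((i.2 + 1 : ℕ) : ℝ) * δ - i.2 * δ = δ := by push_cast; ring
  rw [e] at h2
  linarith

lemma sum_norm_ev_cvec_le (h : Planar μ ev T) {s : ℝ} (hs : s ∈ T) {δ : ℝ} (hδ : 0 ≤ δ) {N : ℕ}
    (hT : ∀ j ≤ N, (j : ℝ) * δ ∈ T) {t : ℝ} (hN : N * δ ≤ t) :
    ∑ i ∈ Finset.univ ×ˢ Finset.range N, ‖ev s (cvec μ (xi (gridPath ev δ) i))‖ ≤ 24 * (1 + t) := by
  have hm : Monotone fun j : ℕ => (j : ℝ) * δ := fun a b hab => by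
    have : (a : ℝ) ≤ b := by exact_mod_cast hab
    exact mul_le_mul_of_nonneg_right this hδ
  have h1 := sum_abs_cov6_le (N := N) hm s
  simp only [Nat.cast_zero, zero_mul, sub_zero] at h1
  have h0 : 0 ≤ (N : ℝ) * δ := by positivity
  have h2 : ((N : ℝ) * δ) ^ (1 / 3 : ℝ) ≤ 1 + t := by
    have h3 := rpow_third_pow h0
    have h4 : 0 ≤ ((N : ℝ) * δ) ^ (1 / 3 : ℝ) := by positivity
    set y := ((N : ℝ) * δ) ^ (1 / 3 : ℝ)
    by_contra! hc
    nlinarith [mul_nonneg h4 (sq_nonneg (y - 1)), sq_nonneg (y - 1)]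
  rw [Finset.sum_product]
  calc _ ≤ ∑ _u : Fin 6, 2 * (2 * (1 + t)) := Finset.sum_le_sum fun u _ => by
        calc _ ≤ ∑ j ∈ Finset.range N, 2 * |cov6 ((j + 1 : ℕ) * δ) s - cov6 (j * δ) s| :=
              Finset.sum_le_sum fun j hj =>
                h.norm_ev_cvec_le hs (u, j) (hT _ (Finset.mem_range.1 hj).le) (hT _ (Finset.mem_range.1 hj))
          _ ≤ _ := by rw [← Finset.mul_sum]; linarith
    _ = _ := by simp; ring

end Planar

/-- Scale factor relating the size of correlations to the variance of the increments. -/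
def corrScale : ℝ := 5 * (1 + rhoSum)

lemma five_le_corrScale : 5 ≤ corrScale := by
  have := rhoSum_nonneg; rw [corrScale]; linarith

/-- Constant governing the weak correlation of the increments on `[0, t]`. -/
def weakConst (t : ℝ) : ℝ := 24 * (1 + t) * corrScale ^ 3

lemma le_weakConst {t : ℝ} (ht : 0 ≤ t) : 24 * (1 + t) ≤ weakConst t := by
  have h : 1 ≤ corrScale ^ 3 := one_le_pow₀ (by linarith [five_le_corrScale])
  have h0 : 0 ≤ 24 * (1 + t) := by positivity
  rw [weakConst]; nlinarith

namespace Planar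

lemma weak (h : Planar μ ev T) {δ : ℝ} (hδ : 0 < δ) {N : ℕ} (hT : ∀ j ≤ N, (j : ℝ) * δ ∈ T)
    {t : ℝ} (hN : N * δ ≤ t) (hsmall : corrScale * δ ^ (1 / 3 : ℝ) ≤ 1) :
    WeakCorr μ (Finset.univ ×ˢ Finset.range N) (xi (gridPath ev δ)) (fun _ => (0 : E →L[ℝ] ℝ))
      (corrScale * δ ^ (1 / 3 : ℝ)) (weakConst t) := by
  have hv : 0 < δ ^ (1 / 3 : ℝ) := by positivity
  have hc := five_le_corrScale
  have hr := rhoSum_nonneg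
  have h0 : 0 ≤ (N : ℝ) * δ := by positivity
  have hC := le_weakConst (h0.trans hN)
  have key : ∀ i ∈ Finset.univ ×ˢ Finset.range N, ∀ j ∈ Finset.univ ×ˢ Finset.range N,
      |xi (gridPath ev δ) j (cvec μ (xi (gridPath ev δ) i))| ≤
        5 * δ ^ (1 / 3 : ℝ) * |rho6 ((i.2 : ℤ) - j.2)| := fun i hi j hj => by
    have hi := (Finset.mem_product.1 hi).2
    have hj := (Finset.mem_product.1 hj).2
    rw [h.xi_cvec hδ.le hT i j (by simpa using hi) (by simpa using hj), abs_mul, abs_mul, abs_of_pos hv,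
      ← neg_sub (i.2 : ℤ), rho6_neg, mul_assoc]
    exact mul_le_mul_of_nonneg_right (abs_dot_dir_le _ _) (by positivity)
  refine ⟨by positivity, hsmall, by linarith, ?_, fun i hi j hj => ?_, fun i hi => ?_, ?_, ?_, ?_⟩
  · rw [mul_pow, rpow_third_pow hδ.le]
    simp only [Finset.card_product, Finset.card_univ, Fintype.card_fin, Finset.card_range]
    push_cast
    rw [weakConst]
    have : 0 < corrScale ^ 3 := by positivity
    nlinarith
  · refine (key i hi j hj).trans ?_
    have := abs_rho6_le ((i.2 : ℤ) - j.2)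
    rw [corrScale]
    nlinarith
  · refine (Finset.sum_le_sum fun j hj => key i hi j hj).trans ?_
    rw [Finset.sum_product]
    simp only [← Finset.mul_sum]
    rw [Finset.sum_const, Finset.card_univ, Fintype.card_fin, nsmul_eq_mul]
    have h1 := sum_abs_rho6_le i.2 N
    calc _ ≤ 5 * δ ^ (1 / 3 : ℝ) * (((6 : ℕ) : ℝ) * rhoSum) :=
          mul_le_mul_of_nonneg_left (mul_le_mul_of_nonneg_left h1 (by positivity)) (by positivity)
      _ ≤ 6 * (corrScale * δ ^ (1 / 3 : ℝ)) := by rw [corrScale]; push_cast; nlinarith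
      _ ≤ _ := mul_le_mul_of_nonneg_right (by linarith) (by positivity)
  · intro i _ j _
    simp only [zero_apply, norm_zero]; positivity
  · intro j _
    simp only [zero_apply, norm_zero, Finset.sum_const_zero]; linarith
  · simp only [zero_apply, norm_zero, Finset.sum_const_zero]; linarith

lemma norm_mid_diag_le (h : Planar μ ev T) {δ : ℝ} (hδ : 0 ≤ δ) {N : ℕ} (hT : ∀ j ≤ N, (j : ℝ) * δ ∈ T)
    (i : Fin 6 × ℕ) (hi : i.2 < N) :
    ‖mid (gridPath ev δ) i.2 (cvec μ (xi (gridPath ev δ) i))‖ ≤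
      cbrt ((i.2 + 1 : ℕ) * δ) - cbrt (i.2 * δ) := by
  rw [mid, smul_apply, add_apply, gridPath, gridPath, h.ev_cvec (hT _ hi) i (hT _ hi.le) (hT _ hi),
    h.ev_cvec (hT _ hi.le) i (hT _ hi.le) (hT _ hi), ← add_smul, smul_smul, norm_smul]
  have h0 : 0 ≤ (i.2 : ℝ) * δ := by positivity
  have h1 : 0 ≤ ((i.2 + 1 : ℕ) : ℝ) * δ := by positivity
  have hm : cbrt (i.2 * δ) ≤ cbrt ((i.2 + 1 : ℕ) * δ) := cbrt_mono (by push_cast; nlinarith)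
  have hz : cbrt 0 = 0 := by simp [cbrt]
  have p0 : 0 ≤ cbrt (i.2 * δ) := hz ▸ cbrt_mono h0
  have p1 : 0 ≤ cbrt ((i.2 + 1 : ℕ) * δ) := hz ▸ cbrt_mono h1
  have e : (1 / 2 : ℝ) * (cov6 (i.2 * δ) ((i.2 + 1 : ℕ) * δ) - cov6 (i.2 * δ) (i.2 * δ) +
      (cov6 ((i.2 + 1 : ℕ) * δ) ((i.2 + 1 : ℕ) * δ) - cov6 ((i.2 + 1 : ℕ) * δ) (i.2 * δ))) =
      (cbrt ((i.2 + 1 : ℕ) * δ) - cbrt (i.2 * δ)) / 2 := by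
    rw [cov6_comm (i.2 * δ) ((i.2 + 1 : ℕ) * δ), cov6_eq, cov6_eq, cov6_eq, sub_self, sub_self, hz,
      abs_of_nonneg p0, abs_of_nonneg p1, abs_zero]
    ring
  rw [e, Real.norm_eq_abs, abs_of_nonneg (by linarith)]
  have := norm_dir_le i.1
  nlinarith

lemma sum_norm_mid_diag_le (h : Planar μ ev T) {δ : ℝ} (hδ : 0 ≤ δ) {N : ℕ}
    (hT : ∀ j ≤ N, (j : ℝ) * δ ∈ T) {t : ℝ} (hN : N * δ ≤ t) :
    ∑ i ∈ Finset.univ ×ˢ Finset.range N, ‖mid (gridPath ev δ) i.2 (cvec μ (xi (gridPath ev δ) i))‖ ≤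
      24 * (1 + t) := by
  have h0 : 0 ≤ (N : ℝ) * δ := by positivity
  have hz : cbrt 0 = 0 := by simp [cbrt]
  have h2 : cbrt (N * δ) ≤ 1 + t := by
    have h3 := cbrt_pow (N * δ)
    have h4 : 0 ≤ cbrt (N * δ) := hz ▸ cbrt_mono h0
    set y := cbrt (N * δ)
    by_contra! hc
    nlinarith [mul_nonneg h4 (sq_nonneg (y - 1)), sq_nonneg (y - 1)]
  rw [Finset.sum_product]
  calc _ ≤ ∑ _u : Fin 6, (1 + t) := Finset.sum_le_sum fun u _ => by
        calc _ ≤ ∑ j ∈ Finset.range N, (cbrt ((j + 1 : ℕ) * δ) - cbrt (j * δ)) :=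
              Finset.sum_le_sum fun j hj => h.norm_mid_diag_le hδ hT (u, j) (Finset.mem_range.1 hj)
          _ ≤ _ := by
            rw [Finset.sum_range_sub fun j : ℕ => cbrt (j * δ)]
            simpa [hz] using h2
    _ ≤ _ := by simp; linarith

lemma cross_mid_le (h : Planar μ ev T) {δ : ℝ} (hδ : 0 ≤ δ) {N : ℕ} (hT : ∀ j ≤ N, (j : ℝ) * δ ∈ T)
    (i : Fin 6 × ℕ) (hi : i.2 < N) {j : ℕ} (hj : j < N) :
    ‖mid (gridPath ev δ) j (cvec μ (xi (gridPath ev δ) i))‖ ≤ corrScale * δ ^ (1 / 3 : ℝ) := by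
  have h0 := norm_mid_le (ev := ev) δ j (cvec μ (xi (gridPath ev δ) i))
  have h1 := h.norm_ev_cvec_le' (hT j hj.le) hδ i (hT _ hi.le) (hT _ hi)
  have h2 := h.norm_ev_cvec_le' (hT _ hj) hδ i (hT _ hi.le) (hT _ hi)
  have hc := five_le_corrScale
  have hv : 0 ≤ δ ^ (1 / 3 : ℝ) := by positivity
  nlinarith

lemma sum_cross_mid_le (h : Planar μ ev T) {δ : ℝ} (hδ : 0 ≤ δ) {N : ℕ}
    (hT : ∀ j ≤ N, (j : ℝ) * δ ∈ T) {t : ℝ} (hN : N * δ ≤ t) {j : ℕ} (hj : j < N) :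
    ∑ i ∈ Finset.univ ×ˢ Finset.range N, ‖mid (gridPath ev δ) j (cvec μ (xi (gridPath ev δ) i))‖ ≤
      24 * (1 + t) := by
  refine (Finset.sum_le_sum fun i _ => norm_mid_le δ j _).trans ?_
  rw [← Finset.sum_div, Finset.sum_add_distrib]
  have h1 := h.sum_norm_ev_cvec_le (hT j hj.le) hδ hT hN
  have h2 := h.sum_norm_ev_cvec_le (hT _ hj) hδ hT hN
  linarith

lemma grid (h : Planar μ ev T) {δ : ℝ} (hδ : 0 < δ) {N : ℕ} (hT : ∀ j ≤ N, (j : ℝ) * δ ∈ T)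
    {t : ℝ} (hN : N * δ ≤ t) (hsmall : corrScale * δ ^ (1 / 3 : ℝ) ≤ 1) :
    Grid μ (gridPath ev δ) N (δ ^ (1 / 3 : ℝ)) (√(corrScale * δ ^ (1 / 3 : ℝ))) (weakConst t) := by
  have hw := h.weak hδ hT hN hsmall
  have hv : 0 < δ ^ (1 / 3 : ℝ) := by positivity
  have h0 : 0 ≤ (N : ℝ) * δ := by positivity
  have hC := le_weakConst (h0.trans hN)
  have hc := five_le_corrScale
  have hmem : ∀ i ∈ Finset.univ (α := Fin 6) ×ˢ Finset.range N, i.2 < N := fun i hi => by simpa using hi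
  refine ⟨h.gauss, ?_, Real.sqrt_pos.2 hw.pos, fun u j hj => ?_, hv.le, ?_⟩
  · rw [Real.sq_sqrt hw.pos.le]
    exact ⟨hw.pos, hw.le_one, hw.one_le, hw.card_le, hw.corr_le, hw.corr_sum,
      fun i hi j hj => h.cross_mid_le hδ.le hT i (hmem i hi) (hmem j hj),
      fun j hj => (h.sum_cross_mid_le hδ.le hT hN (hmem j hj)).trans hC,
      (h.sum_norm_mid_diag_le hδ.le hT hN).trans hC⟩
  · rw [h.xi_cvec hδ.le hT _ _ hj hj, sub_self]
    have : rho6 0 = 1 := by simp [rho6_eq, cbrt]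
    rw [this, mul_one]
  · rw [Real.sq_sqrt hw.pos.le]; nlinarith

lemma integral_sq_dotL (h : Planar μ ev T) {r s : ℝ} (hr : r ∈ T) (hs : s ∈ T) (w : ℝ × ℝ) :
    ∫ z, dotL w (ev r z - ev s z) ^ 2 ∂μ = dot w w * |cbrt (r - s)| := by
  have e := apply_cvec h.gauss ((dotL w).comp (ev r) - (dotL w).comp (ev s))
    ((dotL w).comp (ev r) - (dotL w).comp (ev s))
  have e2 : ∀ z, ((dotL w).comp (ev r) - (dotL w).comp (ev s)) z •
      ((dotL w).comp (ev r) - (dotL w).comp (ev s)) z = dotL w (ev r z - ev s z) ^ 2 := fun z => by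
    simp [sq]
  have hz : cbrt 0 = 0 := by simp [cbrt]
  simp only [e2] at e
  rw [← e, cvec_sub h.gauss, sub_apply, ContinuousLinearMap.comp_apply, ContinuousLinearMap.comp_apply,
    map_sub, map_sub, map_sub (ev s), h.cov r hr r hr, h.cov r hr s hs, h.cov s hs r hr, h.cov s hs s hs, cov6_comm s r,
    map_sub, map_smul, map_smul, map_smul, dotL_apply, ← sub_smul, ← sub_smul, ← sub_smul, smul_eq_mul, cov6_eq, cov6_eq,
    cov6_eq, sub_self, sub_self, hz, abs_zero]
  ring

lemma integral_sq_norm_le (h : Planar μ ev T) {r s : ℝ} (hr : r ∈ T) (hs : s ∈ T) :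
    LeOne μ (fun z => ‖ev r z - ev s z‖ ^ 2) (2 * |cbrt (r - s)|) := by
  have := h.gauss.gauss
  have hi : ∀ w, Integrable (fun z => dotL w (ev r z - ev s z) ^ 2) μ := fun w =>
    integrable_of_temperate (((dotL w).comp (ev r - ev s)).hasTemperateGrowth.pow 2)
  have h1 : LeOne μ (fun z => dotL (1, 0) (ev r z - ev s z) ^ 2 + dotL (0, 1) (ev r z - ev s z) ^ 2)
      (2 * |cbrt (r - s)|) := by
    refine ⟨(hi _).add (hi _), ?_⟩
    have e : ∀ z, |dotL (1, 0) (ev r z - ev s z) ^ 2 + dotL (0, 1) (ev r z - ev s z) ^ 2| =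
      dotL (1, 0) (ev r z - ev s z) ^ 2 + dotL (0, 1) (ev r z - ev s z) ^ 2 := fun z =>
      abs_of_nonneg (by positivity)
    simp only [e]
    rw [integral_add (hi _) (hi _), h.integral_sq_dotL hr hs, h.integral_sq_dotL hr hs]
    simp [dot]; linarith
  refine h1.of_abs_le (by fun_prop) fun z => ?_
  simp only [dotL_apply, dot]
  rw [abs_of_nonneg (by positivity), Prod.norm_def, Real.norm_eq_abs, Real.norm_eq_abs]
  rcases max_cases |(ev r z - ev s z).1| |(ev r z - ev s z).2| with h | h <;> rw [h.1, sq_abs] <;>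
    nlinarith [sq_nonneg (ev r z - ev s z).1, sq_nonneg (ev r z - ev s z).2]

end Planar
end Planar

section GaussianProcess
variable {Ω : Type*} [MeasurableSpace Ω] {P : Measure Ω} {X X1 X2 : ℝ → Ω → ℝ}

lemma integral_sq_of_map {Y : Ω → ℝ} (hY : Measurable Y) {v : ℝ} (hv : 0 ≤ v)
    (h : P.map Y = gaussianReal 0 v.toNNReal) : ∫ ω, Y ω ^ 2 ∂P = v := by
  have e : ∫ ω, Y ω ^ 2 ∂P = ∫ x, x ^ 2 ∂P.map Y := by
    rw [integral_map hY.aemeasurable (by fun_prop)]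
  have hvar : Var[fun x => x; gaussianReal 0 v.toNNReal] = v := by
    rw [variance_fun_id_gaussianReal, Real.coe_toNNReal _ hv]
  rw [variance_eq_integral (by fun_prop)] at hvar
  simpa [e, h] using hvar

lemma memLp_of_map {Y : Ω → ℝ} (hY : Measurable Y) {v : ℝ≥0} (h : P.map Y = gaussianReal 0 v) :
    MemLp Y 2 P := by
  have := memLp_id_gaussianReal' (μ := 0) (v := v) 2 (by simp)
  rw [← h] at this
  exact (memLp_map_measure_iff (by fun_prop) hY.aemeasurable).1 this

namespace GaussProc

lemma map_sum {ι : Type*} [Fintype ι] {C : ℝ → ℝ → ℝ} (hX : IsCenteredGaussianProcess P X C)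
    (ts c : ι → ℝ) : ∃ v : ℝ≥0, P.map (fun ω => ∑ i, c i * X (ts i) ω) = gaussianReal 0 v := by
  have e := Fintype.equivFin ι
  refine ⟨_, Eq.trans ?_ (hX.2 (Fintype.card ι) (ts ∘ e.symm) (c ∘ e.symm))⟩
  congr 1
  funext ω
  exact (Equiv.sum_comp e.symm fun i => c i * X (ts i) ω).symm

variable (hX : IsCenteredGaussianProcess P X (covH (1 / 6)))
include hX

lemma map_one (s : ℝ) : P.map (X s) = gaussianReal 0 (Real.toNNReal (cov6 s s)) := by
  simpa only [Fin.sum_univ_one, one_mul, Finset.univ_unique, Finset.sum_singleton, cov6] using hX.2 1 (fun _ => s) (fun _ => 1)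

lemma map_sub (s r : ℝ) : P.map (fun ω => X s ω - X r ω) =
    gaussianReal 0 (Real.toNNReal (cov6 s s + cov6 r r - 2 * cov6 s r)) := by
  have h := hX.2 2 ![s, r] ![1, -1]
  simp only [Fin.sum_univ_two, Matrix.cons_val_zero, Matrix.cons_val_one, one_mul, mul_one, neg_mul,
    mul_neg, neg_neg] at h
  simp only [sub_eq_add_neg]
  rw [h]
  congr 2
  have := Planar.cov6_comm s r
  rw [cov6, cov6] at this
  simp only [cov6]
  rw [← this]; ring

lemma memLp (s : ℝ) : MemLp (X s) 2 P := memLp_of_map (hX.1 s) (map_one hX s)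

lemma integral_mul (s r : ℝ) : ∫ ω, X s ω * X r ω ∂P = cov6 s r := by
  have hz : cbrt 0 = 0 := by simp [cbrt]
  have hself : ∀ s, cov6 s s = |cbrt s| := fun s => by rw [cov6_eq, sub_self, hz, abs_zero]; ring
  have h1 := integral_sq_of_map (hX.1 s) (by rw [hself]; positivity) (map_one hX s)
  have h2 := integral_sq_of_map (hX.1 r) (by rw [hself]; positivity) (map_one hX r)
  have h3 := integral_sq_of_map ((hX.1 s).sub (hX.1 r))
    (by rw [hself, hself, cov6_eq]; linarith [abs_nonneg (cbrt (s - r))]) (map_sub hX s r)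
  have i1 := (memLp hX s).integrable_sq
  have i2 := (memLp hX r).integrable_sq
  have i3 : Integrable (fun ω => X s ω * X r ω) P := (memLp hX s).integrable_mul (memLp hX r)
  have i4 : Integrable (fun ω => X s ω ^ 2 + X r ω ^ 2) P := i1.add i2
  have e : ∫ ω, (X s ω - X r ω) ^ 2 ∂P =
      ∫ ω, X s ω ^ 2 ∂P + ∫ ω, X r ω ^ 2 ∂P - 2 * ∫ ω, X s ω * X r ω ∂P := by
    rw [← integral_add i1 i2, ← integral_const_mul, ← integral_sub i4 (i3.const_mul 2)]
    congr 1; funext ω; ring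
  simp only [Pi.sub_apply] at h3
  linarith

lemma integral_eq_zero (s : ℝ) : ∫ ω, X s ω ∂P = 0 := by
  have e : ∫ ω, X s ω ∂P = ∫ x, x ∂P.map (X s) := by
    rw [integral_map (hX.1 s).aemeasurable (by fun_prop)]
  rw [e, map_one hX, integral_id_gaussianReal]

end GaussProc

lemma IndepProcesses.sum {ι : Type*} [Fintype ι] (h : IndepProcesses P X1 X2) (ts c d : ι → ℝ) :
    IndepFun (fun ω => ∑ i, c i * X1 (ts i) ω) (fun ω => ∑ i, d i * X2 (ts i) ω) P := by
  rw [IndepFun_iff_Indep]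
  have aux : ∀ (X : ℝ → Ω → ℝ) (c : ι → ℝ),
      MeasurableSpace.comap (fun ω => ∑ i, c i * X (ts i) ω) inferInstance ≤
        ⨆ t : ℝ, MeasurableSpace.comap (X t) inferInstance := fun X c => by
    rw [← measurable_iff_comap_le]
    refine Finset.measurable_fun_sum _ fun i _ => Measurable.const_mul ?_ _
    exact measurable_iff_comap_le.2 (le_iSup (fun t => MeasurableSpace.comap (X t) _) (ts i))
  exact indep_of_indep_of_le_left (indep_of_indep_of_le_right h (aux X2 d)) (aux X1 c)

end GaussianProcess

/-- Sample of a planar process at finitely many times. -/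
def sample {Ω : Type*} (X1 X2 : ℝ → Ω → ℝ) (T : Finset ℝ) (ω : Ω) : T → ℝ × ℝ :=
  fun s => (X1 s ω, X2 s ω)

open Classical in
/-- Evaluation at time `s`, by convention zero if `s` is not in `T`. -/
def evAt (T : Finset ℝ) (s : ℝ) : (T → ℝ × ℝ) →L[ℝ] ℝ × ℝ :=
  if h : s ∈ T then ContinuousLinearMap.proj ⟨s, h⟩ else 0

section Law
variable {Ω : Type*} {X1 X2 : ℝ → Ω → ℝ}

lemma evAt_sample (X1 X2 : ℝ → Ω → ℝ) {T : Finset ℝ} {s : ℝ} (hs : s ∈ T) (ω : Ω) :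
    evAt T s (sample X1 X2 T ω) = (X1 s ω, X2 s ω) := by
  simp [evAt, hs, sample]

lemma clm_sample {T : Finset ℝ} (L : (T → ℝ × ℝ) →L[ℝ] ℝ) (ω : Ω) :
    L (sample X1 X2 T ω) = ∑ s : T, L (Pi.single s (1, 0)) * X1 s ω +
      ∑ s : T, L (Pi.single s (0, 1)) * X2 s ω := by
  have e : sample X1 X2 T ω = ∑ s : T, (X1 s ω • (Pi.single s (1, 0) : T → ℝ × ℝ) +
      X2 s ω • (Pi.single s (0, 1) : T → ℝ × ℝ)) := by
    funext r
    rw [Finset.sum_apply, Finset.sum_eq_single r]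
    · simp [sample]
    · intro s _ hs; simp [Pi.single_eq_of_ne' hs]
    · simp
  rw [e, map_sum, ← Finset.sum_add_distrib]
  refine Finset.sum_congr rfl fun s _ => ?_
  rw [map_add, map_smul, map_smul, smul_eq_mul, smul_eq_mul, mul_comm, mul_comm (X2 s ω)]

variable [MeasurableSpace Ω] {P : Measure Ω}

lemma measurable_sample {T : Finset ℝ} (h1 : ∀ t, Measurable (X1 t)) (h2 : ∀ t, Measurable (X2 t)) :
    Measurable (sample X1 X2 T) :=
  measurable_pi_lambda _ fun s => (h1 s).prodMk (h2 s)

variable (hX1 : IsCenteredGaussianProcess P X1 (covH (1 / 6)))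
  (hX2 : IsCenteredGaussianProcess P X2 (covH (1 / 6))) (hI : IndepProcesses P X1 X2)
include hX1 hX2 hI

lemma integral_mul_eq_zero (s r : ℝ) : ∫ ω, X1 s ω * X2 r ω ∂P = 0 := by
  have h := IndepProcesses.sum hI ![s, r] ![1, 0] ![0, 1]
  simp only [Fin.sum_univ_two, Matrix.cons_val_zero, Matrix.cons_val_one, one_mul, zero_mul, add_zero,
    zero_add] at h
  have := h.integral_mul_eq_mul_integral (hX1.1 s).aestronglyMeasurable (hX2.1 r).aestronglyMeasurable
  rw [GaussProc.integral_eq_zero hX1, zero_mul] at this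
  exact this

lemma cgauss_sample (T : Finset ℝ) : CGauss (P.map (sample X1 X2 T)) := by
  have hm := measurable_sample (T := T) hX1.1 hX2.1
  have key : ∀ L : (T → ℝ × ℝ) →L[ℝ] ℝ, ∃ v : ℝ≥0, (P.map (sample X1 X2 T)).map L = gaussianReal 0 v := by
    intro L
    obtain ⟨v1, h1⟩ := GaussProc.map_sum hX1 (fun s : T => (s : ℝ)) fun s => L (Pi.single s (1, 0))
    obtain ⟨v2, h2⟩ := GaussProc.map_sum hX2 (fun s : T => (s : ℝ)) fun s => L (Pi.single s (0, 1))
    have h := gaussianReal_add_gaussianReal_of_indepFun (IndepProcesses.sum hI _ _ _) h1 h2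
    rw [add_zero] at h
    refine ⟨v1 + v2, ?_⟩
    rw [Measure.map_map (by fun_prop) hm, ← h]
    congr 1
    funext ω
    exact clm_sample L ω
  refine ⟨isGaussian_of_map_eq_gaussianReal fun L => ⟨0, key L⟩, fun L => ?_⟩
  obtain ⟨v, hv⟩ := key L
  have e : ∫ z, L z ∂P.map (sample X1 X2 T) = ∫ x, x ∂(P.map (sample X1 X2 T)).map L := by
    rw [integral_map (φ := L) (by fun_prop) (by fun_prop)]
  rw [e, hv, integral_id_gaussianReal]

theorem planar_sample (T : Finset ℝ) : Planar (P.map (sample X1 X2 T)) (evAt T) T := by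
  have hg := cgauss_sample hX1 hX2 hI T
  refine ⟨hg, fun s hs r hr w => ?_⟩
  have hm := measurable_sample (T := T) hX1.1 hX2.1
  have key : ∀ w', dotL w' (evAt T s (cvec (P.map (sample X1 X2 T)) ((dotL w).comp (evAt T r)))) =
      cov6 s r * dot w' w := by
    intro w'
    have h := apply_cvec hg ((dotL w).comp (evAt T r)) ((dotL w').comp (evAt T s))
    rw [integral_map hm.aemeasurable (by fun_prop)] at h
    simp only [ContinuousLinearMap.comp_apply] at h
    rw [h]
    simp only [evAt_sample X1 X2 hr, evAt_sample X1 X2 hs, dotL_apply, dot, smul_eq_mul]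
    have i11 : Integrable (fun ω => w.1 * w'.1 * (X1 s * X1 r) ω) P :=
      ((GaussProc.memLp hX1 s).integrable_mul (GaussProc.memLp hX1 r)).const_mul (w.1 * w'.1)
    have i22 : Integrable (fun ω => w.2 * w'.2 * (X2 s * X2 r) ω) P :=
      ((GaussProc.memLp hX2 s).integrable_mul (GaussProc.memLp hX2 r)).const_mul (w.2 * w'.2)
    have i12 : Integrable (fun ω => w.2 * w'.1 * (X1 s * X2 r) ω) P :=
      ((GaussProc.memLp hX1 s).integrable_mul (GaussProc.memLp hX2 r)).const_mul (w.2 * w'.1)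
    have i21 : Integrable (fun ω => w.1 * w'.2 * (X1 r * X2 s) ω) P :=
      ((GaussProc.memLp hX1 r).integrable_mul (GaussProc.memLp hX2 s)).const_mul (w.1 * w'.2)
    have j1 : Integrable (fun ω => w.1 * w'.1 * (X1 s * X1 r) ω + w.2 * w'.2 * (X2 s * X2 r) ω) P :=
      i11.add i22
    have j2 : Integrable (fun ω => w.2 * w'.1 * (X1 s * X2 r) ω + w.1 * w'.2 * (X1 r * X2 s) ω) P :=
      i12.add i21
    have e : ∀ ω, (w.1 * X1 r ω + w.2 * X2 r ω) * (w'.1 * X1 s ω + w'.2 * X2 s ω) =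
        (w.1 * w'.1 * (X1 s * X1 r) ω + w.2 * w'.2 * (X2 s * X2 r) ω) +
          (w.2 * w'.1 * (X1 s * X2 r) ω + w.1 * w'.2 * (X1 r * X2 s) ω) := fun ω => by
      simp only [Pi.mul_apply]; ring
    simp only [e]
    rw [integral_add j1 j2, integral_add i11 i22, integral_add i12 i21,
      integral_const_mul, integral_const_mul, integral_const_mul, integral_const_mul]
    simp only [Pi.mul_apply]
    rw [GaussProc.integral_mul hX1, GaussProc.integral_mul hX2, integral_mul_eq_zero hX1 hX2 hI,
      integral_mul_eq_zero hX1 hX2 hI]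
    ring
  have k1 := key (1, 0)
  have k2 := key (0, 1)
  simp only [dotL_apply, dot, one_mul, zero_mul, add_zero, zero_add] at k1 k2
  exact Prod.ext k1 k2

end Law

/-- Size of the correlations between increments on a grid of mesh `δ`. -/
def corrSize (δ : ℝ) : ℝ := corrScale * δ ^ (1 / 3 : ℝ)

/-- The index of the block of the partition `a 0 ≤ ⋯ ≤ a K` which contains `j`. -/
def anchor (a : ℕ → ℕ) (K j : ℕ) : ℕ := Nat.findGreatest (fun k => a k ≤ j) K

lemma anchor_eq {a : ℕ → ℕ} (ha : Monotone a) {K k j : ℕ} (hk : k < K) (hj : j ∈ Finset.Ico (a k) (a (k + 1))) :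
    anchor a K j = k := by
  rw [Finset.mem_Ico] at hj
  rw [anchor, Nat.findGreatest_eq_iff]
  refine ⟨hk.le, fun _ => hj.1, fun n hn _ hle => ?_⟩
  exact absurd (hj.2.trans_le ((ha hn).trans hle)) (lt_irrefl _)

lemma anchor_spec {a : ℕ → ℕ} (h0 : a 0 = 0) {K j : ℕ} (hj : j < a K) :
    anchor a K j < K ∧ a (anchor a K j) ≤ j ∧ j < a (anchor a K j + 1) := by
  have h1 : a (anchor a K j) ≤ j :=
    Nat.findGreatest_spec (P := fun k => a k ≤ j) (Nat.zero_le K) (by rw [h0]; exact Nat.zero_le j)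
  have h2 : anchor a K j < K := by
    refine lt_of_le_of_ne (Nat.findGreatest_le K) fun h => ?_
    rw [h] at h1; omega
  refine ⟨h2, h1, ?_⟩
  by_contra! h
  have := Nat.le_findGreatest (P := fun k => a k ≤ j) (Nat.succ_le_of_lt h2) h
  simp only [anchor] at *
  omega

lemma sum_range_eq_sum_blocks {a : ℕ → ℕ} (ha : Monotone a) (h0 : a 0 = 0) (K : ℕ) (F : ℕ → ℝ) :
    ∑ j ∈ Finset.range (a K), F j = ∑ k : Fin K, ∑ j ∈ Finset.Ico (a k) (a (k + 1)), F j := by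
  rw [Fin.sum_univ_eq_sum_range fun k => ∑ j ∈ Finset.Ico (a k) (a (k + 1)), F j]
  induction K with
  | zero => simp [h0]
  | succ K ih =>
    rw [Finset.sum_range_succ, ← ih, Finset.range_eq_Ico, Finset.range_eq_Ico,
      Finset.sum_Ico_consecutive _ (Nat.zero_le _) (ha (Nat.le_succ K))]

section FineGrid
variable {E : Type*} [NormedAddCommGroup E] [NormedSpace ℝ E] [MeasurableSpace E]

/-- A planar Gaussian process sampled on a sufficiently fine grid of `[0, t]`. -/
structure FineGrid (μ : Measure E) (ev : ℝ → E →L[ℝ] ℝ × ℝ) (T : Set ℝ) (δ : ℝ) (N : ℕ) (t : ℝ) : Prop where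
  planar : Planar μ ev T
  pos : 0 < δ
  mem : ∀ j ≤ N, (j : ℝ) * δ ∈ T
  le : N * δ ≤ t
  small : corrSize δ ≤ 1

variable {μ : Measure E} {ev : ℝ → E →L[ℝ] ℝ × ℝ} {T : Set ℝ}
  {δ t : ℝ} {N : ℕ}

namespace FineGrid

lemma corrSize_pos (h : FineGrid μ ev T δ N t) : 0 < corrSize δ := by
  have := h.pos
  have := five_le_corrScale
  unfold corrSize; positivity

lemma t_nonneg (h : FineGrid μ ev T δ N t) : 0 ≤ t := by
  have := h.pos
  exact le_trans (by positivity) h.le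

variable [BorelSpace E] [FiniteDimensional ℝ E]

lemma weak (h : FineGrid μ ev T δ N t) : WeakCorr μ (Finset.univ ×ˢ Finset.range N) (xi (gridPath ev δ))
    (fun _ => (0 : E →L[ℝ] ℝ)) (corrSize δ) (weakConst t) :=
  h.planar.weak h.pos h.mem h.le h.small

lemma norm_ev_cvec_le (h : FineGrid μ ev T δ N t) {s : ℝ} (hs : s ∈ T) {i : Fin 6 × ℕ} (hi : i.2 < N) :
    ‖ev s (cvec μ (xi (gridPath ev δ) i))‖ ≤ corrSize δ := by
  have h1 := h.planar.norm_ev_cvec_le' hs h.pos.le i (h.mem _ hi.le) (h.mem _ hi)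
  have hp := h.pos
  have hv : 0 ≤ δ ^ (1 / 3 : ℝ) := by positivity
  have := five_le_corrScale
  unfold corrSize
  nlinarith

lemma sum_norm_ev_cvec_le (h : FineGrid μ ev T δ N t) {s : ℝ} (hs : s ∈ T) :
    ∑ i ∈ Finset.univ ×ˢ Finset.range N, ‖ev s (cvec μ (xi (gridPath ev δ) i))‖ ≤ weakConst t :=
  (h.planar.sum_norm_ev_cvec_le hs h.pos.le h.mem h.le).trans (le_weakConst h.t_nonneg)

/-- Midpoints paired with the anchors of their blocks. -/
lemma weak_anchor (h : FineGrid μ ev T δ N t) {K : ℕ} {a : ℕ → ℕ} {τ : ℕ → ℝ} (h0 : a 0 = 0)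
    (hN : a K = N) (hτ : ∀ k < K, τ k ∈ T) :
    WeakCorr μ (Finset.univ ×ˢ Finset.range N) (xi (gridPath ev δ))
      (fun i => (mid (gridPath ev δ) i.2).prod (ev (τ (anchor a K i.2)))) (corrSize δ)
      ((K + 2) * weakConst t) := by
  have hw := h.weak
  have hC := hw.one_le
  have hC' := le_weakConst h.t_nonneg
  have hmem : ∀ i ∈ Finset.univ (α := Fin 6) ×ˢ Finset.range N, i.2 < N := fun i hi => by simpa using hi
  have hanc : ∀ j < N, anchor a K j < K := fun j hj => (anchor_spec h0 (hN ▸ hj)).1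
  have hle : weakConst t ≤ (K + 2) * weakConst t := by
    have : (0 : ℝ) ≤ K := by positivity
    nlinarith
  have hprod : ∀ (j : ℕ) (r : ℝ) (x : E), ‖(mid (gridPath ev δ) j).prod (ev r) x‖ =
      max ‖mid (gridPath ev δ) j x‖ ‖ev r x‖ := fun j r x => rfl
  have hmax : ∀ (j : ℕ) (r : ℝ) (x : E), ‖(mid (gridPath ev δ) j).prod (ev r) x‖ ≤
      ‖mid (gridPath ev δ) j x‖ + ‖ev r x‖ := fun j r x => by
    rw [hprod]; exact max_le_add_of_nonneg (norm_nonneg _) (norm_nonneg _)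
  refine ⟨hw.pos, hw.le_one, hC.trans hle, hw.card_le.trans hle, hw.corr_le, fun i hi => ?_,
    fun i hi j hj => ?_, fun j hj => ?_, ?_⟩
  · exact (hw.corr_sum i hi).trans (mul_le_mul_of_nonneg_right hle hw.pos.le)
  · rw [hprod]
    exact max_le (h.planar.cross_mid_le h.pos.le h.mem i (hmem i hi) (hmem j hj))
      (h.norm_ev_cvec_le (hτ _ (hanc _ (hmem j hj))) (hmem i hi))
  · refine (Finset.sum_le_sum fun i _ => hmax _ _ _).trans ?_
    rw [Finset.sum_add_distrib]
    have h1 := h.planar.sum_cross_mid_le h.pos.le h.mem h.le (hmem j hj)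
    have h2 := h.sum_norm_ev_cvec_le (hτ _ (hanc _ (hmem j hj)))
    have : (0 : ℝ) ≤ K := by positivity
    nlinarith
  · have h1 : ∀ i ∈ Finset.univ (α := Fin 6) ×ˢ Finset.range N,
        ‖(mid (gridPath ev δ) i.2).prod (ev (τ (anchor a K i.2))) (cvec μ (xi (gridPath ev δ) i))‖ ≤
        ‖mid (gridPath ev δ) i.2 (cvec μ (xi (gridPath ev δ) i))‖ +
          ∑ k ∈ Finset.range K, ‖ev (τ k) (cvec μ (xi (gridPath ev δ) i))‖ := fun i hi =>
      (hmax _ _ _).trans (add_le_add_right (Finset.single_le_sum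
        (f := fun k => ‖ev (τ k) (cvec μ (xi (gridPath ev δ) i))‖) (fun _ _ => norm_nonneg _)
        (Finset.mem_range.2 (hanc _ (hmem i hi)))) _)
    refine (Finset.sum_le_sum h1).trans ?_
    rw [Finset.sum_add_distrib, Finset.sum_comm]
    have h2 := h.planar.sum_norm_mid_diag_le h.pos.le h.mem h.le
    have h3 : ∑ k ∈ Finset.range K, ∑ i ∈ Finset.univ ×ˢ Finset.range N,
        ‖ev (τ k) (cvec μ (xi (gridPath ev δ) i))‖ ≤ K * weakConst t := by
      calc _ ≤ ∑ _k ∈ Finset.range K, weakConst t :=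
            Finset.sum_le_sum fun k hk => h.sum_norm_ev_cvec_le (hτ k (Finset.mem_range.1 hk))
        _ = _ := by simp
    nlinarith

lemma integral_sq_mid_sub_le (h : FineGrid μ ev T δ N t) {s r : ℝ} (hs : s ∈ T) {j : ℕ} (hj : j < N)
    (h1 : |j * δ - s| ≤ r) (h2 : |(j + 1 : ℕ) * δ - s| ≤ r) :
    LeOne μ (fun z => ‖mid (gridPath ev δ) j z - ev s z‖ ^ 2) (2 * cbrt r) := by
  have := h.planar.gauss.gauss
  have hc : ∀ x, |x| ≤ r → |cbrt x| ≤ cbrt r := fun x hx => by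
    rw [abs_le] at hx ⊢
    rw [← cbrt_neg]
    exact ⟨cbrt_mono hx.1, cbrt_mono hx.2⟩
  have l1 := (h.planar.integral_sq_norm_le (h.mem j hj.le) hs).const_mul (1 / 2)
  have l2 := (h.planar.integral_sq_norm_le (h.mem _ hj) hs).const_mul (1 / 2)
  have l3 := (l1.add l2).mono (b := 2 * cbrt r) (by
    rw [abs_of_pos (by norm_num : (0 : ℝ) < 1 / 2)]
    linarith [hc _ h1, hc _ h2])
  refine l3.of_abs_le (by fun_prop) fun z => ?_
  rw [abs_of_nonneg (by positivity)]
  have e : mid (gridPath ev δ) j z - ev s z =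
      (1 / 2 : ℝ) • ((ev (j * δ) z - ev s z) + (ev ((j + 1 : ℕ) * δ) z - ev s z)) := by
    simp only [mid, gridPath, smul_apply, add_apply]
    module
  rw [e, norm_smul, Real.norm_eq_abs, abs_of_pos (by norm_num : (0 : ℝ) < 1 / 2), mul_pow]
  have h3 := norm_add_le (ev (j * δ) z - ev s z) (ev ((j + 1 : ℕ) * δ) z - ev s z)
  have h4 : ‖(ev (j * δ) z - ev s z) + (ev ((j + 1 : ℕ) * δ) z - ev s z)‖ ^ 2 ≤
      (‖ev (j * δ) z - ev s z‖ + ‖ev ((j + 1 : ℕ) * δ) z - ev s z‖) ^ 2 := by gcongr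
  nlinarith [sq_nonneg (‖ev (j * δ) z - ev s z‖ - ‖ev ((j + 1 : ℕ) * δ) z - ev s z‖)]

end FineGrid
end FineGrid

/-- Replacing the weights of the cubic variation by their values at the anchors. -/
lemma exists_anchor_bound {γ : ℝ × ℝ → ℝ} (hγ : Cb γ) (t : ℝ) :
    ∃ A : ℝ, 0 ≤ A ∧ ∀ K : ℕ, ∃ B : ℝ, 0 ≤ B ∧ ∀ {E : Type} [NormedAddCommGroup E] [NormedSpace ℝ E]
      [MeasurableSpace E] [BorelSpace E] [FiniteDimensional ℝ E] {μ : Measure E}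
      {ev : ℝ → E →L[ℝ] ℝ × ℝ} {T : Set ℝ} {δ r : ℝ} {N : ℕ} {a : ℕ → ℕ} {τ : ℕ → ℝ}
      (_ : FineGrid μ ev T δ N t) (_ : a 0 = 0) (_ : a K = N) (_ : ∀ k < K, τ k ∈ T) (_ : 0 ≤ r)
      (_ : ∀ j < N, |j * δ - τ (anchor a K j)| ≤ r ∧ |(j + 1 : ℕ) * δ - τ (anchor a K j)| ≤ r) (u : Fin 6),
      LeOne μ (fun z => ∑ j ∈ Finset.range N, (γ (mid (gridPath ev δ) j z) - γ (ev (τ (anchor a K j)) z)) *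
        gh μ 3 (xi (gridPath ev δ) (u, j)) z) (√(A * cbrt r + B * corrSize δ)) := by
  obtain ⟨M, hM, hLip⟩ := hγ.lipschitz
  set γ' : (ℝ × ℝ) × (ℝ × ℝ) → ℝ := fun p => γ p.1 - γ p.2 with hγ'def
  have hfst : Cb fun p : (ℝ × ℝ) × (ℝ × ℝ) => γ p.1 :=
    hγ.comp_clm (ContinuousLinearMap.fst ℝ (ℝ × ℝ) (ℝ × ℝ))
  have hsnd : Cb fun p : (ℝ × ℝ) × (ℝ × ℝ) => γ p.2 :=
    hγ.comp_clm (ContinuousLinearMap.snd ℝ (ℝ × ℝ) (ℝ × ℝ))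
  have hγ' : Cb γ' := hfst.sub hsnd
  refine ⟨6 * weakConst t ^ 2 * (M ^ 2 * 2), by positivity, fun K => ?_⟩
  obtain ⟨B, hB, hbd⟩ := exists_weighted_three_bound hγ' ((K + 2) * weakConst t)
  refine ⟨B, hB, ?_⟩
  intro E _ _ _ _ _ μ ev T δ r N a τ h h0 hN hτ hr hdist u
  have := h.planar.gauss.gauss
  have hsub : ({u} : Finset (Fin 6)) ×ˢ Finset.range N ⊆ Finset.univ ×ˢ Finset.range N :=
    Finset.product_subset_product_left (Finset.subset_univ _)
  have hcr : 0 ≤ cbrt r := by rw [cbrt_of_nonneg hr]; positivity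
  have hb := hbd h.planar.gauss ((h.weak_anchor h0 hN hτ).mono hsub) (h.weak.mono hsub)
    (w := M ^ 2 * (2 * cbrt r)) (by positivity) (fun i hi => by
      have hi : i.2 < N := by simpa using (Finset.mem_product.1 hi).2
      have hl := (h.integral_sq_mid_sub_le (hτ _ (anchor_spec h0 (hN ▸ hi)).1) hi
        (hdist _ hi).1 (hdist _ hi).2).const_mul (M ^ 2)
      rw [abs_of_nonneg (by positivity)] at hl
      refine le_trans (integral_mono (integrable_of_temperate ?_) hl.int fun z => ?_)
        ((integral_mono hl.int hl.int.abs fun z => le_abs_self _).trans hl.le)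
      · exact (hγ'.comp_clm _).temperate.pow 2
      · have h1 := hLip (mid (gridPath ev δ) i.2 z) (ev (τ (anchor a K i.2)) z)
        rw [Real.norm_eq_abs] at h1
        calc γ' _ ^ 2 = |γ (mid (gridPath ev δ) i.2 z) - γ (ev (τ (anchor a K i.2)) z)| ^ 2 := (sq_abs _).symm
          _ ≤ (M * ‖mid (gridPath ev δ) i.2 z - ev (τ (anchor a K i.2)) z‖) ^ 2 := by gcongr
          _ = _ := by ring)
  simp only [Finset.sum_product, Finset.sum_singleton] at hb
  have ht : (fun z => ∑ j ∈ Finset.range N, (γ (mid (gridPath ev δ) j z) - γ (ev (τ (anchor a K j)) z)) *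
        gh μ 3 (xi (gridPath ev δ) (u, j)) z).HasTemperateGrowth :=
    Function.HasTemperateGrowth.sum fun j _ => ((hγ'.comp_clm
      ((mid (gridPath ev δ) j).prod (ev (τ (anchor a K j))))).temperate).mul (gh_temperate 3 _)
  have hκ := h.corrSize_pos
  refine LeOne.of_sq ht.1.continuous.aestronglyMeasurable (integrable_of_temperate (ht.pow 2))
    (Real.sqrt_nonneg _) ?_
  rw [Real.sq_sqrt (by positivity)]
  refine hb.trans (le_of_eq ?_)
  ring

/-- The cubic sum with its weights frozen at the left ends `τ k` of the blocks of the partition `a`. -/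
def anchoredSum {E : Type*} [NormedAddCommGroup E] [NormedSpace ℝ E] [MeasurableSpace E] (μ : Measure E)
    (ev : ℝ → E →L[ℝ] ℝ × ℝ) (δ : ℝ) (N : ℕ) (g : ℝ × ℝ → ℝ) (a : ℕ → ℕ) (K : ℕ) (τ : ℕ → ℝ) (z : E) : ℝ :=
  ∑ u, ∑ j ∈ Finset.range N,
    wtThree g u (ev (τ (anchor a K j)) z) * gh μ 3 (xi (gridPath ev δ) (u, j)) z

/-- The sum of the cubed correlations. -/
def cubeRho : ℝ := ∑' r : ℤ, rho6 r ^ 3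

/-- The density of the limiting conditional variance. -/
def varDensity (g : ℝ × ℝ → ℝ) (z : ℝ × ℝ) : ℝ :=
  cubeRho / 96 * pdv 3 0 g z ^ 2 + cubeRho / 96 * pdv 0 3 g z ^ 2 +
    cubeRho / 32 * pdv 1 2 g z ^ 2 + cubeRho / 32 * pdv 2 1 g z ^ 2

/-- Covariance of the block sums of third Hermite polynomials. -/
def blockCov (δ : ℝ) (a : ℕ → ℕ) (k k' : ℕ) : ℝ :=
  δ * ∑ i ∈ Finset.Ico (a k) (a (k + 1)), ∑ j ∈ Finset.Ico (a k') (a (k' + 1)), rho6 ((j : ℤ) - i) ^ 3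

lemma WeakCorr.mono_const {E V ι : Type*} [NormedAddCommGroup E] [NormedSpace ℝ E] [NormedAddCommGroup V]
    [NormedSpace ℝ V] [MeasurableSpace E] {μ : Measure E} {J : Finset ι} {ξ : ι → E →L[ℝ] ℝ}
    {Λ : ι → E →L[ℝ] V} {κ C C' : ℝ} (h : WeakCorr μ J ξ Λ κ C) (hC : C ≤ C') : WeakCorr μ J ξ Λ κ C' where
  pos := h.pos
  le_one := h.le_one
  one_le := h.one_le.trans hC
  card_le := h.card_le.trans hC
  corr_le := h.corr_le
  corr_sum i hi := (h.corr_sum i hi).trans (mul_le_mul_of_nonneg_right hC h.pos.le)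
  cross_le := h.cross_le
  cross_sum j hj := (h.cross_sum j hj).trans hC
  diag_sum := h.diag_sum.trans hC

/-- The blocks of indices entering the anchored sum. -/
def block (a : ℕ → ℕ) {K : ℕ} (b : Fin K × Fin 6) : Finset (Fin 6 × ℕ) :=
  {b.2} ×ˢ Finset.Ico (a b.1) (a (b.1 + 1))

lemma sum_block {M : Type*} [AddCommMonoid M] (a : ℕ → ℕ) {K : ℕ} (b : Fin K × Fin 6) (F : Fin 6 × ℕ → M) :
    ∑ i ∈ block a b, F i = ∑ j ∈ Finset.Ico (a b.1) (a (b.1 + 1)), F (b.2, j) := by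
  rw [block, Finset.sum_product, Finset.sum_singleton]

/-- Evaluation at the test times, at the final time, and at the anchors. -/
def testMap {E : Type*} [NormedAddCommGroup E] [NormedSpace ℝ E] (ev : ℝ → E →L[ℝ] ℝ × ℝ) {m : ℕ}
    (s : Fin m → ℝ) (t : ℝ) (K : ℕ) (τ : ℕ → ℝ) :
    E →L[ℝ] (Fin m → ℝ × ℝ) × (ℝ × ℝ) × (Fin K → ℝ × ℝ) :=
  (ContinuousLinearMap.pi fun i => ev (s i)).prod
    ((ev t).prod (ContinuousLinearMap.pi fun k => ev (τ k)))

lemma norm_pi_le_sum {ι : Type*} [Fintype ι] (f : ι → ℝ × ℝ) : ‖f‖ ≤ ∑ i, ‖f i‖ :=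
  (pi_norm_le_iff_of_nonneg (Finset.sum_nonneg fun _ _ => norm_nonneg _)).2 fun i =>
    Finset.single_le_sum (f := fun i => ‖f i‖) (fun _ _ => norm_nonneg _) (Finset.mem_univ i)

lemma norm_testMap_le {E : Type*} [NormedAddCommGroup E] [NormedSpace ℝ E] (ev : ℝ → E →L[ℝ] ℝ × ℝ) {m : ℕ}
    (s : Fin m → ℝ) (t : ℝ) (K : ℕ) (τ : ℕ → ℝ) (x : E) :
    ‖testMap ev s t K τ x‖ ≤ ∑ i, ‖ev (s i) x‖ + (‖ev t x‖ + ∑ k : Fin K, ‖ev (τ k) x‖) := by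
  have h1 := norm_pi_le_sum fun i => ev (s i) x
  have h2 := norm_pi_le_sum fun k : Fin K => ev (τ k) x
  have e1 : 0 ≤ ∑ i, ‖ev (s i) x‖ := Finset.sum_nonneg fun _ _ => norm_nonneg _
  have e2 : 0 ≤ ∑ k : Fin K, ‖ev (τ k) x‖ := Finset.sum_nonneg fun _ _ => norm_nonneg _
  have e3 := norm_nonneg (ev t x)
  refine max_le ?_ (max_le ?_ ?_)
  · exact h1.trans (by linarith)
  · show ‖ev t x‖ ≤ _
    linarith
  · exact h2.trans (by linarith)

lemma Cb.cexp {V : Type*} [NormedAddCommGroup V] [NormedSpace ℝ V] {g : V → ℝ} (hg : Cb g) :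
    Cb fun x => Complex.exp ((g x : ℂ) * Complex.I) := by
  refine ⟨cb_exp_mul_I.1.comp hg.1, fun k => ?_⟩
  obtain ⟨M, hM0, hM⟩ := hg.uniform k
  obtain ⟨M', hM0', hM'⟩ := cb_exp_mul_I.uniform k
  refine ⟨k.factorial * M' * (M + 1) ^ k, fun x => ?_⟩
  refine norm_iteratedFDeriv_comp_le cb_exp_mul_I.1 hg.1 (by exact_mod_cast le_top) x
    (fun i hi => hM' i hi _) fun i h1 hi => (hM i hi x).trans ?_
  exact (le_add_of_nonneg_right zero_le_one).trans (le_self_pow₀ (by linarith) (by omega))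

lemma sum_xi_cvec_eq {E : Type*} [NormedAddCommGroup E] [NormedSpace ℝ E] [MeasurableSpace E]
    [BorelSpace E] [FiniteDimensional ℝ E]
    {μ : Measure E} {ev : ℝ → E →L[ℝ] ℝ × ℝ} {T : Set ℝ} {δ t : ℝ} {N : ℕ} (h : FineGrid μ ev T δ N t)
    {a : ℕ → ℕ} (ha : Monotone a) {K : ℕ} (hK : a K = N) (b b' : Fin K × Fin 6) :
    ∑ i ∈ block a b, ∑ j ∈ block a b', xi (gridPath ev δ) j (cvec μ (xi (gridPath ev δ) i)) ^ 3 =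
      dot (dir b.2) (dir b'.2) ^ 3 * blockCov δ a b.1 b'.1 := by
  have hlt : ∀ (k : Fin K), ∀ j ∈ Finset.Ico (a k) (a (k + 1)), j < N := fun k j hj =>
    (Finset.mem_Ico.1 hj).2.trans_le (hK ▸ ha (Nat.succ_le_of_lt k.2))
  simp only [sum_block]
  rw [blockCov, Finset.mul_sum, Finset.mul_sum]
  refine Finset.sum_congr rfl fun i hi => ?_
  rw [Finset.mul_sum, Finset.mul_sum]
  refine Finset.sum_congr rfl fun j hj => ?_
  rw [h.planar.xi_cvec h.pos.le h.mem (b.2, i) (b'.2, j) (hlt _ i hi) (hlt _ j hj), mul_pow, mul_pow,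
    rpow_third_pow h.pos.le]
  have : dot (dir b'.2) (dir b.2) = dot (dir b.2) (dir b'.2) := by simp only [dot]; ring
  rw [this]

lemma anchoredSum_eq_sum_block {E : Type*} [NormedAddCommGroup E] [NormedSpace ℝ E] [MeasurableSpace E]
    (μ : Measure E) (ev : ℝ → E →L[ℝ] ℝ × ℝ) (δ : ℝ) (g : ℝ × ℝ → ℝ) {a : ℕ → ℕ} (ha : Monotone a)
    (h0 : a 0 = 0) (K : ℕ) (τ : ℕ → ℝ) (z : E) :
    anchoredSum μ ev δ (a K) g a K τ z =
      ∑ b : Fin K × Fin 6, wtThree g b.2 (ev (τ b.1) z) * hsum μ (xi (gridPath ev δ)) (block a b) z := by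
  rw [Fintype.sum_prod_type_right, anchoredSum]
  refine Finset.sum_congr rfl fun u _ => ?_
  rw [sum_range_eq_sum_blocks ha h0]
  refine Finset.sum_congr rfl fun k _ => ?_
  rw [hsum, sum_block, Finset.mul_sum]
  exact Finset.sum_congr rfl fun j hj => by rw [anchor_eq ha k.2 hj]

lemma sum_varDensity (g : ℝ × ℝ → ℝ) (K : ℕ) (lam c : ℝ) (y : Fin K → ℝ × ℝ) :
    -1 / 2 * ∑ b : Fin K × Fin 6, ∑ b' : Fin K × Fin 6,
      (-(lam / 24) * wtThree g b.2 (y b.1)) * (-(lam / 24) * wtThree g b'.2 (y b'.1)) *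
        (if b.1 = b'.1 then 6 * dot (dir b.2) (dir b'.2) ^ 3 * (c * cubeRho) else 0) =
      -(lam ^ 2 / 2) * ∑ k, c * varDensity g (y k) := by
  have key : ∀ k, ∑ u, ∑ u', (-(lam / 24) * wtThree g u (y k)) * (-(lam / 24) * wtThree g u' (y k)) *
      (6 * dot (dir u) (dir u') ^ 3 * (c * cubeRho)) = lam ^ 2 * (c * varDensity g (y k)) := fun k => by
    have e : ∀ u u', (-(lam / 24) * wtThree g u (y k)) * (-(lam / 24) * wtThree g u' (y k)) *
        (6 * dot (dir u) (dir u') ^ 3 * (c * cubeRho)) = lam ^ 2 * c * cubeRho / 96 *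
          (wtThree g u (y k) * wtThree g u' (y k) * dot (dir u) (dir u') ^ 3) := fun u u' => by ring
    simp only [e, ← Finset.mul_sum]
    rw [sum_wtThree_sq, varDensity]
    ring
  have e1 : ∀ (k : Fin K) (u : Fin 6), ∑ b' : Fin K × Fin 6,
      (-(lam / 24) * wtThree g u (y k)) * (-(lam / 24) * wtThree g b'.2 (y b'.1)) *
        (if k = b'.1 then 6 * dot (dir u) (dir b'.2) ^ 3 * (c * cubeRho) else 0) =
      ∑ u', (-(lam / 24) * wtThree g u (y k)) * (-(lam / 24) * wtThree g u' (y k)) *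
        (6 * dot (dir u) (dir u') ^ 3 * (c * cubeRho)) := fun k u => by
    rw [Fintype.sum_prod_type_right]
    refine Finset.sum_congr rfl fun u' _ => ?_
    simp
  rw [Fintype.sum_prod_type]
  simp only [e1, key]
  rw [← Finset.mul_sum]
  ring

/-- Conditional central limit theorem for the anchored sums. -/
theorem exists_block_bound {m : ℕ} {ψ : (Fin m → ℝ × ℝ) → ℝ} (hψ : Cb ψ) {g : ℝ × ℝ → ℝ} (hg : Cb g)
    (lam : ℝ) {t : ℝ} (ht : 0 ≤ t) (K : ℕ) :
    ∃ B : ℝ, 0 ≤ B ∧ ∀ {E : Type} [NormedAddCommGroup E] [NormedSpace ℝ E] [MeasurableSpace E]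
      [BorelSpace E] [FiniteDimensional ℝ E] {μ : Measure E} {ev : ℝ → E →L[ℝ] ℝ × ℝ} {T : Set ℝ}
      {δ : ℝ} {N : ℕ} {a : ℕ → ℕ} {τ : ℕ → ℝ} {s : Fin m → ℝ} (_ : FineGrid μ ev T δ N t)
      (_ : Monotone a) (_ : a 0 = 0) (_ : a K = N) (_ : ∀ i, s i ∈ T) (_ : t ∈ T)
      (_ : ∀ k < K, τ k ∈ T) {η : ℝ} (_ : 0 ≤ η)
      (_ : ∀ k < K, ∀ k' < K, |blockCov δ a k k' - if k = k' then t / K * cubeRho else 0| ≤ η),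
      ‖∫ z, (ψ (fun i => ev (s i) z) : ℂ) * Complex.exp ((lam * (g (ev t z) - g 0 -
          1 / 24 * anchoredSum μ ev δ N g a K τ z) : ℝ) * Complex.I) ∂μ -
        ∫ z, (ψ (fun i => ev (s i) z) : ℂ) * Complex.exp ((lam * (g (ev t z) - g 0) : ℝ) * Complex.I) *
          (Real.exp (-(lam ^ 2 / 2) * ∑ k : Fin K, t / K * varDensity g (ev (τ k) z)) : ℝ) ∂μ‖ ≤
        B * (corrSize δ + η) := by
  let V := (Fin m → ℝ × ℝ) × (ℝ × ℝ) × (Fin K → ℝ × ℝ)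
  have h1 : Cb fun y : V => ψ y.1 := hψ.comp_clm (ContinuousLinearMap.fst ℝ (Fin m → ℝ × ℝ) ((ℝ × ℝ) × (Fin K → ℝ × ℝ)))
  have h2 : Cb fun y : V => g y.2.1 :=
    hg.comp_clm ((ContinuousLinearMap.fst ℝ (ℝ × ℝ) (Fin K → ℝ × ℝ)).comp (ContinuousLinearMap.snd ℝ (Fin m → ℝ × ℝ) ((ℝ × ℝ) × (Fin K → ℝ × ℝ))))
  have h3 : Cb fun y : V => lam * (g y.2.1 - g 0) := (h2.sub (Cb.const (g 0))).const_mul lam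
  have hΨ : Cb fun y : V => (ψ y.1 : ℂ) * Complex.exp ((lam * (g y.2.1 - g 0) : ℝ) * Complex.I) :=
    h1.ofReal.mul h3.cexp
  have hθ : ∀ b : Fin K × Fin 6, Cb fun y : V => -(lam / 24) * wtThree g b.2 (y.2.2 b.1) := fun b => by
    have : Cb fun y : V => wtThree g b.2 (y.2.2 b.1) := (cb_wtThree hg b.2).comp_clm
      ((ContinuousLinearMap.proj (R := ℝ) (φ := fun _ : Fin K => ℝ × ℝ) b.1).comp
        ((ContinuousLinearMap.snd ℝ (ℝ × ℝ) (Fin K → ℝ × ℝ)).comp (ContinuousLinearMap.snd ℝ (Fin m → ℝ × ℝ) ((ℝ × ℝ) × (Fin K → ℝ × ℝ)))))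
    exact this.const_mul _
  obtain ⟨B, hB0, hB⟩ := exists_clt_bound hΨ hθ (fun b b' =>
    if b.1 = b'.1 then 6 * dot (dir b.2) (dir b'.2) ^ 3 * (t / K * cubeRho) else 0)
    ((m + K + 1) * weakConst t)
  refine ⟨B * 750, by positivity, ?_⟩
  intro E _ _ _ _ _ μ ev T δ N a τ s h ha h0 hK hs htT hτ η hη hcov
  have hC : 0 ≤ weakConst t := by linarith [le_weakConst ht]
  have hsub : ∀ b : Fin K × Fin 6, block a b ⊆ Finset.univ ×ˢ Finset.range N := fun b => by
    refine Finset.product_subset_product (Finset.subset_univ _) fun j hj => ?_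
    rw [Finset.mem_range, ← hK]
    exact (Finset.mem_Ico.1 hj).2.trans_le (ha (Nat.succ_le_of_lt b.1.2))
  have key := hB h.planar.gauss (h.weak.mono_const (C' := (m + K + 1) * weakConst t) (by
    have : (0 : ℝ) ≤ m + K := by positivity
    nlinarith)) hsub (L := testMap ev s t K τ) (fun b => ?_) (η := 750 * η) (fun b b' => ?_)
  · have e1 : ∀ z, phase μ (xi (gridPath ev δ)) (testMap ev s t K τ) (block a)
        (fun b y => -(lam / 24) * wtThree g b.2 (y.2.2 b.1)) z =
        -(lam / 24) * anchoredSum μ ev δ N g a K τ z := fun z => by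
      rw [← hK, anchoredSum_eq_sum_block μ ev δ g ha h0, phase, Finset.mul_sum]
      exact Finset.sum_congr rfl fun b _ => mul_assoc _ _ _
    have e2 : ∀ z, (ψ (testMap ev s t K τ z).1 : ℂ) *
        Complex.exp ((lam * (g (testMap ev s t K τ z).2.1 - g 0) : ℝ) * Complex.I) *
        Complex.exp ((-(lam / 24) * anchoredSum μ ev δ N g a K τ z : ℝ) * Complex.I) =
        (ψ (fun i => ev (s i) z) : ℂ) * Complex.exp ((lam * (g (ev t z) - g 0 -
          1 / 24 * anchoredSum μ ev δ N g a K τ z) : ℝ) * Complex.I) := fun z => by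
      rw [mul_assoc, ← Complex.exp_add, ← add_mul, ← Complex.ofReal_add]
      congr 4
      show lam * (g (ev t z) - g 0) + _ = _
      ring
    simp only [sum_varDensity g K lam (t / K)] at key
    refine (congrArg norm (congrArg₂ (· - ·) (integral_congr_ae (.of_forall fun z => ?_)) rfl)).trans_le
      (key.trans ?_)
    · refine (e2 z).symm.trans ?_
      rw [← e1 z]
    have := h.corrSize_pos
    nlinarith
  · calc _ ≤ ∑ i ∈ Finset.univ ×ˢ Finset.range N, ‖testMap ev s t K τ (cvec μ (xi (gridPath ev δ) i))‖ :=
          Finset.sum_le_sum_of_subset_of_nonneg (hsub b) fun _ _ _ => norm_nonneg _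
      _ ≤ ∑ i ∈ Finset.univ ×ˢ Finset.range N, (∑ l, ‖ev (s l) (cvec μ (xi (gridPath ev δ) i))‖ +
          (‖ev t (cvec μ (xi (gridPath ev δ) i))‖ +
            ∑ k : Fin K, ‖ev (τ k) (cvec μ (xi (gridPath ev δ) i))‖)) :=
          Finset.sum_le_sum fun i _ => norm_testMap_le ev s t K τ _
      _ ≤ ∑ l : Fin m, weakConst t + (weakConst t + ∑ k : Fin K, weakConst t) := by
          rw [Finset.sum_add_distrib, Finset.sum_add_distrib, Finset.sum_comm]
          refine add_le_add (Finset.sum_le_sum fun l _ => h.sum_norm_ev_cvec_le (hs l))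
            (add_le_add (h.sum_norm_ev_cvec_le htT) ?_)
          rw [Finset.sum_comm]
          exact Finset.sum_le_sum fun k _ => h.sum_norm_ev_cvec_le (hτ k k.2)
      _ = _ := by simp; ring
  · rw [sum_xi_cvec_eq h ha hK]
    have h5 : |6 * dot (dir b.2) (dir b'.2) ^ 3| ≤ 750 := by
      rw [abs_mul, abs_pow]
      have := pow_le_pow_left₀ (abs_nonneg _) (abs_dot_dir_le b.2 b'.2) 3
      norm_num at this ⊢
      linarith
    have e : 6 * (dot (dir b.2) (dir b'.2) ^ 3 * blockCov δ a b.1 b'.1) -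
        (if b.1 = b'.1 then 6 * dot (dir b.2) (dir b'.2) ^ 3 * (t / K * cubeRho) else 0) =
        6 * dot (dir b.2) (dir b'.2) ^ 3 *
          (blockCov δ a b.1 b'.1 - if (b.1 : ℕ) = b'.1 then t / K * cubeRho else 0) := by
      by_cases hb : b.1 = b'.1
      · simp only [hb, if_true]; ring
      · have hb' : (b.1 : ℕ) ≠ b'.1 := fun h => hb (Fin.ext h)
        simp only [hb, hb', if_false]; ring
    rw [e, abs_mul]
    exact mul_le_mul h5 (hcov _ b.1.2 _ b'.1.2) (abs_nonneg _) (by norm_num)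

section Reduction
variable {E : Type*} [NormedAddCommGroup E] [NormedSpace ℝ E] [MeasurableSpace E]
  [BorelSpace E] [FiniteDimensional ℝ E] {μ : Measure E} {ev : ℝ → E →L[ℝ] ℝ × ℝ} {T : Set ℝ}

lemma Planar.norm_sub_le (h : Planar μ ev T) {r s : ℝ} (hr : r ∈ T) (hs : s ∈ T) :
    LeOne μ (fun z => ‖ev r z - ev s z‖) (2 * √|cbrt (r - s)|) := by
  have := h.gauss.gauss.toIsProbabilityMeasure
  have h1 := h.integral_sq_norm_le hr hs
  refine LeOne.of_sq (by fun_prop) h1.int (by positivity) ?_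
  calc ∫ z, ‖ev r z - ev s z‖ ^ 2 ∂μ ≤ ∫ z, |‖ev r z - ev s z‖ ^ 2| ∂μ :=
        integral_mono h1.int h1.int.abs fun z => le_abs_self _
    _ ≤ 2 * |cbrt (r - s)| := h1.le
    _ ≤ _ := by
      rw [mul_pow, Real.sq_sqrt (abs_nonneg _)]
      linarith [abs_nonneg (cbrt (r - s))]

lemma Planar.norm_zero_le (h : Planar μ ev T) (h0 : (0 : ℝ) ∈ T) : LeOne μ (fun z => ‖ev 0 z‖) 0 := by
  have := h.gauss.gauss
  have hz : cbrt 0 = 0 := by simp [cbrt]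
  have hw : ∀ w, LeOne μ (fun z => dotL w (ev 0 z)) 0 := fun w => by
    have e := apply_cvec h.gauss ((dotL w).comp (ev 0)) ((dotL w).comp (ev 0))
    rw [ContinuousLinearMap.comp_apply, h.cov 0 h0 0 h0, cov6_eq] at e
    simp only [sub_self, abs_zero, hz, add_zero, zero_div, zero_smul, map_zero] at e
    have := h.gauss.gauss.toIsProbabilityMeasure
    refine LeOne.of_sq (by fun_prop) (integrable_of_temperate (((dotL w).comp (ev 0)).hasTemperateGrowth.pow 2))
      le_rfl ?_
    have e2 : ∀ z, ((dotL w).comp (ev 0)) z • ((dotL w).comp (ev 0)) z = dotL w (ev 0 z) ^ 2 := fun z => by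
      simp [sq]
    simp only [e2] at e
    rw [← e]; simp
  have hw' : ∀ w, LeOne μ (fun z => |dotL w (ev 0 z)|) 0 := fun w =>
    ⟨(hw w).int.abs, by simpa only [abs_abs] using (hw w).le⟩
  have := (hw' (1, 0)).add (hw' (0, 1))
  rw [add_zero] at this
  refine this.of_abs_le (by fun_prop) fun z => ?_
  simp only [dotL_apply, dot, one_mul, zero_mul, add_zero, zero_add]
  rw [abs_norm, Prod.norm_def, Real.norm_eq_abs, Real.norm_eq_abs]
  exact max_le (le_add_of_nonneg_right (abs_nonneg _)) (le_add_of_nonneg_left (abs_nonneg _))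

end Reduction

lemma LeOne.of_lipschitz {E : Type*} [NormedAddCommGroup E] [NormedSpace ℝ E] [MeasurableSpace E]
    [BorelSpace E] {μ : Measure E} {g : ℝ × ℝ → ℝ} (hg : Cb g) {M a : ℝ} (hM : ∀ x y, ‖g x - g y‖ ≤ M * ‖x - y‖) (hM0 : 0 ≤ M)
    {X Y : E →L[ℝ] ℝ × ℝ} (h : LeOne μ (fun z => ‖X z - Y z‖) a) : LeOne μ (fun z => g (X z) - g (Y z)) (M * a) := by
  have h1 := h.const_mul M
  rw [abs_of_nonneg hM0] at h1
  have hc := hg.1.continuous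
  exact h1.of_abs_le (by fun_prop) fun z => hM _ _

/-- Bound for the error in replacing the symmetric sum by the anchored sum. -/
def reductionBound (C : ℝ) (A B : Fin 6 → ℝ) (δ r e : ℝ) : ℝ :=
  C * √(corrSize δ) + C * √|cbrt e| + 1 / 24 * ∑ u, √(A u * cbrt r + B u * corrSize δ)

theorem exists_reduction_bound {g : ℝ × ℝ → ℝ} (hg : Cb g) (t : ℝ) :
    ∃ (C : ℝ) (A : Fin 6 → ℝ), ∀ K : ℕ, ∃ B : Fin 6 → ℝ, ∀ {E : Type} [NormedAddCommGroup E]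
      [NormedSpace ℝ E] [MeasurableSpace E] [BorelSpace E] [FiniteDimensional ℝ E] {μ : Measure E}
      {ev : ℝ → E →L[ℝ] ℝ × ℝ} {T : Set ℝ} {δ r : ℝ} {N : ℕ} {a : ℕ → ℕ} {τ : ℕ → ℝ}
      (_ : FineGrid μ ev T δ N t) (_ : a 0 = 0) (_ : a K = N) (_ : t ∈ T) (_ : ∀ k < K, τ k ∈ T) (_ : 0 ≤ r)
      (_ : ∀ j < N, |j * δ - τ (anchor a K j)| ≤ r ∧ |(j + 1 : ℕ) * δ - τ (anchor a K j)| ≤ r),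
      LeOne μ (fun z => midSum (gridPath ev δ) N g z -
        (g (ev t z) - g 0 - 1 / 24 * anchoredSum μ ev δ N g a K τ z)) (reductionBound C A B δ r (N * δ - t)) := by
  obtain ⟨C1, hC10, hC1⟩ := exists_expansion_bound hg (weakConst t)
  obtain ⟨M, hM0, hM⟩ := hg.lipschitz
  choose A hA0 hA using fun u => exists_anchor_bound (cb_wtThree hg u) t
  refine ⟨max C1 (M * 2), A, fun K => ?_⟩
  choose B hB0 hB using fun u => hA u K
  refine ⟨B, ?_⟩
  intro E _ _ _ _ _ μ ev T δ r N a τ h h0 hK htT hτ hr hd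
  have e1 := hC1 (h.planar.grid h.pos h.mem h.le h.small)
  have e2 : LeOne μ (fun z => g (ev (N * δ) z) - g (ev t z)) _ :=
    (h.planar.norm_sub_le (h.mem N le_rfl) htT).of_lipschitz hg hM hM0
  have hz : (0 : ℝ) ∈ T := by simpa using h.mem 0 (Nat.zero_le _)
  have e3 : LeOne μ (fun z => g ((0 : E →L[ℝ] ℝ × ℝ) z) - g (ev 0 z)) (M * 0) := by
    refine LeOne.of_lipschitz (a := 0) hg hM hM0 ?_
    simpa using h.planar.norm_zero_le hz
  have e4 : LeOne μ (fun z => ∑ u, ∑ j ∈ Finset.range N, (wtThree g u (mid (gridPath ev δ) j z) -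
      wtThree g u (ev (τ (anchor a K j)) z)) * gh μ 3 (xi (gridPath ev δ) (u, j)) z) _ :=
    LeOne.sum _ fun u _ => hB u h h0 hK hτ hr hd u
  have e5 := (((e1.add e2).add e3).add (e4.const_mul (-1 / 24)))
  have e6 := e5.mono (b := reductionBound (max C1 (M * 2)) A B δ r (N * δ - t)) (by
    have := le_max_left C1 (M * 2)
    have := le_max_right C1 (M * 2)
    have e7 : C1 * √(corrSize δ) ≤ max C1 (M * 2) * √(corrSize δ) := by gcongr
    have e8 : M * (2 * √|cbrt (N * δ - t)|) ≤ max C1 (M * 2) * √|cbrt (N * δ - t)| := by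
      rw [← mul_assoc]; gcongr
    rw [reductionBound]
    norm_num [corrSize] at e7 ⊢
    linarith)
  have e7 : ∀ z, cubicSum μ (gridPath ev δ) N g z - anchoredSum μ ev δ N g a K τ z =
      ∑ u, ∑ j ∈ Finset.range N, (wtThree g u (mid (gridPath ev δ) j z) -
        wtThree g u (ev (τ (anchor a K j)) z)) * gh μ 3 (xi (gridPath ev δ) (u, j)) z := fun z => by
    simp only [cubicSum, anchoredSum, wsum, sub_mul, Finset.sum_sub_distrib]
  simp only [← e7] at e6
  have e8 : ∀ z, gridPath ev δ 0 z = ev 0 z := fun z => by simp [gridPath]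
  have e9 : ∀ z, gridPath ev δ N z = ev (N * δ) z := fun z => rfl
  refine ⟨e6.int.congr (.of_forall fun z => ?_), (integral_congr_ae (.of_forall fun z => ?_)).trans_le e6.le⟩
  · simp only [e8, e9, zero_apply]; ring
  · simp only [e8, e9, zero_apply]; congr 1; ring

lemma norm_exp_mul_I_sub_le (x y : ℝ) :
    ‖Complex.exp (x * Complex.I) - Complex.exp (y * Complex.I)‖ ≤ |x - y| := by
  have e : Complex.exp (x * Complex.I) - Complex.exp (y * Complex.I) =
      Complex.exp (y * Complex.I) * (Complex.exp (Complex.I * (x - y : ℝ)) - 1) := by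
    rw [mul_sub, ← Complex.exp_add, mul_one]
    congr 2
    push_cast; ring
  rw [e, norm_mul, Complex.norm_exp_ofReal_mul_I, one_mul]
  exact Real.norm_exp_I_mul_ofReal_sub_one_le

lemma norm_integral_exp_sub_le {E : Type*} [MeasurableSpace E] {μ : Measure E} [IsProbabilityMeasure μ]
    {w F G : E → ℝ} {M a : ℝ} (hw : Measurable w) (hF : Measurable F) (hG : Measurable G)
    (hM : ∀ z, |w z| ≤ M) (h : LeOne μ (fun z => F z - G z) a) (lam : ℝ) :
    ‖∫ z, (w z : ℂ) * Complex.exp ((lam * F z : ℝ) * Complex.I) ∂μ -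
      ∫ z, (w z : ℂ) * Complex.exp ((lam * G z : ℝ) * Complex.I) ∂μ‖ ≤ M * (|lam| * a) := by
  have hi : ∀ {F : E → ℝ}, Measurable F →
      Integrable (fun z => (w z : ℂ) * Complex.exp ((lam * F z : ℝ) * Complex.I)) μ := fun {F} hF => by
    refine Integrable.of_bound (C := M) (by fun_prop) (.of_forall fun z => ?_)
    rw [norm_mul, Complex.norm_exp_ofReal_mul_I, mul_one, Complex.norm_real]
    exact hM z
  have hn := h.const_mul lam
  rw [← integral_sub (hi hF) (hi hG)]
  refine (norm_integral_le_of_norm_le (hn.int.abs.const_mul M) (.of_forall fun z => ?_)).trans ?_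
  · rw [← mul_sub, norm_mul, Complex.norm_real, mul_sub]
    have := norm_exp_mul_I_sub_le (lam * F z) (lam * G z)
    exact mul_le_mul (hM z) this (norm_nonneg _) ((abs_nonneg _).trans (hM z))
  · rw [integral_const_mul]
    have hM0 : 0 ≤ M := by
      obtain ⟨z⟩ : Nonempty E := nonempty_of_isProbabilityMeasure μ
      exact (abs_nonneg _).trans (hM z)
    exact mul_le_mul_of_nonneg_left hn.le hM0

theorem exists_symm_bound {m : ℕ} {ψ : (Fin m → ℝ × ℝ) → ℝ} (hψ : Cb ψ) {g : ℝ × ℝ → ℝ} (hg : Cb g)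
    (lam : ℝ) {t : ℝ} (ht : 0 ≤ t) :
    ∃ (M C : ℝ) (A : Fin 6 → ℝ), ∀ K : ℕ, ∃ (B' : ℝ) (B : Fin 6 → ℝ), ∀ {E : Type} [NormedAddCommGroup E]
      [NormedSpace ℝ E] [MeasurableSpace E] [BorelSpace E] [FiniteDimensional ℝ E] {μ : Measure E}
      {ev : ℝ → E →L[ℝ] ℝ × ℝ} {T : Set ℝ} {δ r : ℝ} {N : ℕ} {a : ℕ → ℕ} {τ : ℕ → ℝ} {s : Fin m → ℝ}
      (_ : FineGrid μ ev T δ N t) (_ : Monotone a) (_ : a 0 = 0) (_ : a K = N) (_ : ∀ i, s i ∈ T)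
      (_ : t ∈ T) (_ : ∀ k < K, τ k ∈ T) (_ : 0 ≤ r)
      (_ : ∀ j < N, |j * δ - τ (anchor a K j)| ≤ r ∧ |(j + 1 : ℕ) * δ - τ (anchor a K j)| ≤ r)
      {η : ℝ} (_ : 0 ≤ η)
      (_ : ∀ k < K, ∀ k' < K, |blockCov δ a k k' - if k = k' then t / K * cubeRho else 0| ≤ η),
      ‖∫ z, (ψ (fun i => ev (s i) z) : ℂ) *
          Complex.exp ((lam * midSum (gridPath ev δ) N g z : ℝ) * Complex.I) ∂μ -
        ∫ z, (ψ (fun i => ev (s i) z) : ℂ) * Complex.exp ((lam * (g (ev t z) - g 0) : ℝ) * Complex.I) *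
          (Real.exp (-(lam ^ 2 / 2) * ∑ k : Fin K, t / K * varDensity g (ev (τ k) z)) : ℝ) ∂μ‖ ≤
        M * reductionBound C A B δ r (N * δ - t) + B' * (corrSize δ + η) := by
  obtain ⟨M, hM0, hM⟩ := hψ.bound
  obtain ⟨C, A, hA⟩ := exists_reduction_bound hg t
  refine ⟨M * |lam|, C, A, fun K => ?_⟩
  obtain ⟨B, hB⟩ := hA K
  obtain ⟨B', -, hB'⟩ := exists_block_bound hψ hg lam ht K
  refine ⟨B', B, ?_⟩
  intro E _ _ _ _ _ μ ev T δ r N a τ s h ha h0 hK hs htT hτ hr hd η hη hcov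
  have := h.planar.gauss.gauss.toIsProbabilityMeasure
  have hψc := hψ.1.continuous
  have hgc := hg.1.continuous
  have hw : Continuous fun z : E => ψ fun i => ev (s i) z :=
    hψc.comp (ContinuousLinearMap.pi fun i => ev (s i)).continuous
  have hanc : Continuous (anchoredSum μ ev δ N g a K τ) :=
    continuous_finsetSum _ fun u _ => continuous_finsetSum _ fun j _ =>
      ((cb_wtThree hg u).1.continuous.comp (ev _).continuous).mul (gh_temperate 3 _).1.continuous
  have e1 := norm_integral_exp_sub_le hw.measurable (continuous_midSum (gridPath ev δ) N hg).measurable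
    (by fun_prop : Continuous fun z => g (ev t z) - g 0 - 1 / 24 * anchoredSum μ ev δ N g a K τ z).measurable
    (fun z => hM _) (hB h h0 hK htT hτ hr hd) lam
  have e2 := hB' h ha h0 hK hs htT hτ hη hcov
  rw [mul_assoc]
  exact (norm_sub_le_norm_sub_add_norm_sub _ _ _).trans (add_le_add e1 e2)

/-- The left end of the `k`-th of `K` equal blocks of `[0, t]`. -/
def blockTime (t : ℝ) (K k : ℕ) : ℝ := t / K * k

/-- The index of the first dyadic interval in the `k`-th of `K` equal blocks of `[0, t]`. -/
def blockStart (t : ℝ) (K n k : ℕ) : ℕ := nSteps n (blockTime t K k)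

section Blocks
variable {t : ℝ} (ht : 0 ≤ t) {K : ℕ}
include ht

lemma blockTime_mono : Monotone (blockTime t K) := fun k k' h =>
  mul_le_mul_of_nonneg_left (by exact_mod_cast h) (by positivity)

lemma blockTime_nonneg (k : ℕ) : 0 ≤ blockTime t K k := by rw [blockTime]; positivity

lemma blockStart_mono (n : ℕ) : Monotone (blockStart t K n) := (nSteps_mono n).comp (blockTime_mono ht)

lemma tendsto_blockStart (k : ℕ) :
    Tendsto (fun n => blockStart t K n k * mesh n) atTop (𝓝 (blockTime t K k)) :=
  tendsto_nSteps (blockTime_nonneg ht k)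

lemma dist_blockTime_le (n : ℕ) {j : ℕ} (hj : j < blockStart t K n K) :
    |j * mesh n - blockTime t K (anchor (blockStart t K n) K j)| ≤ t / K + mesh n ∧
      |(j + 1 : ℕ) * mesh n - blockTime t K (anchor (blockStart t K n) K j)| ≤ t / K + mesh n := by
  have h0 : blockStart t K n 0 = 0 := by simp [blockStart, blockTime, nSteps_zero]
  obtain ⟨-, h2, h3⟩ := anchor_spec h0 hj
  set k := anchor (blockStart t K n) K j
  have hm := mesh_pos n
  have h4 := sub_nSteps_mul_mesh_le n (blockTime t K k)
  have h5 := nSteps_mul_mesh_le n (blockTime_nonneg (K := K) ht (k + 1))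
  have h6 : blockTime t K (k + 1) = blockTime t K k + t / K := by simp only [blockTime]; push_cast; ring
  have h7 : (blockStart t K n k : ℝ) * mesh n ≤ j * mesh n := by gcongr
  have h8 : ((j + 1 : ℕ) : ℝ) * mesh n ≤ blockStart t K n (k + 1) * mesh n := by gcongr; exact h3
  have h9 : ((j + 1 : ℕ) : ℝ) * mesh n = j * mesh n + mesh n := by push_cast; ring
  have h10 : 0 ≤ t / K := by positivity
  simp only [blockStart] at h7 h8
  constructor <;> rw [abs_le] <;> constructor <;> linarith

lemma tendsto_blockCov {k k' : ℕ} :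
    Tendsto (fun n => blockCov (mesh n) (blockStart t K n) k k') atTop
      (𝓝 (if k = k' then t / K * cubeRho else 0)) := by
  have hs : Summable fun r : ℤ => |rho6 r ^ 3| := by
    refine (summable_abs_rho6.mul_left (rhoSum ^ 2)).of_nonneg_of_le (fun _ => abs_nonneg _) fun r => ?_
    rw [abs_pow, pow_succ]
    gcongr
    exact abs_rho6_le r
  have key := tendsto_block hs mesh_pos tendsto_mesh (tendsto_blockStart (K := K) ht k)
    (tendsto_blockStart (K := K) ht (k + 1)) (tendsto_blockStart (K := K) ht k')
    (tendsto_blockStart (K := K) ht (k' + 1))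
  have e : max (min (blockTime t K (k + 1)) (blockTime t K (k' + 1)) - max (blockTime t K k) (blockTime t K k')) 0 *
      ∑' r : ℤ, rho6 r ^ 3 = if k = k' then t / K * cubeRho else 0 := by
    rw [← cubeRho]
    have hm := blockTime_mono (K := K) ht
    rcases lt_trichotomy k k' with h | h | h
    · rw [if_neg h.ne, max_eq_right, zero_mul]
      have := hm (Nat.succ_le_of_lt h)
      have := min_le_left (blockTime t K (k + 1)) (blockTime t K (k' + 1))
      have := le_max_right (blockTime t K k) (blockTime t K k')
      simp only [Nat.succ_eq_add_one] at *
      linarith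
    · subst h
      rw [if_pos rfl, min_self, max_self, max_eq_left (sub_nonneg.2 (hm (Nat.le_succ k)))]
      simp only [blockTime]
      push_cast; ring
    · rw [if_neg h.ne', max_eq_right, zero_mul]
      have := hm (Nat.succ_le_of_lt h)
      have := min_le_right (blockTime t K (k + 1)) (blockTime t K (k' + 1))
      have := le_max_left (blockTime t K k) (blockTime t K k')
      simp only [Nat.succ_eq_add_one] at *
      linarith
  rw [← e]
  refine key.congr fun n => ?_
  rw [blockCov]
  congr 1
  refine Finset.sum_congr rfl fun i _ => Finset.sum_congr rfl fun j _ => ?_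
  rw [← neg_sub (j : ℤ), rho6_neg]

end Blocks

/-- Total deviation of the block covariances from their limits. -/
def covError (t : ℝ) (K n : ℕ) : ℝ :=
  ∑ k ∈ Finset.range K, ∑ k' ∈ Finset.range K,
    |blockCov (mesh n) (blockStart t K n) k k' - if k = k' then t / K * cubeRho else 0|

lemma covError_nonneg (t : ℝ) (K n : ℕ) : 0 ≤ covError t K n :=
  Finset.sum_nonneg fun _ _ => Finset.sum_nonneg fun _ _ => abs_nonneg _

lemma le_covError (t : ℝ) {K : ℕ} (n : ℕ) {k k' : ℕ} (hk : k < K) (hk' : k' < K) :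
    |blockCov (mesh n) (blockStart t K n) k k' - if k = k' then t / K * cubeRho else 0| ≤ covError t K n :=
  (Finset.single_le_sum (f := fun k' => |blockCov (mesh n) (blockStart t K n) k k' -
      if k = k' then t / K * cubeRho else 0|) (fun _ _ => abs_nonneg _) (Finset.mem_range.2 hk')).trans
    (Finset.single_le_sum (f := fun k => ∑ k' ∈ Finset.range K, |blockCov (mesh n) (blockStart t K n) k k' -
      if k = k' then t / K * cubeRho else 0|)
      (fun _ _ => Finset.sum_nonneg fun _ _ => abs_nonneg _) (Finset.mem_range.2 hk))

lemma tendsto_covError {t : ℝ} (ht : 0 ≤ t) (K : ℕ) : Tendsto (covError t K) atTop (𝓝 0) := by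
  have : Tendsto (covError t K) atTop (𝓝 (∑ k ∈ Finset.range K, ∑ k' ∈ Finset.range K, 0)) := by
    refine tendsto_finsetSum _ fun k _ => tendsto_finsetSum _ fun k' _ => ?_
    have := ((tendsto_blockCov (K := K) ht (k := k) (k' := k')).sub_const
      (if k = k' then t / K * cubeRho else 0)).abs
    rwa [sub_self, abs_zero] at this
  simpa using this

lemma tendsto_corrSize : Tendsto (fun n => corrSize (mesh n)) atTop (𝓝 0) := by
  have h : Tendsto (fun n => mesh n ^ (1 / 3 : ℝ)) atTop (𝓝 (0 ^ (1 / 3 : ℝ))) :=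
    tendsto_mesh.rpow_const (Or.inr (by norm_num))
  rw [Real.zero_rpow (by norm_num)] at h
  simpa [corrSize] using h.const_mul corrScale

lemma continuous_cbrt : Continuous cbrt :=
  cbrt_mono.continuous_of_surjective fun x => ⟨x ^ 3,
    (Odd.strictMono_pow (by decide : Odd 3)).injective (cbrt_pow _)⟩

/-- The limiting error of the block approximation with `K` blocks. -/
def blockError (A : Fin 6 → ℝ) (t : ℝ) (K : ℕ) : ℝ := 1 / 24 * ∑ u, √(A u * cbrt (t / K))

lemma tendsto_reductionBound (C : ℝ) (A B : Fin 6 → ℝ) {t : ℝ} (ht : 0 ≤ t) (K : ℕ) :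
    Tendsto (fun n => reductionBound C A B (mesh n) (t / K + mesh n) (nSteps n t * mesh n - t)) atTop
      (𝓝 (blockError A t K)) := by
  have hz : cbrt 0 = 0 := by simp [cbrt]
  have h1 := (tendsto_corrSize.sqrt).const_mul C
  have h2 := ((continuous_cbrt.tendsto _).comp ((tendsto_nSteps ht).sub_const t)).abs.sqrt.const_mul C
  have h3 := (continuous_cbrt.tendsto _).comp (tendsto_mesh.const_add (t / K))
  have h4 : ∀ u, Tendsto (fun n => √(A u * cbrt (t / K + mesh n) + B u * corrSize (mesh n))) atTop _ :=
    fun u => ((h3.const_mul (A u)).add (tendsto_corrSize.const_mul (B u))).sqrt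
  have h5 := (h1.add h2).add ((tendsto_finsetSum Finset.univ fun u _ => h4 u).const_mul (1 / 24))
  simp only [sub_self, hz, abs_zero, Real.sqrt_zero, mul_zero, add_zero, zero_add] at h5
  exact h5

lemma tendsto_blockError (A : Fin 6 → ℝ) (t : ℝ) : Tendsto (blockError A t) atTop (𝓝 0) := by
  have hz : cbrt 0 = 0 := by simp [cbrt]
  have h1 := (continuous_cbrt.tendsto _).comp (tendsto_const_div_atTop_nhds_zero_nat t)
  have h2 := (tendsto_finsetSum Finset.univ fun u _ => (h1.const_mul (A u)).sqrt).const_mul (1 / 24)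
  simp only [hz, mul_zero, Real.sqrt_zero, Finset.sum_const_zero] at h2
  exact h2

lemma cb_varDensity {g : ℝ × ℝ → ℝ} (hg : Cb g) : Cb (varDensity g) := by
  have h : ∀ (c : ℝ) (a b : ℕ), Cb fun z => c * pdv a b g z ^ 2 := fun c a b => by
    simp only [pow_two]
    exact ((cb_pdv hg a b).mul (cb_pdv hg a b)).const_mul c
  exact (((h _ 3 0).add (h _ 0 3)).add (h _ 1 2)).add (h _ 2 1)

section GaussianProcess
variable {Ω : Type*} {X1 X2 : ℝ → Ω → ℝ} {f : ℝ → ℝ → ℝ} {t lam : ℝ} {m : ℕ} {ψ : (Fin m → ℝ × ℝ) → ℝ}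

/-- The symmetric Riemann sum of `∇f` along the path of `(X1, X2)`. -/
def symmSum (X1 X2 : ℝ → Ω → ℝ) (f : ℝ → ℝ → ℝ) (t : ℝ) (n : ℕ) (ω : Ω) : ℝ :=
  ∑ j ∈ Finset.range (nSteps n t),
    (Xmid X1 X2 (pd 1 0 f) n j ω * Xincr X1 n j ω + Xmid X1 X2 (pd 0 1 f) n j ω * Xincr X2 n j ω)

lemma midSum_sample (hf : CbSmooth2 f) {T : Finset ℝ} {n : ℕ}
    (hT : ∀ j ≤ nSteps n t, (j : ℝ) * mesh n ∈ T) (ω : Ω) :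
    midSum (gridPath (evAt T) (mesh n)) (nSteps n t) (fun p => f p.1 p.2) (sample X1 X2 T ω) =
      symmSum X1 X2 f t n ω := by
  refine Finset.sum_congr rfl fun j hj => ?_
  rw [Finset.mem_range] at hj
  have h0 := evAt_sample X1 X2 (hT j hj.le) ω
  have h1 := evAt_sample X1 X2 (hT (j + 1) hj) ω
  rw [dv_pair, incr, mid, sub_apply, smul_apply, add_apply]
  simp only [gridPath]
  rw [h0, h1, Xmid, Xmid, pd_eq_pdv hf, pd_eq_pdv hf, Xincr, Xincr]
  simp only [dyadicPt_eq]
  have e : (1 / 2 : ℝ) • ((X1 (j * mesh n) ω, X2 (j * mesh n) ω) +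
      (X1 ((j + 1 : ℕ) * mesh n) ω, X2 ((j + 1 : ℕ) * mesh n) ω)) =
      ((X1 ((j + 1 : ℕ) * mesh n) ω + X1 (j * mesh n) ω) / 2,
        (X2 ((j + 1 : ℕ) * mesh n) ω + X2 (j * mesh n) ω) / 2) := by
    ext <;> simp <;> ring
  rw [e]
  simp only [pdv, iterate_one, iterate_zero, id_eq, Prod.fst_sub, Prod.snd_sub]
  ring

variable [MeasurableSpace Ω] {P : Measure Ω}

theorem exists_process_bound (hX1 : IsCenteredGaussianProcess P X1 (covH (1 / 6)))
    (hX2 : IsCenteredGaussianProcess P X2 (covH (1 / 6))) (hI : IndepProcesses P X1 X2)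
    (hf : CbSmooth2 f) (ht : 0 ≤ t) (hψ : Cb ψ) (s : Fin m → ℝ) (lam : ℝ) :
    ∃ (M C : ℝ) (A : Fin 6 → ℝ), ∀ K ≠ 0, ∃ (B' : ℝ) (B : Fin 6 → ℝ), ∀ n, corrSize (mesh n) ≤ 1 →
      ‖∫ ω, (ψ (fun i => (X1 (s i) ω, X2 (s i) ω)) : ℂ) *
          Complex.exp ((lam * symmSum X1 X2 f t n ω : ℝ) * Complex.I) ∂P -
        ∫ ω, (ψ (fun i => (X1 (s i) ω, X2 (s i) ω)) : ℂ) *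
          Complex.exp ((lam * (f (X1 t ω) (X2 t ω) - f 0 0) : ℝ) * Complex.I) *
          (Real.exp (-(lam ^ 2 / 2) * ∑ k : Fin K, t / K * varDensity (fun p => f p.1 p.2)
            (X1 (blockTime t K k) ω, X2 (blockTime t K k) ω)) : ℝ) ∂P‖ ≤
        M * reductionBound C A B (mesh n) (t / K + mesh n) (nSteps n t * mesh n - t) +
          B' * (corrSize (mesh n) + covError t K n) := by
  have hg : Cb fun p : ℝ × ℝ => f p.1 p.2 := CbSmooth.cb hf
  obtain ⟨M, C, A, hA⟩ := exists_symm_bound hψ hg lam ht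
  refine ⟨M, C, A, fun K hK => ?_⟩
  obtain ⟨B', B, hB⟩ := hA K
  refine ⟨B', B, fun n hn => ?_⟩
  classical
  let T : Finset ℝ := (Finset.range (nSteps n t + 1)).image (fun j : ℕ => (j : ℝ) * mesh n) ∪
    Finset.univ.image s ∪ {t} ∪ (Finset.range K).image (blockTime t K)
  have hTn : ∀ j ≤ nSteps n t, (j : ℝ) * mesh n ∈ T := fun j hj => by
    have : (j : ℝ) * mesh n ∈ (Finset.range (nSteps n t + 1)).image (fun j : ℕ => (j : ℝ) * mesh n) :=
      Finset.mem_image_of_mem _ (Finset.mem_range.2 (Nat.lt_succ_of_le hj))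
    simp only [T, Finset.mem_union]
    tauto
  have hTs : ∀ i, s i ∈ T := fun i => by
    have : s i ∈ Finset.univ.image s := Finset.mem_image_of_mem _ (Finset.mem_univ i)
    simp only [T, Finset.mem_union]
    tauto
  have hTt : t ∈ T := by simp [T]
  have hTb : ∀ k < K, blockTime t K k ∈ T := fun k hk => by
    have : blockTime t K k ∈ (Finset.range K).image (blockTime t K) :=
      Finset.mem_image_of_mem _ (Finset.mem_range.2 hk)
    simp only [T, Finset.mem_union]
    tauto
  have hfine : FineGrid (P.map (sample X1 X2 T)) (evAt T) T (mesh n) (nSteps n t) t :=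
    ⟨planar_sample hX1 hX2 hI T, mesh_pos n, fun j hj => hTn j hj, nSteps_mul_mesh_le n ht, hn⟩
  have hend : blockStart t K n K = nSteps n t := by
    rw [blockStart, blockTime, div_mul_cancel₀ _ (Nat.cast_ne_zero.2 hK)]
  have key := hB (s := s) (τ := blockTime t K) hfine (blockStart_mono ht n)
    (by simp [blockStart, blockTime, nSteps_zero]) hend hTs hTt hTb
    (by have := mesh_pos n; positivity : 0 ≤ t / K + mesh n)
    (fun j hj => dist_blockTime_le ht n (hend ▸ hj)) (covError_nonneg t K n)
    (fun k hk k' hk' => le_covError t n hk hk')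
  have hm := (measurable_sample (T := T) hX1.1 hX2.1).aemeasurable (μ := P)
  have hψc := hψ.1.continuous
  have hgc := hg.1.continuous
  have hms := continuous_midSum (gridPath (evAt T) (mesh n)) (nSteps n t) hg
  have hvc := (cb_varDensity hg).1.continuous
  rw [integral_map hm (by fun_prop), integral_map hm (by fun_prop)] at key
  simp only [midSum_sample hf hTn, evAt_sample X1 X2 (hTs _), evAt_sample X1 X2 hTt] at key
  have e : ∀ ω, ∑ k : Fin K, t / K * varDensity (fun p => f p.1 p.2)
      (evAt T (blockTime t K k) (sample X1 X2 T ω)) = ∑ k : Fin K, t / K * varDensity (fun p => f p.1 p.2)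
      (X1 (blockTime t K k) ω, X2 (blockTime t K k) ω) := fun ω =>
    Finset.sum_congr rfl fun k _ => by rw [evAt_sample X1 X2 (hTb k k.2)]
  simp only [e] at key
  exact key

end GaussianProcess

lemma tendsto_riemannSum {φ : ℝ → ℝ} (hφ : Continuous φ) {t : ℝ} (ht : 0 ≤ t) :
    Tendsto (fun K : ℕ => ∑ k : Fin K, t / K * φ (blockTime t K k)) atTop (𝓝 (∫ u in (0 : ℝ)..t, φ u)) := by
  rw [Metric.tendsto_atTop]
  intro ε hε
  have hu := isCompact_Icc.uniformContinuousOn_of_continuous (hφ.continuousOn (s := Set.Icc 0 t))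
  obtain ⟨d, hd, hdist⟩ := Metric.uniformContinuousOn_iff.1 hu (ε / (t + 1)) (by positivity)
  obtain ⟨K0, hK0⟩ := exists_nat_gt (t / d)
  refine ⟨K0 + 1, fun K hK => ?_⟩
  have hKpos : (0 : ℝ) < K := by exact_mod_cast (by lia : 0 < K)
  have hK' : t / K < d := by
    rw [div_lt_comm₀ hKpos hd]
    exact hK0.trans_le (by exact_mod_cast (by lia : K0 ≤ K))
  have h0 : blockTime t K 0 = 0 := by simp [blockTime]
  have hend : blockTime t K K = t := by rw [blockTime, div_mul_cancel₀ _ hKpos.ne']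
  have hmono := blockTime_mono (K := K) ht
  have hstep : ∀ k, blockTime t K (k + 1) - blockTime t K k = t / K := fun k => by
    simp only [blockTime]; push_cast; ring
  have hsum := intervalIntegral.sum_integral_adjacent_intervals (f := φ) (a := blockTime t K) (n := K)
    (μ := volume) fun k _ => hφ.intervalIntegrable _ _
  rw [h0, hend] at hsum
  rw [Fin.sum_univ_eq_sum_range (fun k => t / K * φ (blockTime t K k)), ← hsum, Real.dist_eq,
    ← Finset.sum_sub_distrib]
  have hb : ∀ k ∈ Finset.range K, |t / K * φ (blockTime t K k) -
      ∫ u in (blockTime t K k)..(blockTime t K (k + 1)), φ u| ≤ ε / (t + 1) * (t / K) := by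
    intro k hk
    have hk' : k + 1 ≤ K := Finset.mem_range.1 hk
    have e : t / K * φ (blockTime t K k) =
        ∫ _ in (blockTime t K k)..(blockTime t K (k + 1)), φ (blockTime t K k) := by
      rw [intervalIntegral.integral_const, hstep, smul_eq_mul]
    rw [e, ← intervalIntegral.integral_sub intervalIntegrable_const (hφ.intervalIntegrable _ _)]
    have := intervalIntegral.norm_integral_le_of_norm_le_const (a := blockTime t K k)
      (b := blockTime t K (k + 1)) (C := ε / (t + 1)) (f := fun u => φ (blockTime t K k) - φ u) fun u hu => by
        rw [Set.uIoc_of_le (hmono (Nat.le_succ k))] at hu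
        have h1 := blockTime_nonneg (K := K) ht k
        have h2 := hmono hk'
        rw [hend] at h2
        refine (hdist _ ⟨h1, ?_⟩ _ ⟨h1.trans hu.1.le, hu.2.trans h2⟩ ?_).le
        · exact (hmono (Nat.le_succ k)).trans h2
        · have h3 := hstep k
          rw [Real.dist_eq, abs_sub_comm, abs_of_nonneg (sub_nonneg.2 hu.1.le)]
          linarith [hu.2]
    rwa [hstep, abs_of_nonneg (by positivity : 0 ≤ t / K)] at this
  calc _ ≤ ∑ _ ∈ Finset.range K, ε / (t + 1) * (t / K) :=
        (Finset.abs_sum_le_sum_abs _ _).trans (Finset.sum_le_sum hb)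
    _ = ε * (t / (t + 1)) := by
      rw [Finset.sum_const, Finset.card_range, nsmul_eq_mul]
      field_simp
    _ < ε * 1 := by
      gcongr
      rw [div_lt_one (by positivity)]
      linarith
    _ = ε := mul_one ε

section Limit
variable {Ω : Type*} {X1 X2 : ℝ → Ω → ℝ} {f : ℝ → ℝ → ℝ} {t : ℝ} {m : ℕ} {ψ : (Fin m → ℝ × ℝ) → ℝ}

lemma integral_varDensity (hf : CbSmooth2 f) {ω : Ω} (hc1 : Continuous fun u => X1 u ω)
    (hc2 : Continuous fun u => X2 u ω) :
    ∫ u in (0 : ℝ)..t, varDensity (fun p => f p.1 p.2) (X1 u ω, X2 u ω) =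
      ((∑' r : ℤ, rhoH (1 / 6) r ^ 3) / 96 * ∫ u in (0 : ℝ)..t, pd 3 0 f (X1 u ω) (X2 u ω) ^ 2) +
        ((∑' r : ℤ, rhoH (1 / 6) r ^ 3) / 96 * ∫ u in (0 : ℝ)..t, pd 0 3 f (X1 u ω) (X2 u ω) ^ 2) +
        ((∑' r : ℤ, rhoH (1 / 6) r ^ 3) / 32 * ∫ u in (0 : ℝ)..t, pd 1 2 f (X1 u ω) (X2 u ω) ^ 2) +
        ((∑' r : ℤ, rhoH (1 / 6) r ^ 3) / 32 * ∫ u in (0 : ℝ)..t, pd 2 1 f (X1 u ω) (X2 u ω) ^ 2) := by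
  have hg : Cb fun p : ℝ × ℝ => f p.1 p.2 := CbSmooth.cb hf
  have hi : ∀ (c : ℝ) (a b : ℕ), IntervalIntegrable
      (fun u => c * pdv a b (fun p => f p.1 p.2) (X1 u ω, X2 u ω) ^ 2) volume 0 t := fun c a b =>
    ((((cb_pdv hg a b).1.continuous.comp (hc1.prodMk hc2)).pow 2).const_mul c).intervalIntegrable _ _
  simp only [varDensity, pd_eq_pdv hf]
  rw [intervalIntegral.integral_add (((hi _ 3 0).add (hi _ 0 3)).add (hi _ 1 2)) (hi _ 2 1),
    intervalIntegral.integral_add ((hi _ 3 0).add (hi _ 0 3)) (hi _ 1 2),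
    intervalIntegral.integral_add (hi _ 3 0) (hi _ 0 3)]
  simp only [intervalIntegral.integral_const_mul]
  rfl

variable [MeasurableSpace Ω] {P : Measure Ω} [IsProbabilityMeasure P]

lemma tendsto_integral_riemannSum (h1 : ∀ u, Measurable (X1 u)) (h2 : ∀ u, Measurable (X2 u))
    (hc1 : ∀ ω, Continuous fun u => X1 u ω) (hc2 : ∀ ω, Continuous fun u => X2 u ω) {V : ℝ × ℝ → ℝ}
    (hV : Cb V) (ht : 0 ≤ t) {Y : Ω → ℂ} (hY : Measurable Y) {M : ℝ} (hM : ∀ ω, ‖Y ω‖ ≤ M) (c : ℝ) :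
    Tendsto (fun K : ℕ => ∫ ω, Y ω *
        (Real.exp (c * ∑ k : Fin K, t / K * V (X1 (blockTime t K k) ω, X2 (blockTime t K k) ω)) : ℝ) ∂P)
      atTop (𝓝 (∫ ω, Y ω * (Real.exp (c * ∫ u in (0 : ℝ)..t, V (X1 u ω, X2 u ω)) : ℝ) ∂P)) := by
  obtain ⟨D, hD0, hD⟩ := hV.bound
  have hVm := hV.1.continuous.measurable
  refine tendsto_integral_of_dominated_convergence (fun _ => M * Real.exp (|c| * (t * D))) (fun K => ?_)
    (integrable_const _) (fun K => .of_forall fun ω => ?_) (.of_forall fun ω => ?_)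
  · have : Measurable fun ω => ∑ k : Fin K, t / K * V (X1 (blockTime t K k) ω, X2 (blockTime t K k) ω) :=
      Finset.measurable_fun_sum _ fun k _ => (hVm.comp ((h1 _).prodMk (h2 _))).const_mul _
    exact (hY.mul (Complex.measurable_ofReal.comp
      (Real.measurable_exp.comp (this.const_mul c)))).aestronglyMeasurable
  · rw [norm_mul, Complex.norm_real, Real.norm_eq_abs, Real.abs_exp]
    have hs : |∑ k : Fin K, t / K * V (X1 (blockTime t K k) ω, X2 (blockTime t K k) ω)| ≤ t * D := by
      refine (Finset.abs_sum_le_sum_abs _ _).trans ?_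
      refine (Finset.sum_le_sum (g := fun _ => t / K * D) fun k _ => ?_).trans ?_
      · rw [abs_mul, abs_of_nonneg (by positivity : 0 ≤ t / K)]
        exact mul_le_mul_of_nonneg_left (hD _) (by positivity)
      · rw [Finset.sum_const, Finset.card_univ, Fintype.card_fin, nsmul_eq_mul, ← mul_assoc]
        refine mul_le_mul_of_nonneg_right ?_ hD0
        rcases K.eq_zero_or_pos with rfl | hK
        · simpa using ht
        · rw [mul_div_cancel₀ _ (by positivity)]
    have he : c * ∑ k : Fin K, t / K * V (X1 (blockTime t K k) ω, X2 (blockTime t K k) ω) ≤ |c| * (t * D) := by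
      refine (le_abs_self _).trans ?_
      rw [abs_mul]
      exact mul_le_mul_of_nonneg_left hs (abs_nonneg c)
    exact mul_le_mul (hM ω) (Real.exp_le_exp.2 he) (Real.exp_pos _).le ((norm_nonneg _).trans (hM ω))
  · have := tendsto_riemannSum (hV.1.continuous.comp ((hc1 ω).prodMk (hc2 ω))) ht
    exact ((Complex.continuous_ofReal.tendsto _).comp
      ((Real.continuous_exp.tendsto _).comp (this.const_mul c))).const_mul (Y ω)

end Limit

/-- Convergence follows from approximation by a doubly indexed family. -/
lemma tendsto_of_approx {F : Type*} [NormedAddCommGroup F] {I : ℕ → F} {J : ℕ → F} {L : F}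
    (hJ : Tendsto J atTop (𝓝 L)) {b : ℕ → ℕ → ℝ} {b' : ℕ → ℝ}
    (hb : ∀ K ≠ 0, Tendsto (b K) atTop (𝓝 (b' K))) (hb' : Tendsto b' atTop (𝓝 0))
    (h : ∀ K ≠ 0, ∀ᶠ n in atTop, ‖I n - J K‖ ≤ b K n) : Tendsto I atTop (𝓝 L) := by
  rw [Metric.tendsto_nhds]
  intro ε hε
  have e1 := (Metric.tendsto_nhds.1 hJ) (ε / 2) (by positivity)
  have e2 := hb'.eventually_lt_const (by positivity : (0 : ℝ) < ε / 2)
  obtain ⟨K, h1, h2, h3⟩ := (e1.and (e2.and (eventually_ne_atTop 0))).exists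
  filter_upwards [h K h3, (hb K h3).eventually_lt_const h2] with n h4 h5
  calc dist (I n) L ≤ dist (I n) (J K) + dist (J K) L := dist_triangle _ _ _
    _ < ε / 2 + ε / 2 := by rw [dist_eq_norm (I n)]; linarith
    _ = ε := add_halves ε

end CriticalHurst

theorem change_of_variable_in_law_critical_hurst
    {Ω : Type*} [MeasurableSpace Ω] (P : Measure Ω) [IsProbabilityMeasure P]
    (X1 X2 : ℝ → Ω → ℝ)
    (hX1 : IsCenteredGaussianProcess P X1 (covH (1 / 6)))
    (hX2 : IsCenteredGaussianProcess P X2 (covH (1 / 6)))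
    (hInd : IndepProcesses P X1 X2)
    (hc1 : ∀ ω, Continuous fun u => X1 u ω)
    (hc2 : ∀ ω, Continuous fun u => X2 u ω)
    (f : ℝ → ℝ → ℝ) (hf : CbSmooth2 f)
    (t : ℝ) (ht : 0 ≤ t)
    (m : ℕ) (hm : 1 ≤ m)
    (ψ : (Fin m → ℝ × ℝ) → ℝ) (hψ : CbSmooth ψ)
    (s : Fin m → ℝ) (lam : ℝ) :
    Tendsto
      (fun n : ℕ => ∫ ω,
        Complex.ofReal (ψ fun i => (X1 (s i) ω, X2 (s i) ω)) *
          Complex.exp (Complex.I * (lam : ℂ) *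
            Complex.ofReal
              (∑ j ∈ Finset.range (nSteps n t),
                (Xmid X1 X2 (pd 1 0 f) n j ω * Xincr X1 n j ω +
                  Xmid X1 X2 (pd 0 1 f) n j ω * Xincr X2 n j ω))) ∂P)
      atTop
      (nhds (∫ ω,
        Complex.ofReal (ψ fun i => (X1 (s i) ω, X2 (s i) ω)) *
          Complex.exp (Complex.I * (lam : ℂ) *
            Complex.ofReal (f (X1 t ω) (X2 t ω) - f 0 0)) *
          Complex.exp (-((lam : ℂ) ^ 2 / 2) *
            Complex.ofReal
              (((∑' r : ℤ, rhoH (1 / 6) r ^ 3) / 96 *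
                  ∫ u in (0 : ℝ)..t, pd 3 0 f (X1 u ω) (X2 u ω) ^ 2) +
                ((∑' r : ℤ, rhoH (1 / 6) r ^ 3) / 96 *
                  ∫ u in (0 : ℝ)..t, pd 0 3 f (X1 u ω) (X2 u ω) ^ 2) +
                ((∑' r : ℤ, rhoH (1 / 6) r ^ 3) / 32 *
                  ∫ u in (0 : ℝ)..t, pd 1 2 f (X1 u ω) (X2 u ω) ^ 2) +
                ((∑' r : ℤ, rhoH (1 / 6) r ^ 3) / 32 *
                  ∫ u in (0 : ℝ)..t, pd 2 1 f (X1 u ω) (X2 u ω) ^ 2))) ∂P)) := by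
  open CriticalHurst in
  have hg : Cb fun p : ℝ × ℝ => f p.1 p.2 := CbSmooth.cb hf
  obtain ⟨M, C, A, hA⟩ := exists_process_bound hX1 hX2 hInd hf ht hψ.cb s lam
  choose! B' B hB using hA
  obtain ⟨D, -, hD⟩ := hψ.cb.bound
  have hψm : Measurable fun ω => ψ fun i => (X1 (s i) ω, X2 (s i) ω) :=
    hψ.cb.1.continuous.measurable.comp (measurable_pi_lambda _ fun i => (hX1.1 (s i)).prodMk (hX2.1 (s i)))
  have hfm : Measurable fun ω => f (X1 t ω) (X2 t ω) :=
    hg.1.continuous.measurable.comp ((hX1.1 t).prodMk (hX2.1 t))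
  have hexp : ∀ x : ℝ, Complex.exp (Complex.I * (lam : ℂ) * (x : ℂ)) =
      Complex.exp ((lam * x : ℝ) * Complex.I) := fun x => by push_cast; ring_nf
  have hexp' : ∀ x : ℝ, Complex.exp (-((lam : ℂ) ^ 2 / 2) * (x : ℂ)) =
      (Real.exp (-(lam ^ 2 / 2) * x) : ℝ) := fun x => by push_cast; rfl
  simp only [← integral_varDensity hf (hc1 _) (hc2 _), hexp, hexp']
  refine tendsto_of_approx
    (tendsto_integral_riemannSum (M := D) (Y := fun ω => (ψ (fun i => (X1 (s i) ω, X2 (s i) ω)) : ℂ) *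
      Complex.exp ((lam * (f (X1 t ω) (X2 t ω) - f 0 0) : ℝ) * Complex.I)) hX1.1 hX2.1 hc1 hc2
      (cb_varDensity hg) ht
      (hψm.complex_ofReal.mul (((hfm.sub_const _).const_mul lam).complex_ofReal.mul_const _).cexp) (fun ω => ?_) (-(lam ^ 2 / 2)))
    (b := fun K n => M * reductionBound C A (B K) (mesh n) (t / K + mesh n) (nSteps n t * mesh n - t) +
      B' K * (corrSize (mesh n) + covError t K n)) (b' := fun K => M * blockError A t K)
    (fun K _ => ?_) ?_ fun K hK => ?_
  · rw [norm_mul, Complex.norm_exp_ofReal_mul_I, mul_one, Complex.norm_real]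
    exact hD _
  · simpa using ((tendsto_reductionBound C A (B K) ht K).const_mul M).add
      ((tendsto_corrSize.add (tendsto_covError ht K)).const_mul (B' K))
  · simpa using (tendsto_blockError A t).const_mul M
  · filter_upwards [tendsto_corrSize.eventually_le_const one_pos] with n hn
    exact hB K hK n hn

end
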